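/- Let u : ℝ^N → ℝ with values in [−1,1] be a viscosity solution of F(∇u, D²u) + f(u) = 0 in ℝ^N. Assume that lim_{x₁→+∞} u(x₁, x′) = 1 and lim_{x₁→−∞} u(x₁, x′) = −1 uniformly with respect to x′ ∈ ℝ^{N−1}, and, in case α ≠ 0, that for every b < c there exists m > 0 such that |∇u| ≥ m in [b,c] × ℝ^{N−1} in the viscosity sense. Then u does not depend on x′: u(x₁, x′) = v(x₁) for all (x₁, x′), where v : ℝ → ℝ is increasing, takes values in [−1,1], satisfies lim_{x→±∞} v(x) = ±1, and is a viscosity solution of |v′|^α F̃(v″ e₁⊗e₁) + f(v) = 0 on ℝ (e₁⊗e₁ being the matrix with 1 in the (1,1) entry and 0 elsewhere). -/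

import Mathlib

noncomputable section

open Metric Filter Topology Real

/-- `ℝ^N` as a Euclidean space. -/
abbrev ESp (N : ℕ) := EuclideanSpace ℝ (Fin N)

/-- The Hessian matrix of a function `φ : ℝ^N → ℝ` at a point `x`. -/
def hessianMatrix {N : ℕ} (φ : ESp N → ℝ) (x : ESp N) : Matrix (Fin N) (Fin N) ℝ :=
  Matrix.of fun i j =>
    fderiv ℝ (fun y => fderiv ℝ φ y (EuclideanSpace.single j (1 : ℝ))) x
      (EuclideanSpace.single i (1 : ℝ))

/-- `F̃` is positively homogeneous of degree one and uniformly elliptic with constants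
`0 < a ≤ A`, i.e. `a tr(P) ≤ F̃(M+P) - F̃(M) ≤ A tr(P)` for symmetric `M` and
positive semidefinite symmetric `P`. -/
def UniformlyElliptic (N : ℕ) (a A : ℝ) (Ftil : Matrix (Fin N) (Fin N) ℝ → ℝ) : Prop :=
  (∀ t : ℝ, 0 ≤ t → ∀ M : Matrix (Fin N) (Fin N) ℝ, M.IsSymm → Ftil (t • M) = t * Ftil M) ∧
  ∀ M P : Matrix (Fin N) (Fin N) ℝ, M.IsSymm → P.IsSymm → P.PosSemidef →
    a * P.trace ≤ Ftil (M + P) - Ftil M ∧ Ftil (M + P) - Ftil M ≤ A * P.trace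

/-- `v` is a viscosity supersolution of `|∇u|^α F̃(D²u) = g(x,u)` in `Ω`. -/
def ViscSuper {N : ℕ} (α : ℝ) (Ftil : Matrix (Fin N) (Fin N) ℝ → ℝ)
    (g : ESp N → ℝ → ℝ) (Ω : Set (ESp N)) (v : ESp N → ℝ) : Prop :=
  ∀ x₀ ∈ Ω,
    (∃ δ > (0:ℝ), ∃ c : ℝ, ball x₀ δ ⊆ Ω ∧ (∀ x ∈ ball x₀ δ, v x = c) ∧
      ∀ x ∈ ball x₀ δ, 0 ≤ g x c) ∨
    (∀ φ : ESp N → ℝ, ContDiff ℝ 2 φ →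
      IsLocalMin (fun x => v x - φ x) x₀ → gradient φ x₀ ≠ 0 →
      ‖gradient φ x₀‖ ^ α * Ftil (hessianMatrix φ x₀) ≤ g x₀ (v x₀))

/-- `v` is a viscosity subsolution of `|∇u|^α F̃(D²u) = g(x,u)` in `Ω`. -/
def ViscSub {N : ℕ} (α : ℝ) (Ftil : Matrix (Fin N) (Fin N) ℝ → ℝ)
    (g : ESp N → ℝ → ℝ) (Ω : Set (ESp N)) (v : ESp N → ℝ) : Prop :=
  ∀ x₀ ∈ Ω,
    (∃ δ > (0:ℝ), ∃ c : ℝ, ball x₀ δ ⊆ Ω ∧ (∀ x ∈ ball x₀ δ, v x = c) ∧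
      ∀ x ∈ ball x₀ δ, g x c ≤ 0) ∨
    (∀ φ : ESp N → ℝ, ContDiff ℝ 2 φ →
      IsLocalMax (fun x => v x - φ x) x₀ → gradient φ x₀ ≠ 0 →
      g x₀ (v x₀) ≤ ‖gradient φ x₀‖ ^ α * Ftil (hessianMatrix φ x₀))

/-- `v` is a viscosity solution of `|∇u|^α F̃(D²u) = g(x,u)` in `Ω`. -/
def ViscSol {N : ℕ} (α : ℝ) (Ftil : Matrix (Fin N) (Fin N) ℝ → ℝ)
    (g : ESp N → ℝ → ℝ) (Ω : Set (ESp N)) (v : ESp N → ℝ) : Prop :=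
  ViscSub α Ftil g Ω v ∧ ViscSuper α Ftil g Ω v

/-- `|∇u| ≥ m` in `Ω` in the viscosity sense. -/
def GradGE {N : ℕ} (m : ℝ) (Ω : Set (ESp N)) (u : ESp N → ℝ) : Prop :=
  ∀ φ : ESp N → ℝ, ContDiff ℝ 2 φ → ∀ x₀ ∈ Ω,
    (IsLocalMin (fun x => u x - φ x) x₀ ∨ IsLocalMax (fun x => u x - φ x) x₀) →
    m ≤ ‖gradient φ x₀‖

/-- The matrix `e₁ ⊗ e₁`, with 1 in the (1,1) entry and 0 elsewhere. -/
def e11 (N : ℕ) [NeZero N] : Matrix (Fin N) (Fin N) ℝ :=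
  Matrix.of fun i j => if i = 0 ∧ j = 0 then (1 : ℝ) else 0

/-- `v` is a one-dimensional viscosity solution of
`|v'|^α F̃(v'' e₁⊗e₁) + f(v) = 0` on `ℝ`. -/
def ViscSol1D {N : ℕ} [NeZero N] (α : ℝ) (Ftil : Matrix (Fin N) (Fin N) ℝ → ℝ)
    (f : ℝ → ℝ) (v : ℝ → ℝ) : Prop :=
  ∀ x₀ : ℝ,
    ((∃ δ > (0:ℝ), ∃ c : ℝ, (∀ x ∈ ball x₀ δ, v x = c) ∧ -f c ≤ 0) ∨
      (∀ φ : ℝ → ℝ, ContDiff ℝ 2 φ →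
        IsLocalMax (fun x => v x - φ x) x₀ → deriv φ x₀ ≠ 0 →
        -f (v x₀) ≤ |deriv φ x₀| ^ α * Ftil (deriv (deriv φ) x₀ • e11 N))) ∧
    ((∃ δ > (0:ℝ), ∃ c : ℝ, (∀ x ∈ ball x₀ δ, v x = c) ∧ 0 ≤ -f c) ∨
      (∀ φ : ℝ → ℝ, ContDiff ℝ 2 φ →
        IsLocalMin (fun x => v x - φ x) x₀ → deriv φ x₀ ≠ 0 →
        |deriv φ x₀| ^ α * Ftil (deriv (deriv φ) x₀ • e11 N) ≤ -f (v x₀)))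

open scoped RealInnerProductSpace Pointwise

/-- `y` is a subgradient of `ψ` at `x`. -/
def IsSubgrad {V : Type*} [NormedAddCommGroup V] [InnerProductSpace ℝ V]
    (ψ : V → ℝ) (x y : V) : Prop :=
  ∀ x', ψ x + ⟪y, x' - x⟫ ≤ ψ x'

/-- `ψ` has the second-order expansion with gradient `y` and quadratic part `M` at `x`. -/
def TaylorTwo {V : Type*} [NormedAddCommGroup V] [InnerProductSpace ℝ V]
    (ψ : V → ℝ) (x y : V) (M : V →L[ℝ] V) : Prop :=
  ∀ ε > (0:ℝ), ∀ᶠ k in 𝓝 (0 : V), |ψ (x + k) - ψ x - ⟪y, k⟫ - 1 / 2 * ⟪M k, k⟫| ≤ ε * ‖k‖ ^ 2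

section Alexandrov

variable {V : Type*} [NormedAddCommGroup V] [InnerProductSpace ℝ V]

theorem IsSubgrad.monotone {ψ : V → ℝ} {x₁ x₂ y₁ y₂ : V} (h₁ : IsSubgrad ψ x₁ y₁)
    (h₂ : IsSubgrad ψ x₂ y₂) : 0 ≤ ⟪y₁ - y₂, x₁ - x₂⟫ := by
  have e₁ := h₁ x₂
  have e₂ := h₂ x₁
  rw [← neg_sub x₁ x₂, inner_neg_right] at e₁
  rw [inner_sub_left]; linarith

theorem IsSubgrad.norm_sub_le {ψ : V → ℝ} {x₁ x₂ y₁ y₂ : V} (h₁ : IsSubgrad ψ x₁ y₁)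
    (h₂ : IsSubgrad ψ x₂ y₂) : ‖x₁ - x₂‖ ≤ ‖(x₁ + y₁) - (x₂ + y₂)‖ := by
  have h := h₁.monotone h₂
  have e : (x₁ + y₁) - (x₂ + y₂) = (x₁ - x₂) + (y₁ - y₂) := by abel
  rw [e]
  refine le_of_sq_le_sq ?_ (norm_nonneg _)
  rw [norm_add_sq_real, real_inner_comm]
  nlinarith [sq_nonneg ‖y₁ - y₂‖]

variable [FiniteDimensional ℝ V]

theorem continuous_of_subgrad {ψ : V → ℝ} (hψ : ∀ x, ∃ y, IsSubgrad ψ x y) : Continuous ψ := by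
  have hc : ConvexOn ℝ Set.univ ψ := by
    refine ⟨convex_univ, fun x _ z _ s t hs ht hst => ?_⟩
    obtain ⟨y, hy⟩ := hψ (s • x + t • z)
    have h1 := hy x
    have h2 := hy z
    have h3 : s * ⟪y, x - (s • x + t • z)⟫ + t * ⟪y, z - (s • x + t • z)⟫ = 0 := by
      simp only [inner_sub_right, inner_add_right, inner_smul_right]
      have : s = 1 - t := by linarith
      subst this; ring
    simp only [smul_eq_mul]
    have h4 := mul_le_mul_of_nonneg_left h1 hs
    have h5 := mul_le_mul_of_nonneg_left h2 ht
    have h6 : s * ψ (s • x + t • z) + t * ψ (s • x + t • z) = ψ (s • x + t • z) := by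
      rw [← add_mul, hst, one_mul]
    nlinarith
  exact hc.locallyLipschitz.continuous

omit [FiniteDimensional ℝ V] in
theorem IsSubgrad.of_tendsto {ψ : V → ℝ} (hc : Continuous ψ) {x y : V} {xs ys : ℕ → V}
    (hx : Tendsto xs atTop (𝓝 x)) (hy : Tendsto ys atTop (𝓝 y))
    (h : ∀ n, IsSubgrad ψ (xs n) (ys n)) : IsSubgrad ψ x y := by
  intro x'
  have h1 : Tendsto (fun n => ψ (xs n) + ⟪ys n, x' - xs n⟫) atTop (𝓝 (ψ x + ⟪y, x' - x⟫)) :=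
    ((hc.tendsto x).comp hx).add (hy.inner (tendsto_const_nhds.sub hx))
  exact le_of_tendsto h1 (Eventually.of_forall fun n => h n x')

theorem exists_bound_subgrad {ψ : V → ℝ} (hc : Continuous ψ) (x : V) :
    ∃ B : ℝ, ∀ x' y', ‖x' - x‖ ≤ 1 → IsSubgrad ψ x' y' → ‖y'‖ ≤ B := by
  have := FiniteDimensional.proper_real V
  obtain ⟨B, hB⟩ := (isCompact_closedBall x (2:ℝ)).exists_bound_of_continuousOn hc.continuousOn
  refine ⟨2 * B, fun x' y' hx' hy' => ?_⟩
  have hB0 : 0 ≤ B := (norm_nonneg _).trans (hB x (by simp))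
  by_cases h0 : y' = 0
  · subst h0; simp; exact hB0
  have hn : 0 < ‖y'‖ := norm_pos_iff.2 h0
  have h1 := hy' (x' + (‖y'‖)⁻¹ • y')
  rw [add_sub_cancel_left, inner_smul_right, real_inner_self_eq_norm_sq] at h1
  have h2 : ‖y'‖⁻¹ * ‖y'‖ ^ 2 = ‖y'‖ := by field_simp
  rw [h2] at h1
  have h3 := hB x' (by rw [mem_closedBall, dist_eq_norm]; linarith)
  have h4 := hB (x' + (‖y'‖)⁻¹ • y') (by
    rw [mem_closedBall, dist_eq_norm]
    have : ‖(‖y'‖)⁻¹ • y'‖ = 1 := by rw [norm_smul, norm_inv, norm_norm]; field_simp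
    calc ‖x' + (‖y'‖)⁻¹ • y' - x‖ = ‖(x' - x) + (‖y'‖)⁻¹ • y'‖ := by congr 1; abel
      _ ≤ _ := norm_add_le _ _
      _ ≤ 2 := by linarith)
  rw [Real.norm_eq_abs] at h3 h4
  linarith [abs_le.1 h3, abs_le.1 h4]

theorem subgrad_tendsto {ψ : V → ℝ} (hc : Continuous ψ) {x y : V}
    (huniq : ∀ y', IsSubgrad ψ x y' → y' = y) {ε : ℝ} (hε : 0 < ε) :
    ∃ δ > (0:ℝ), ∀ x' y', ‖x' - x‖ < δ → IsSubgrad ψ x' y' → ‖y' - y‖ < ε := by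
  have := FiniteDimensional.proper_real V
  by_contra! H
  have hpos : ∀ n : ℕ, (0:ℝ) < 1 / ((n:ℝ) + 1) := fun n => by positivity
  choose xs ys h1 h2 h3 using fun n : ℕ => H _ (hpos n)
  obtain ⟨B, hB⟩ := exists_bound_subgrad hc x
  have hx : Tendsto xs atTop (𝓝 x) := by
    rw [tendsto_iff_norm_sub_tendsto_zero]
    exact squeeze_zero (fun _ => norm_nonneg _) (fun n => (h1 n).le)
      tendsto_one_div_add_atTop_nhds_zero_nat
  have hyB : ∀ n, ys n ∈ closedBall (0:V) B := fun n => by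
    rw [mem_closedBall_zero_iff]
    refine hB (xs n) _ ((h1 n).le.trans ?_) (h2 n)
    rw [div_le_one (by positivity)]; simp
  obtain ⟨z, -, φ, hφ, hz⟩ := tendsto_subseq_of_bounded isBounded_closedBall hyB
  have hzs : IsSubgrad ψ x z :=
    IsSubgrad.of_tendsto hc (hx.comp hφ.tendsto_atTop) hz (fun n => h2 (φ n))
  have : Tendsto (fun n => ‖(ys ∘ φ) n - y‖) atTop (𝓝 ‖z - y‖) := (hz.sub_const y).norm
  have h4 := ge_of_tendsto this (Eventually.of_forall fun n => h3 (φ n))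
  rw [huniq z hzs] at h4
  simp at h4; linarith

/-- Riemann-sum type estimate: small superlinear increments do not contribute. -/
theorem abs_sub_le_of_increment {G : ℝ → ℝ} {c₁ c₂ : ℝ}
    (h : ∀ t t', 0 ≤ t → t ≤ t' → t' ≤ 1 → |G t' - G t| ≤ c₁ * (t' - t) + c₂ * (t' - t) ^ 2) :
    |G 1 - G 0| ≤ c₁ := by
  have key : ∀ n : ℕ, |G 1 - G 0| ≤ c₁ + c₂ * (1 / ((n:ℝ) + 1)) := by
    intro n
    set m : ℝ := (n:ℝ) + 1 with hm
    have hm0 : 0 < m := by positivity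
    have hk : ∀ k : ℕ, k ≤ n + 1 → |G (k / m) - G 0| ≤ k * (c₁ / m + c₂ / m ^ 2) := by
      intro k
      induction k with
      | zero => intro _; simp
      | succ k ih =>
        intro hk
        have h1 := ih (by omega)
        have hk' : ((k + 1 : ℕ) : ℝ) ≤ m := by rw [hm]; exact_mod_cast hk
        have h2 := h (k / m) ((k + 1 : ℕ) / m) (by positivity)
          (by gcongr; simp) (by rw [div_le_one hm0]; exact hk')
        have h3 : ((k + 1 : ℕ) : ℝ) / m - k / m = 1 / m := by push_cast; ring
        rw [h3] at h2
        have h4 : |G ((k + 1 : ℕ) / m) - G 0| ≤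
            |G ((k + 1 : ℕ) / m) - G (k / m)| + |G (k / m) - G 0| := abs_sub_le _ _ _
        calc _ ≤ _ := h4
          _ ≤ (c₁ * (1 / m) + c₂ * (1 / m) ^ 2) + k * (c₁ / m + c₂ / m ^ 2) := add_le_add h2 h1
          _ = _ := by push_cast; ring
    have h5 := hk (n + 1) le_rfl
    have h6 : ((n + 1 : ℕ) : ℝ) = m := by push_cast; rfl
    rw [h6, div_self hm0.ne'] at h5
    calc _ ≤ _ := h5
      _ = _ := by field_simp
  have hlim : Tendsto (fun n : ℕ => c₁ + c₂ * (1 / ((n:ℝ) + 1))) atTop (𝓝 (c₁ + c₂ * 0)) :=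
    tendsto_const_nhds.add (tendsto_const_nhds.mul tendsto_one_div_add_atTop_nhds_zero_nat)
  have := ge_of_tendsto hlim (Eventually.of_forall key)
  simpa using this

omit [FiniteDimensional ℝ V] in
theorem taylorTwo_of_subgrad_expansion {ψ : V → ℝ} (hψ : ∀ x, ∃ y, IsSubgrad ψ x y)
    {x y : V} {M : V →L[ℝ] V}
    (hM : ∀ ε > (0:ℝ), ∃ δ > (0:ℝ), ∀ x' y', ‖x' - x‖ < δ → IsSubgrad ψ x' y' →
      ‖y' - y - M (x' - x)‖ ≤ ε * ‖x' - x‖) : TaylorTwo ψ x y M := by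
  intro ε hε
  obtain ⟨δ, hδ, H⟩ := hM ε hε
  filter_upwards [ball_mem_nhds (0:V) hδ] with h hh
  rw [mem_ball_zero_iff] at hh
  set G : ℝ → ℝ := fun t => ψ (x + t • h) - ψ x - t * ⟪y, h⟫ - 1 / 2 * t ^ 2 * ⟪M h, h⟫ with hG
  have hgrad : ∀ t, 0 ≤ t → t ≤ 1 → ∀ z, IsSubgrad ψ (x + t • h) z →
      |⟪z, h⟫ - ⟪y, h⟫ - t * ⟪M h, h⟫| ≤ ε * ‖h‖ ^ 2 := by
    intro t ht0 ht1 z hz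
    have hth : ‖t • h‖ ≤ ‖h‖ := by
      rw [norm_smul, Real.norm_of_nonneg ht0]
      exact mul_le_of_le_one_left (norm_nonneg _) ht1
    have h1 := H _ z (by rw [add_sub_cancel_left]; linarith) hz
    rw [add_sub_cancel_left] at h1
    have h2 : ⟪z, h⟫ - ⟪y, h⟫ - t * ⟪M h, h⟫ = ⟪z - y - M (t • h), h⟫ := by
      rw [map_smul, inner_sub_left, inner_sub_left, real_inner_smul_left]
    rw [h2]
    calc _ ≤ ‖z - y - M (t • h)‖ * ‖h‖ := abs_real_inner_le_norm _ _
      _ ≤ ε * ‖h‖ * ‖h‖ := by gcongr; exact h1.trans (by gcongr)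
      _ = _ := by ring
  have hinc := abs_sub_le_of_increment (G := G) (c₁ := ε * ‖h‖ ^ 2) (c₂ := 1 / 2 * |⟪M h, h⟫|)
    (by
      intro t t' ht htt' ht'
      obtain ⟨z, hz⟩ := hψ (x + t • h)
      obtain ⟨z', hz'⟩ := hψ (x + t' • h)
      have e1 := hgrad t ht (htt'.trans ht') z hz
      have e2 := hgrad t' (ht.trans htt') ht' z' hz'
      have d : x + t' • h - (x + t • h) = (t' - t) • h := by rw [sub_smul]; abel
      have d' : x + t • h - (x + t' • h) = -((t' - t) • h) := by rw [sub_smul]; abel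
      have f1 := hz (x + t' • h)
      have f2 := hz' (x + t • h)
      rw [d, inner_smul_right] at f1
      rw [d', inner_neg_right, inner_smul_right] at f2
      have hs : 0 ≤ t' - t := sub_nonneg.2 htt'
      have hG' : G t' - G t = ψ (x + t' • h) - ψ (x + t • h) - (t' - t) * ⟪y, h⟫
        - 1 / 2 * (t' ^ 2 - t ^ 2) * ⟪M h, h⟫ := by simp only [hG]; ring
      rw [abs_le] at e1 e2
      have k1 := mul_le_mul_of_nonneg_left e1.1 hs
      have k2 := mul_le_mul_of_nonneg_left e2.2 hs
      have m1 := mul_le_mul_of_nonneg_left (le_abs_self ⟪M h, h⟫) (sq_nonneg (t' - t))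
      have m2 := mul_le_mul_of_nonneg_left (neg_abs_le ⟪M h, h⟫) (sq_nonneg (t' - t))
      rw [hG', abs_le]
      constructor <;> nlinarith)
  have g1 : G 1 - G 0 = ψ (x + h) - ψ x - ⟪y, h⟫ - 1 / 2 * ⟪M h, h⟫ := by
    simp [hG]
  rwa [g1] at hinc

end Alexandrov

section Alexandrov

open MeasureTheory

variable {V : Type*} [NormedAddCommGroup V] [InnerProductSpace ℝ V] [FiniteDimensional ℝ V]

theorem taylorTwo_of_resolvent {ψ : V → ℝ} (hψ : ∀ x, ∃ y, IsSubgrad ψ x y) {g : V → V}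
    (hg : ∀ x y, IsSubgrad ψ x y → g (x + y) = x) {x y : V} (hy : IsSubgrad ψ x y)
    (hd : DifferentiableAt ℝ g (x + y)) (hdet : (fderiv ℝ g (x + y)).det ≠ 0) :
    ∃ M : V →L[ℝ] V, TaylorTwo ψ x y M := by
  set D := fderiv ℝ g (x + y) with hD
  set T := D.toContinuousLinearEquivOfDetNeZero hdet with hT
  have hTD : ∀ v, T v = D v := fun v => rfl
  set S : V →L[ℝ] V := (T.symm : V →L[ℝ] V) with hS
  have hSD : ∀ v, S (D v) = v := fun v => by
    rw [← hTD]; exact T.symm_apply_apply v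
  have hgd : HasFDerivAt g D (x + y) := hd.hasFDerivAt
  -- uniqueness of the subgradient
  have huniq : ∀ y', IsSubgrad ψ x y' → y' = y := by
    intro y' hy'
    have hseg : ∀ t ∈ Set.Icc (0:ℝ) 1, g (x + y + t • (y' - y)) = x := by
      intro t ht
      have : IsSubgrad ψ x (y + t • (y' - y)) := by
        intro z
        have e1 := hy z
        have e2 := hy' z
        rw [inner_add_left, real_inner_smul_left, inner_sub_left]
        nlinarith [mul_le_mul_of_nonneg_left e1 (sub_nonneg.2 ht.2),
          mul_le_mul_of_nonneg_left e2 ht.1]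
      rw [add_assoc]; exact hg _ _ this
    have hline : HasDerivAt (fun t : ℝ => g (x + y + t • (y' - y))) (D (y' - y)) 0 := by
      have h1 : HasDerivAt (fun t : ℝ => x + y + t • (y' - y)) (y' - y) 0 := by
        simpa using ((hasDerivAt_id (0:ℝ)).smul_const (y' - y)).const_add (x + y)
      have h2 : HasFDerivAt g D (x + y + (0:ℝ) • (y' - y)) := by simpa using hgd
      exact h2.comp_hasDerivAt 0 h1
    have h3 : HasDerivWithinAt (fun t : ℝ => g (x + y + t • (y' - y))) (0:V) (Set.Icc 0 1) 0 := by
      refine (hasDerivWithinAt_const (0:ℝ) (Set.Icc (0:ℝ) 1) x).congr (fun t ht => hseg t ht) ?_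
      exact hseg 0 (by simp)
    have h4 : D (y' - y) = 0 :=
      (uniqueDiffOn_Icc_zero_one 0 (by simp)).eq_deriv _ hline.hasDerivWithinAt h3
    have h5 := hSD (y' - y)
    rw [h4, map_zero] at h5
    exact (sub_eq_zero.1 h5.symm)
  have hc := continuous_of_subgrad hψ
  refine ⟨S - ContinuousLinearMap.id ℝ V, taylorTwo_of_subgrad_expansion hψ ?_⟩
  intro ε hε
  set c : ℝ := ‖S‖ + 1 with hcdef
  have hc0 : 0 < c := by positivity
  -- smallness for the differentiability of `g`
  set η : ℝ := min (1 / (2 * c)) (ε / (2 * c ^ 2)) with hη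
  have hη0 : 0 < η := by positivity
  have hlo := (hasFDerivAt_iff_isLittleO_nhds_zero.1 hgd).def hη0
  obtain ⟨r, hr, hlo⟩ := Metric.eventually_nhds_iff_ball.1 hlo
  obtain ⟨δ, hδ, hδy⟩ := subgrad_tendsto hc huniq (half_pos hr)
  refine ⟨min δ (r / 2), lt_min hδ (half_pos hr), fun x' y' hx' hy' => ?_⟩
  have hx1 : ‖x' - x‖ < δ := hx'.trans_le (min_le_left _ _)
  have hx2 : ‖x' - x‖ < r / 2 := hx'.trans_le (min_le_right _ _)
  have hy2 := hδy x' y' hx1 hy'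
  set s : V := (x' - x) + (y' - y) with hs
  have hsr : s ∈ ball (0:V) r := by
    rw [mem_ball_zero_iff]
    calc ‖s‖ ≤ ‖x' - x‖ + ‖y' - y‖ := norm_add_le _ _
      _ < r := by linarith
  have h1 := hlo s hsr
  have e1 : x + y + s = x' + y' := by rw [hs]; abel
  rw [e1, hg x' y' hy', hg x y hy] at h1
  -- apply the inverse
  have h2 : ‖S (x' - x) - s‖ ≤ c * (η * ‖s‖) := by
    have : S (x' - x) - s = S (x' - x - D s) := by rw [map_sub S (x' - x), hSD]
    rw [this]
    calc _ ≤ ‖S‖ * ‖x' - x - D s‖ := S.le_opNorm _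
      _ ≤ c * (η * ‖s‖) := by gcongr; linarith
  have hcη : c * η ≤ 1 / 2 := by
    calc c * η ≤ c * (1 / (2 * c)) := by gcongr; exact min_le_left _ _
      _ = 1 / 2 := by field_simp
  have h3 : ‖s‖ ≤ 2 * c * ‖x' - x‖ := by
    have i1 : ‖s‖ ≤ ‖S (x' - x)‖ + ‖S (x' - x) - s‖ := by
      calc ‖s‖ = ‖S (x' - x) - (S (x' - x) - s)‖ := by congr 1; abel
        _ ≤ _ := norm_sub_le _ _
    have i2 : ‖S (x' - x)‖ ≤ c * ‖x' - x‖ :=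
      (S.le_opNorm _).trans (by gcongr; linarith)
    have i3 : c * (η * ‖s‖) ≤ 1 / 2 * ‖s‖ := by
      rw [← mul_assoc]; gcongr
    linarith
  have e2 : y' - y - (S - ContinuousLinearMap.id ℝ V) (x' - x) = -(S (x' - x) - s) := by
    simp only [sub_apply, ContinuousLinearMap.id_apply, hs]; abel
  rw [e2, norm_neg]
  calc _ ≤ _ := h2
    _ ≤ c * (ε / (2 * c ^ 2) * (2 * c * ‖x' - x‖)) := by
        gcongr; exact min_le_right _ _
    _ = ε * ‖x' - x‖ := by field_simp

/-- **Alexandrov's theorem** for everywhere subdifferentiable functions. -/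
theorem ae_taylorTwo_of_subgrad [MeasurableSpace V] [BorelSpace V]
    {ψ : V → ℝ} (hψ : ∀ x, ∃ y, IsSubgrad ψ x y) :
    ∀ᵐ x ∂(μH[Module.finrank ℝ V] : Measure V),
      ∃ y, ∃ M : V →L[ℝ] V, TaylorTwo ψ x y M := by
  classical
  set μ : Measure V := μH[Module.finrank ℝ V] with hμ
  have : μ.IsAddHaarMeasure := isAddHaarMeasure_hausdorffMeasure
  set S : Set V := {s | ∃ x y, IsSubgrad ψ x y ∧ x + y = s} with hS
  set J : V → V := fun s => if h : s ∈ S then h.choose else 0 with hJ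
  have hJs : ∀ x y, IsSubgrad ψ x y → J (x + y) = x := by
    intro x y hxy
    have hm : x + y ∈ S := ⟨x, y, hxy, rfl⟩
    simp only [hJ, hm, dif_pos]
    obtain ⟨y', hy', e⟩ := hm.choose_spec
    have := hy'.norm_sub_le hxy
    rw [e, sub_self, norm_zero] at this
    exact sub_eq_zero.1 (norm_eq_zero.1 (le_antisymm this (norm_nonneg _)))
  have hJL : LipschitzOnWith 1 J S := by
    refine LipschitzOnWith.of_dist_le_mul ?_
    rintro _ ⟨x, y, h, rfl⟩ _ ⟨x', y', h', rfl⟩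
    rw [hJs _ _ h, hJs _ _ h', dist_eq_norm, dist_eq_norm, NNReal.coe_one, one_mul]
    exact h.norm_sub_le h'
  obtain ⟨g, hgL, hgJ⟩ := hJL.extend_finite_dimension
  have hg : ∀ x y, IsSubgrad ψ x y → g (x + y) = x := fun x y h => by
    rw [← hgJ ⟨x, y, h, rfl⟩, hJs x y h]
  have hnull1 : μ (g '' {s | ¬ DifferentiableAt ℝ g s}) = 0 :=
by
    have h0 : μ {s | ¬ DifferentiableAt ℝ g s} = 0 := hgL.ae_differentiableAt (μ := μ)
    have := hgL.hausdorffMeasure_image_le (d := Module.finrank ℝ V) (Nat.cast_nonneg _)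
      {s | ¬ DifferentiableAt ℝ g s}
    rw [← hμ, h0, mul_zero] at this
    exact le_antisymm this zero_le
  have hnull2 : μ (g '' {s | DifferentiableAt ℝ g s ∧ (fderiv ℝ g s).det = 0}) = 0 :=
    addHaar_image_eq_zero_of_det_fderivWithin_eq_zero μ
      (fun s hs => hs.1.hasFDerivAt.hasFDerivWithinAt) (fun s hs => hs.2)
  have h1 := measure_eq_zero_iff_ae_notMem.1 hnull1
  have h2 := measure_eq_zero_iff_ae_notMem.1 hnull2
  filter_upwards [h1, h2] with x hx1 hx2
  obtain ⟨y, hy⟩ := hψ x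
  have hd : DifferentiableAt ℝ g (x + y) := by
    by_contra h
    exact hx1 ⟨x + y, h, hg x y hy⟩
  have hdet : (fderiv ℝ g (x + y)).det ≠ 0 := fun h => hx2 ⟨x + y, ⟨hd, h⟩, hg x y hy⟩
  exact ⟨y, taylorTwo_of_resolvent hψ hg hy hd hdet⟩

omit [FiniteDimensional ℝ V] in
theorem eq_zero_of_inner_le_sq {v : V} {c : ℝ}
    (h : ∀ᶠ k in 𝓝 (0:V), ⟪v, k⟫ ≤ c * ‖k‖ ^ 2) : v = 0 := by
  have h1 : Tendsto (fun t : ℝ => t • v) (𝓝[>] 0) (𝓝 (0:V)) := by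
    have : Tendsto (fun t : ℝ => t • v) (𝓝 0) (𝓝 ((0:ℝ) • v)) :=
      (continuous_id.smul continuous_const).tendsto 0
    rw [zero_smul] at this
    exact this.mono_left nhdsWithin_le_nhds
  have h2 : ∀ᶠ t : ℝ in 𝓝[>] 0, ‖v‖ ^ 2 ≤ t * (c * ‖v‖ ^ 2) := by
    filter_upwards [h1.eventually h, self_mem_nhdsWithin] with t ht ht0
    rw [inner_smul_right, real_inner_self_eq_norm_sq, norm_smul, mul_pow, Real.norm_eq_abs,
      sq_abs] at ht
    have ht0' : (0:ℝ) < t := ht0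
    refine le_of_mul_le_mul_left ?_ ht0'
    linarith
  have h3 : Tendsto (fun t : ℝ => t * (c * ‖v‖ ^ 2)) (𝓝[>] 0) (𝓝 (0 * (c * ‖v‖ ^ 2))) :=
    (tendsto_id.mono_left nhdsWithin_le_nhds).mul_const _
  have h4 := ge_of_tendsto h3 h2
  rw [zero_mul] at h4
  have : ‖v‖ = 0 := by nlinarith [norm_nonneg v]
  exact norm_eq_zero.1 this

omit [FiniteDimensional ℝ V] in
theorem le_of_eventually_quadratic {a b : V → ℝ} (ha : ∀ (t : ℝ) k, a (t • k) = t ^ 2 * a k)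
    (hb : ∀ (t : ℝ) k, b (t • k) = t ^ 2 * b k)
    (h : ∀ ε > (0:ℝ), ∀ᶠ k in 𝓝 (0:V), a k ≤ b k + ε * ‖k‖ ^ 2) (k : V) : a k ≤ b k := by
  have key : ∀ ε > (0:ℝ), a k ≤ b k + ε * ‖k‖ ^ 2 := by
    intro ε hε
    have h1 : Tendsto (fun t : ℝ => t • k) (𝓝[>] 0) (𝓝 (0:V)) := by
      have : Tendsto (fun t : ℝ => t • k) (𝓝 0) (𝓝 ((0:ℝ) • k)) :=
        (continuous_id.smul continuous_const).tendsto 0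
      rw [zero_smul] at this
      exact this.mono_left nhdsWithin_le_nhds
    obtain ⟨t, ht, ht0⟩ := ((h1.eventually (h ε hε)).and self_mem_nhdsWithin).exists
    have ht0' : (0:ℝ) < t := ht0
    rw [ha, hb, norm_smul, mul_pow, Real.norm_eq_abs, sq_abs] at ht
    have : 0 < t ^ 2 := by positivity
    refine le_of_mul_le_mul_left ?_ this
    linarith
  by_contra! hlt
  have h2 := key ((a k - b k) / (2 * (‖k‖ ^ 2 + 1))) (by
    have := sub_pos.2 hlt; positivity)
  have h3 : (a k - b k) / (2 * (‖k‖ ^ 2 + 1)) * ‖k‖ ^ 2 ≤ (a k - b k) / 2 := by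
    rw [div_mul_eq_mul_div, div_le_div_iff₀ (by positivity) (by norm_num)]
    nlinarith [sub_pos.2 hlt, sq_nonneg ‖k‖]
  linarith

omit [FiniteDimensional ℝ V] in
theorem inner_map_smul_self (M : V →L[ℝ] V) (t : ℝ) (k : V) :
    ⟪M (t • k), t • k⟫ = t ^ 2 * ⟪M k, k⟫ := by
  rw [map_smul, real_inner_smul_left, inner_smul_right]; ring

omit [FiniteDimensional ℝ V] in
theorem abs_inner_map_self_le (M : V →L[ℝ] V) (k : V) : |⟪M k, k⟫| ≤ ‖M‖ * ‖k‖ ^ 2 := by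
  calc _ ≤ ‖M k‖ * ‖k‖ := abs_real_inner_le_norm _ _
    _ ≤ ‖M‖ * ‖k‖ * ‖k‖ := by gcongr; exact M.le_opNorm k
    _ = _ := by ring

/-- **Jensen's lemma**, combined with Alexandrov's theorem, for semiconvex functions. -/
theorem exists_taylorTwo_near_strict_max {w : V → ℝ} {C : ℝ}
    (hw : ∀ z, ∃ ζ, ∀ z', w z + ⟪ζ, z' - z⟫ - C / 2 * ‖z' - z‖ ^ 2 ≤ w z')
    {T : V →L[ℝ] V} (hT : ∀ x y, ⟪T x, y⟫ = ⟪x, T y⟫) {P zh : V} {r γ : ℝ} (hr : 0 < r)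
    (hγ : 0 < γ)
    (hmax : ∀ z, r / 4 ≤ ‖z - zh‖ → ‖z - zh‖ ≤ r →
      w z - ⟪P, z - zh⟫ - 1 / 2 * ⟪T (z - zh), z - zh⟫ + γ < w zh)
    {ρ : ℝ} (hρ : 0 < ρ) :
    ∃ z P' : V, ∃ M : V →L[ℝ] V, ‖z - zh‖ ≤ r / 4 ∧ TaylorTwo w z P' M ∧
      ‖P' - P - T (z - zh)‖ ≤ ρ ∧ ∀ k, ⟪M k, k⟫ ≤ ⟪T k, k⟫ := by
  borelize V
  have := FiniteDimensional.proper_real V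
  -- the convex function
  set ψ : V → ℝ := fun z => w z + C / 2 * ‖z‖ ^ 2 with hψdef
  have hψ : ∀ x, ∃ y, IsSubgrad ψ x y := by
    intro z
    obtain ⟨ζ, hζ⟩ := hw z
    refine ⟨ζ + C • z, fun z' => ?_⟩
    have h1 := hζ z'
    have h2 := norm_sub_sq_real z' z
    rw [inner_add_left, real_inner_smul_left, inner_sub_right z, real_inner_self_eq_norm_sq,
      real_inner_comm z' z]
    simp only [hψdef]
    rw [h2] at h1
    linarith
  have hwc : Continuous w := by
    have h1 := continuous_of_subgrad hψ
    have : w = fun z => ψ z - C / 2 * ‖z‖ ^ 2 := by funext z; simp [hψdef]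
    rw [this]; fun_prop
  have hA := ae_taylorTwo_of_subgrad hψ
  choose ζ hζ using hw
  set c := ‖T‖ with hc
  -- contact points
  set ρ' := min ρ (γ / r) with hρ'
  have hρ'0 : 0 < ρ' := lt_min hρ (by positivity)
  set Q : V → V → V := fun z p => P + T (z - zh) + p with hQ
  set K : Set V := {z | ‖z - zh‖ ≤ r / 4 ∧ ∃ p, ‖p‖ < ρ' ∧ ∀ z', ‖z' - zh‖ ≤ r →
    w z' ≤ w z + ⟪Q z p, z' - z⟫ + 1 / 2 * ⟪T (z' - z), z' - z⟫} with hK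
  have hloc : ∀ z p, ‖z - zh‖ ≤ r / 4 → (∀ z', ‖z' - zh‖ ≤ r →
      w z' ≤ w z + ⟪Q z p, z' - z⟫ + 1 / 2 * ⟪T (z' - z), z' - z⟫) →
      ∀ᶠ k in 𝓝 (0:V), w (z + k) ≤ w z + ⟪Q z p, k⟫ + 1 / 2 * ⟪T k, k⟫ := by
    intro z p hz h
    filter_upwards [ball_mem_nhds (0:V) (half_pos hr)] with k hk
    rw [mem_ball_zero_iff] at hk
    have := h (z + k) (by
      calc ‖z + k - zh‖ = ‖(z - zh) + k‖ := by congr 1; abel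
        _ ≤ _ := norm_add_le _ _
        _ ≤ r := by linarith)
    rwa [add_sub_cancel_left] at this
  have hζQ : ∀ z p, ‖z - zh‖ ≤ r / 4 → (∀ z', ‖z' - zh‖ ≤ r →
      w z' ≤ w z + ⟪Q z p, z' - z⟫ + 1 / 2 * ⟪T (z' - z), z' - z⟫) → ζ z = Q z p := by
    intro z p hz h
    refine sub_eq_zero.1 (eq_zero_of_inner_le_sq (c := c + C / 2) ?_)
    filter_upwards [hloc z p hz h] with k hk
    have h1 := hζ z (z + k)
    rw [add_sub_cancel_left] at h1
    rw [inner_sub_left]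
    have h2 := (abs_le.1 (abs_inner_map_self_le T k)).2
    have : 0 ≤ c * ‖k‖ ^ 2 := by positivity
    linarith
  -- the gradient map is Lipschitz on the contact set
  set Φ : V → V := fun z => ζ z - P - T (z - zh) with hΦ
  have hLip : LipschitzOnWith (Real.toNNReal (2 * |C| + 2 * c)) Φ K := by
    refine LipschitzOnWith.of_dist_le_mul ?_
    rintro z₁ ⟨hz₁, p₁, hp₁, h₁⟩ z₂ ⟨hz₂, p₂, hp₂, h₂⟩
    rw [Real.coe_toNNReal _ (by positivity), dist_eq_norm, dist_eq_norm]
    have e₁ := hζQ z₁ p₁ hz₁ h₁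
    have e₂ := hζQ z₂ p₂ hz₂ h₂
    rw [← e₁] at h₁
    rw [← e₂] at h₂
    set d := ‖z₁ - z₂‖ with hd
    have hdr : d ≤ r / 2 := by
      calc d = ‖(z₁ - zh) - (z₂ - zh)‖ := by rw [hd]; congr 1; abel
        _ ≤ _ := norm_sub_le _ _
        _ ≤ _ := by linarith
    have hd0 : 0 ≤ d := norm_nonneg _
    have main : ‖ζ z₂ - ζ z₁‖ ≤ (2 * |C| + c) * d := by
      by_cases h0 : ζ z₂ - ζ z₁ = 0
      · rw [h0, norm_zero]; positivity
      by_cases hd00 : d = 0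
      · have : z₁ = z₂ := sub_eq_zero.1 (norm_eq_zero.1 hd00)
        rw [this, sub_self, norm_zero]; positivity
      have hn : 0 < ‖ζ z₂ - ζ z₁‖ := norm_pos_iff.2 h0
      have hdp : 0 < d := lt_of_le_of_ne hd0 (Ne.symm hd00)
      set h : V := (d * ‖ζ z₂ - ζ z₁‖⁻¹) • (ζ z₂ - ζ z₁) with hh
      have hhn : ‖h‖ = d := by
        rw [hh, norm_smul, Real.norm_of_nonneg (by positivity)]; field_simp
      have hhi : ⟪ζ z₂ - ζ z₁, h⟫ = d * ‖ζ z₂ - ζ z₁‖ := by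
        rw [hh, inner_smul_right, real_inner_self_eq_norm_sq]; field_simp
      have i1 := h₁ (z₁ + h) (by
        calc ‖z₁ + h - zh‖ = ‖(z₁ - zh) + h‖ := by congr 1; abel
          _ ≤ _ := norm_add_le _ _
          _ ≤ r := by linarith)
      have i2 := hζ z₂ (z₁ + h)
      have i3 := h₂ z₁ (hz₁.trans (by linarith))
      rw [add_sub_cancel_left] at i1
      have e3 : z₁ + h - z₂ = (z₁ - z₂) + h := by abel
      rw [e3, inner_add_right] at i2
      rw [inner_sub_left] at hhi
      have j1 := (abs_le.1 (abs_inner_map_self_le T h)).2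
      have j2 := (abs_le.1 (abs_inner_map_self_le T (z₁ - z₂))).2
      rw [hhn] at j1
      rw [← hd] at j2
      have j3 : ‖(z₁ - z₂) + h‖ ≤ 2 * d := (norm_add_le _ _).trans (by rw [hhn]; linarith)
      have j4 : C / 2 * ‖(z₁ - z₂) + h‖ ^ 2 ≤ |C| / 2 * (2 * d) ^ 2 := by
        have : C ≤ |C| := le_abs_self C
        have : ‖(z₁ - z₂) + h‖ ^ 2 ≤ (2 * d) ^ 2 := by gcongr
        calc _ ≤ |C| / 2 * ‖(z₁ - z₂) + h‖ ^ 2 := by gcongr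
          _ ≤ _ := by gcongr
      have fin : d * ‖ζ z₂ - ζ z₁‖ ≤ d * ((2 * |C| + c) * d) := by
        rw [← hhi]
        nlinarith
      exact le_of_mul_le_mul_left fin hdp
    calc ‖Φ z₁ - Φ z₂‖ = ‖-(ζ z₂ - ζ z₁) - T (z₁ - z₂)‖ := by
          congr 1
          have : T (z₁ - z₂) = T (z₁ - zh) - T (z₂ - zh) := by rw [← map_sub]; congr 1; abel
          rw [this]; simp only [hΦ]; abel
      _ ≤ ‖ζ z₂ - ζ z₁‖ + ‖T (z₁ - z₂)‖ := by
          refine (norm_sub_le _ _).trans ?_; rw [norm_neg]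
      _ ≤ (2 * |C| + c) * d + c * d := add_le_add main (T.le_opNorm _)
      _ = _ := by ring
  -- it is onto a ball
  have honto : ball (0:V) ρ' ⊆ Φ '' K := by
    intro p hp
    rw [mem_ball_zero_iff] at hp
    obtain ⟨z, hz, hzmax⟩ := (isCompact_closedBall zh r).exists_isMaxOn
      (f := fun z => w z - ⟪P, z - zh⟫ - 1 / 2 * ⟪T (z - zh), z - zh⟫ - ⟪p, z - zh⟫)
      ⟨zh, mem_closedBall_self hr.le⟩ (by fun_prop)
    rw [mem_closedBall, dist_eq_norm] at hz
    have hzr : ‖z - zh‖ ≤ r / 4 := by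
      by_contra! hlt
      have h1 := hmax z hlt.le hz
      have h2 := isMaxOn_iff.1 hzmax zh (mem_closedBall_self hr.le)
      simp only [sub_self, inner_zero_right, map_zero, mul_zero, sub_zero] at h2
      have h3 : -⟪p, z - zh⟫ ≤ γ := by
        have : |⟪p, z - zh⟫| ≤ ‖p‖ * ‖z - zh‖ := abs_real_inner_le_norm _ _
        have h4 : ‖p‖ * ‖z - zh‖ ≤ (γ / r) * r := by
          gcongr
          exact hp.le.trans (min_le_right _ _)
        rw [div_mul_cancel₀ _ hr.ne'] at h4
        linarith [(abs_le.1 this).1]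
      linarith
    have hcontact : ∀ z', ‖z' - zh‖ ≤ r →
        w z' ≤ w z + ⟪Q z p, z' - z⟫ + 1 / 2 * ⟪T (z' - z), z' - z⟫ := by
      intro z' hz'
      have h1 := isMaxOn_iff.1 hzmax z' (by rwa [mem_closedBall, dist_eq_norm])
      have e : z' - zh = (z - zh) + (z' - z) := by abel
      have e2 : ⟪T (z' - z), z - zh⟫ = ⟪T (z - zh), z' - z⟫ := by
        rw [hT, real_inner_comm]
      rw [e, map_add, inner_add_right, inner_add_right, inner_add_right, inner_add_left,
        inner_add_left, e2] at h1
      simp only [hQ, inner_add_left]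
      linarith
    refine ⟨z, ⟨hzr, p, hp, hcontact⟩, ?_⟩
    simp only [hΦ]
    rw [hζQ z p hzr hcontact]
    simp only [hQ]; abel
  have hKpos : (μH[Module.finrank ℝ V] : Measure V) K ≠ 0 := by
    intro h0
    have h1 := hLip.hausdorffMeasure_image_le (d := Module.finrank ℝ V) (Nat.cast_nonneg _)
    rw [h0, mul_zero] at h1
    have : (μH[Module.finrank ℝ V] : Measure V).IsAddHaarMeasure := isAddHaarMeasure_hausdorffMeasure
    have h2 : (μH[Module.finrank ℝ V] : Measure V) (ball 0 ρ') = 0 :=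
      le_antisymm ((measure_mono honto).trans h1) zero_le
    exact (measure_ball_pos _ (0:V) hρ'0).ne' h2
  obtain ⟨z, hzK, y, M', hM'⟩ : ∃ z ∈ K, ∃ y, ∃ M : V →L[ℝ] V, TaylorTwo ψ z y M := by
    by_contra! hcon
    refine hKpos (measure_mono_null (fun z hz => ?_) (ae_iff.1 hA))
    intro ⟨y, M, h⟩
    exact hcon z hz y M h
  obtain ⟨hz, p, hp, hcon⟩ := hzK
  have hup := hloc z p hz hcon
  set P' := y - C • z with hP'
  set M := M' - C • ContinuousLinearMap.id ℝ V with hM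
  have hTay : TaylorTwo w z P' M := by
    intro ε hε
    filter_upwards [hM' ε hε] with k hk
    have : w (z + k) - w z - ⟪P', k⟫ - 1 / 2 * ⟪M k, k⟫ =
        ψ (z + k) - ψ z - ⟪y, k⟫ - 1 / 2 * ⟪M' k, k⟫ := by
      simp only [hψdef, hP', hM, sub_apply, smul_apply,
        ContinuousLinearMap.id_apply, inner_sub_left, real_inner_smul_left, norm_add_sq_real,
        real_inner_self_eq_norm_sq]
      ring
    rwa [this]
  have hPQ : P' = Q z p := by
    refine sub_eq_zero.1 (eq_zero_of_inner_le_sq (c := c + ‖M‖ + 1) ?_)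
    filter_upwards [hup, hTay 1 one_pos] with k hk1 hk2
    rw [inner_sub_left]
    have h2 := (abs_le.1 (abs_inner_map_self_le T k)).2
    have h3 := (abs_le.1 (abs_inner_map_self_le M k)).1
    have : 0 ≤ c * ‖k‖ ^ 2 := by positivity
    have : 0 ≤ ‖M‖ * ‖k‖ ^ 2 := by positivity
    nlinarith [(abs_le.1 hk2).1]
  refine ⟨z, P', M, hz, hTay, ?_, ?_⟩
  · have : P' - P - T (z - zh) = p := by rw [hPQ]; simp only [hQ]; abel
    rw [this]; exact hp.le.trans (min_le_left _ _)
  · refine le_of_eventually_quadratic (inner_map_smul_self M) (inner_map_smul_self T) ?_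
    intro ε hε
    filter_upwards [hup, hTay (ε / 2) (by positivity)] with k hk1 hk2
    rw [hPQ] at hk2
    linarith [(abs_le.1 hk2).1]

end Alexandrov

/-- The function `u` is locally bounded above by a paraboloid touching it at `x`. -/
def JetAbove {V : Type*} [NormedAddCommGroup V] [InnerProductSpace ℝ V]
    (u : V → ℝ) (x p : V) (b : V → ℝ) : Prop :=
  ∀ᶠ k in 𝓝 (0 : V), u (x + k) ≤ u x + ⟪p, k⟫ + 1 / 2 * b k

/-- The function `u` is locally bounded below by a paraboloid touching it at `x`. -/
def JetBelow {V : Type*} [NormedAddCommGroup V] [InnerProductSpace ℝ V]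
    (u : V → ℝ) (x p : V) (b : V → ℝ) : Prop :=
  ∀ᶠ k in 𝓝 (0 : V), u x + ⟪p, k⟫ + 1 / 2 * b k ≤ u (x + k)

section SupConvolution

variable {V : Type*} [NormedAddCommGroup V] [InnerProductSpace ℝ V] [FiniteDimensional ℝ V]

theorem exists_supConvolution {U : V → ℝ} (hU : Continuous U) {C₀ : ℝ} (hC : ∀ x, |U x| ≤ C₀)
    {c : ℝ} (hc : 0 < c) : ∃ (a : V → ℝ) (m : V → V),
      (∀ x, a x = U (m x) - c / 2 * ‖x - m x‖ ^ 2) ∧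
      (∀ x x', U x' - c / 2 * ‖x - x'‖ ^ 2 ≤ a x) ∧ ∀ x, ‖x - m x‖ ^ 2 ≤ 4 * C₀ / c := by
  have := FiniteDimensional.proper_real V
  have hC0 : 0 ≤ C₀ := (abs_nonneg _).trans (hC 0)
  have hbd : ∀ x x', U x - c / 2 * ‖x - x‖ ^ 2 ≤ U x' - c / 2 * ‖x - x'‖ ^ 2 →
      ‖x - x'‖ ^ 2 ≤ 4 * C₀ / c := by
    intro x x' h
    rw [sub_self, norm_zero] at h
    rw [le_div_iff₀ hc]
    linarith [abs_le.1 (hC x), abs_le.1 (hC x')]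
  have hex : ∀ x, ∃ y, ∀ x', U x' - c / 2 * ‖x - x'‖ ^ 2 ≤ U y - c / 2 * ‖x - y‖ ^ 2 := by
    intro x
    obtain ⟨y, hy, hmax⟩ := (isCompact_closedBall x (Real.sqrt (4 * C₀ / c))).exists_isMaxOn
      (f := fun x' => U x' - c / 2 * ‖x - x'‖ ^ 2)
      ⟨x, mem_closedBall_self (Real.sqrt_nonneg _)⟩ (by fun_prop)
    refine ⟨y, fun x' => ?_⟩
    by_cases h : x' ∈ closedBall x (Real.sqrt (4 * C₀ / c))
    · exact hmax h
    · have h1 : U x - c / 2 * ‖x - x‖ ^ 2 ≤ U y - c / 2 * ‖x - y‖ ^ 2 :=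
        hmax (mem_closedBall_self (Real.sqrt_nonneg _))
      refine le_trans ?_ h1
      by_contra! h2
      refine h ?_
      rw [mem_closedBall, dist_comm, dist_eq_norm]
      exact Real.le_sqrt_of_sq_le (hbd x x' h2.le)
  choose m hm using hex
  exact ⟨fun x => U (m x) - c / 2 * ‖x - m x‖ ^ 2, m, fun _ => rfl, hm, fun x => hbd x _ (hm x x)⟩

omit [FiniteDimensional ℝ V] in
theorem supConvolution_semiconvex {U a : V → ℝ} {m : V → V} {c : ℝ}
    (ha : ∀ x, a x = U (m x) - c / 2 * ‖x - m x‖ ^ 2)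
    (hm : ∀ x x', U x' - c / 2 * ‖x - x'‖ ^ 2 ≤ a x) (x x' : V) :
    a x + ⟪-(c • (x - m x)), x' - x⟫ - c / 2 * ‖x' - x‖ ^ 2 ≤ a x' := by
  have h1 := hm x' (m x)
  have h2 : ‖x' - m x‖ ^ 2 = ‖x - m x‖ ^ 2 + 2 * ⟪x - m x, x' - x⟫ + ‖x' - x‖ ^ 2 := by
    rw [← norm_add_sq_real]; congr 2; abel
  rw [h2] at h1
  rw [ha x, inner_neg_left, real_inner_smul_left]
  linarith

end SupConvolution

section Sums

variable {E : Type*} [NormedAddCommGroup E] [InnerProductSpace ℝ E] [FiniteDimensional ℝ E]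

/-- The projections and embeddings of an orthogonal sum `H` of two copies of `E`. -/
structure HilbertSum (E H : Type*) [NormedAddCommGroup E] [InnerProductSpace ℝ E]
    [NormedAddCommGroup H] [InnerProductSpace ℝ H] where
  fst : H →L[ℝ] E
  snd : H →L[ℝ] E
  inl : E →L[ℝ] H
  inr : E →L[ℝ] H
  fst_inl : ∀ x, fst (inl x) = x
  snd_inl : ∀ x, snd (inl x) = 0
  fst_inr : ∀ x, fst (inr x) = 0
  snd_inr : ∀ x, snd (inr x) = x
  inl_add_inr : ∀ z, inl (fst z) + inr (snd z) = z
  inner_eq : ∀ z z', ⟪z, z'⟫ = ⟪fst z, fst z'⟫ + ⟪snd z, snd z'⟫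

/-- The standard orthogonal sum. -/
def hilbertSumProd (E : Type*) [NormedAddCommGroup E] [InnerProductSpace ℝ E] :
    HilbertSum E (WithLp 2 (E × E)) where
  fst := WithLp.fstL 2 ℝ E E
  snd := WithLp.sndL 2 ℝ E E
  inl := ((WithLp.prodContinuousLinearEquiv 2 ℝ E E).symm : E × E →L[ℝ] WithLp 2 (E × E)).comp
    (ContinuousLinearMap.inl ℝ E E)
  inr := ((WithLp.prodContinuousLinearEquiv 2 ℝ E E).symm : E × E →L[ℝ] WithLp 2 (E × E)).comp
    (ContinuousLinearMap.inr ℝ E E)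
  fst_inl _ := rfl
  snd_inl _ := rfl
  fst_inr _ := rfl
  snd_inr _ := rfl
  inl_add_inr z := by
    change WithLp.toLp 2 (z.fst, (0:E)) + WithLp.toLp 2 ((0:E), z.snd) = z
    rw [← WithLp.toLp_add]; simp; rfl
  inner_eq z z' := WithLp.prod_inner_apply z z'

variable {H : Type*} [NormedAddCommGroup H] [InnerProductSpace ℝ H]

omit [FiniteDimensional ℝ E]

theorem HilbertSum.norm_sq (S : HilbertSum E H) (z : H) :
    ‖z‖ ^ 2 = ‖S.fst z‖ ^ 2 + ‖S.snd z‖ ^ 2 := by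
  simp only [← real_inner_self_eq_norm_sq, S.inner_eq z z]

theorem HilbertSum.norm_fst_le (S : HilbertSum E H) (z : H) : ‖S.fst z‖ ≤ ‖z‖ :=
  (abs_le_of_sq_le_sq' (by rw [S.norm_sq z]; linarith [sq_nonneg ‖S.snd z‖]) (norm_nonneg _)).2

theorem HilbertSum.norm_snd_le (S : HilbertSum E H) (z : H) : ‖S.snd z‖ ≤ ‖z‖ :=
  (abs_le_of_sq_le_sq' (by rw [S.norm_sq z]; linarith [sq_nonneg ‖S.fst z‖]) (norm_nonneg _)).2

theorem HilbertSum.inner_inl (S : HilbertSum E H) (z : H) (x : E) :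
    ⟪z, S.inl x⟫ = ⟪S.fst z, x⟫ := by
  rw [S.inner_eq, S.fst_inl, S.snd_inl, inner_zero_right, add_zero]

theorem HilbertSum.inner_inr (S : HilbertSum E H) (z : H) (x : E) :
    ⟪z, S.inr x⟫ = ⟪S.snd z, x⟫ := by
  rw [S.inner_eq, S.fst_inr, S.snd_inr, inner_zero_right, zero_add]

theorem HilbertSum.norm_inl (S : HilbertSum E H) (x : E) : ‖S.inl x‖ = ‖x‖ := by
  have h := S.norm_sq (S.inl x)
  rw [S.fst_inl, S.snd_inl, norm_zero] at h
  exact (sq_eq_sq₀ (norm_nonneg _) (norm_nonneg _)).1 (by linarith)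

theorem HilbertSum.norm_inr (S : HilbertSum E H) (x : E) : ‖S.inr x‖ = ‖x‖ := by
  have h := S.norm_sq (S.inr x)
  rw [S.fst_inr, S.snd_inr, norm_zero] at h
  exact (sq_eq_sq₀ (norm_nonneg _) (norm_nonneg _)).1 (by linarith)

theorem separable_cross_terms (S : HilbertSum E H) {a b : E → ℝ} {z P : H} {M : H →L[ℝ] H}
    (h : TaylorTwo (fun z => a (S.fst z) + b (S.snd z)) z P M) (k : H) :
    ⟪M (S.inl (S.fst k)), S.inl (S.fst k)⟫ + ⟪M (S.inr (S.snd k)), S.inr (S.snd k)⟫ ≤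
      ⟪M k, k⟫ := by
  refine le_of_eventually_quadratic
    (a := fun k => ⟪M (S.inl (S.fst k)), S.inl (S.fst k)⟫ +
      ⟪M (S.inr (S.snd k)), S.inr (S.snd k)⟫) (b := fun k => ⟪M k, k⟫)
    (fun t k => by
      simp only [map_smul, real_inner_smul_left, inner_smul_right]; ring)
    (inner_map_smul_self M) (fun ε hε => ?_) k
  have t1 : Tendsto (fun k => S.inl (S.fst k)) (𝓝 0) (𝓝 0) := by
    have := (S.inl.continuous.comp S.fst.continuous).tendsto 0
    simpa [Function.comp_def] using this
  have t2 : Tendsto (fun k => S.inr (S.snd k)) (𝓝 0) (𝓝 0) := by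
    have := (S.inr.continuous.comp S.snd.continuous).tendsto 0
    simpa [Function.comp_def] using this
  have hε' : 0 < ε / 6 := by positivity
  filter_upwards [h _ hε', t1.eventually (h _ hε'), t2.eventually (h _ hε')] with k h0 h1 h2
  have n1 : ‖S.inl (S.fst k)‖ ^ 2 ≤ ‖k‖ ^ 2 := by
    rw [S.norm_inl, S.norm_sq k]; linarith [sq_nonneg ‖S.snd k‖]
  have n2 : ‖S.inr (S.snd k)‖ ^ 2 ≤ ‖k‖ ^ 2 := by
    rw [S.norm_inr, S.norm_sq k]; linarith [sq_nonneg ‖S.fst k‖]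
  have m1 := mul_le_mul_of_nonneg_left n1 hε'.le
  have m2 := mul_le_mul_of_nonneg_left n2 hε'.le
  have hP : ⟪P, k⟫ = ⟪P, S.inl (S.fst k)⟫ + ⟪P, S.inr (S.snd k)⟫ := by
    rw [← inner_add_right, S.inl_add_inr]
  simp only [map_add, S.fst_inl, S.snd_inl, S.fst_inr, S.snd_inr, add_zero] at h0 h1 h2
  linarith [abs_le.1 h0, abs_le.1 h1, abs_le.1 h2]

theorem jetAbove_of_supConvolution {U a : E → ℝ} {m : E → E} {c : ℝ}
    (ha : ∀ x, a x = U (m x) - c / 2 * ‖x - m x‖ ^ 2)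
    (hm : ∀ x x', U x' - c / 2 * ‖x - x'‖ ^ 2 ≤ a x) {x p : E} {b : E → ℝ}
    (h : JetAbove a x p b) : JetAbove U (m x) p b := by
  filter_upwards [h] with k hk
  have h1 := hm (x + k) (m x + k)
  rw [add_sub_add_right_eq_sub] at h1
  linarith [ha x]

variable [FiniteDimensional ℝ E] [FiniteDimensional ℝ H]

set_option maxHeartbeats 1600000 in
theorem HilbertSum.exists_jets_of_doubling (S : HilbertSum E H) {U W : E → ℝ} (hU : Continuous U) (hW : Continuous W) {C₀ : ℝ}
    (hCU : ∀ x, |U x| ≤ C₀) (hCW : ∀ x, |W x| ≤ C₀)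
    {T₁ T₂ : E →L[ℝ] E} (hT₁ : ∀ x y, ⟪T₁ x, y⟫ = ⟪x, T₁ y⟫) (hT₂ : ∀ x y, ⟪T₂ x, y⟫ = ⟪x, T₂ y⟫)
    {p q xh yh : E} {r : ℝ} (hr : 0 < r)
    (hmax : ∀ x y, ‖x - xh‖ ≤ r → ‖y - yh‖ ≤ r → U x - W y ≤ U xh - W yh + ⟪p, x - xh⟫ -
      ⟪q, y - yh⟫ + 1 / 2 * (⟪T₁ ((x - xh) - (y - yh)), (x - xh) - (y - yh)⟫ +
        ⟪T₂ (x - xh), x - xh⟫))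
    {τ : ℝ} (hτ : 0 < τ) :
    ∃ (x y p' q' : E) (X Y : E →L[ℝ] E), ‖x - xh‖ < τ ∧ ‖y - yh‖ < τ ∧ ‖p' - p‖ < τ ∧
      ‖q' - q‖ < τ ∧ JetAbove U x p' (fun k => ⟪X k, k⟫) ∧ JetBelow W y q' (fun k => ⟪Y k, k⟫) ∧
      ∀ ξ η, ⟪X ξ, ξ⟫ - ⟪Y η, η⟫ ≤ ⟪T₁ (ξ - η), ξ - η⟫ + ⟪T₂ ξ, ξ⟫ + τ * (‖ξ‖ ^ 2 + ‖η‖ ^ 2) := by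
  set D := S.fst - S.snd with hD
  set T₀ : H →L[ℝ] H :=
    D.adjoint.comp (T₁.comp D) + S.fst.adjoint.comp (T₂.comp S.fst) with hT₀
  set P : H := S.inl p - S.inr q with hP
  have hT₀s : ∀ x y, ⟪T₀ x, y⟫ = ⟪x, T₀ y⟫ := by
    intro x y
    simp only [hT₀, add_apply, ContinuousLinearMap.comp_apply, inner_add_left,
      inner_add_right, ContinuousLinearMap.adjoint_inner_left,
      ContinuousLinearMap.adjoint_inner_right, hT₁, hT₂]
  have hT₀q : ∀ k, ⟪T₀ k, k⟫ = ⟪T₁ (S.fst k - S.snd k), S.fst k - S.snd k⟫ + ⟪T₂ (S.fst k), S.fst k⟫ := by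
    intro k
    simp only [hT₀, add_apply, ContinuousLinearMap.comp_apply, inner_add_left,
      ContinuousLinearMap.adjoint_inner_left]
    rfl
  have hPk : ∀ k, ⟪P, k⟫ = ⟪p, S.fst k⟫ - ⟪q, S.snd k⟫ := by
    intro k
    rw [hP, inner_sub_left, real_inner_comm, S.inner_inl, real_inner_comm k, S.inner_inr,
      real_inner_comm p, real_inner_comm q]
  set τ₁ := τ / 2 with hτ₁
  have hτ₁0 : 0 < τ₁ := by positivity
  set T := T₀ + τ₁ • ContinuousLinearMap.id ℝ (H) with hT
  have hTs : ∀ x y, ⟪T x, y⟫ = ⟪x, T y⟫ := by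
    intro x y
    simp only [hT, add_apply, smul_apply, ContinuousLinearMap.id_apply, inner_add_left,
      inner_add_right, hT₀s, real_inner_smul_left, inner_smul_right]
  have hTq : ∀ k, ⟪T k, k⟫ = ⟪T₀ k, k⟫ + τ₁ * ‖k‖ ^ 2 := by
    intro k
    simp only [hT, add_apply, smul_apply, ContinuousLinearMap.id_apply, inner_add_left,
      real_inner_smul_left, real_inner_self_eq_norm_sq]
  -- choice of parameters
  set r₁ := min (r / 2) (min (τ / 2) (τ / (2 * (‖T‖ + 1)))) with hr₁
  have hr₁0 : 0 < r₁ := by positivity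
  have hr₁r : r₁ ≤ r / 2 := min_le_left _ _
  have hr₁τ : r₁ ≤ τ / 2 := (min_le_right _ _).trans (min_le_left _ _)
  have hr₁T : r₁ ≤ τ / (2 * (‖T‖ + 1)) := (min_le_right _ _).trans (min_le_right _ _)
  set LQ := ‖P‖ + ‖T₀‖ * (2 * r) + 1 with hLQ
  have hLQ0 : 0 < LQ := by positivity
  set γ := τ₁ * r₁ ^ 2 / 128 with hγ
  have hγ0 : 0 < γ := by positivity
  set σ := min (r / 2) (min (τ / 2) (γ / (2 * LQ))) with hσ
  have hσ0 : 0 < σ := by positivity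
  have hσr : σ ≤ r / 2 := min_le_left _ _
  have hστ : σ ≤ τ / 2 := (min_le_right _ _).trans (min_le_left _ _)
  have hσL : σ ≤ γ / (2 * LQ) := (min_le_right _ _).trans (min_le_right _ _)
  have hC0 : 0 ≤ C₀ := (abs_nonneg _).trans (hCU 0)
  set c := (4 * C₀ + 1) / σ ^ 2 with hc
  have hc0 : 0 < c := by positivity
  have hcσ : 4 * C₀ / c ≤ σ ^ 2 := by
    rw [hc, div_div_eq_mul_div, div_le_iff₀ (by positivity)]
    nlinarith [sq_nonneg σ]
  obtain ⟨a, m, ha, ham, hmb⟩ := exists_supConvolution hU hCU hc0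
  obtain ⟨b, n, hb, hbn, hnb⟩ := exists_supConvolution (U := fun x => - W x) hW.neg
    (fun x => by rw [abs_neg]; exact hCW x) hc0
  have hmσ : ∀ x, ‖x - m x‖ ≤ σ := fun x => abs_le_of_sq_le_sq' ((hmb x).trans hcσ) hσ0.le |>.2
  have hnσ : ∀ x, ‖x - n x‖ ≤ σ := fun x => abs_le_of_sq_le_sq' ((hnb x).trans hcσ) hσ0.le |>.2
  set w : H → ℝ := fun z => a (S.fst z) + b (S.snd z) with hw
  have hwsemi : ∀ z, ∃ ζ, ∀ z', w z + ⟪ζ, z' - z⟫ - c / 2 * ‖z' - z‖ ^ 2 ≤ w z' := by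
    intro z
    refine ⟨S.inl (-(c • (S.fst z - m (S.fst z)))) + S.inr (-(c • (S.snd z - n (S.snd z)))), fun z' => ?_⟩
    have h1 := supConvolution_semiconvex ha ham (S.fst z) (S.fst z')
    have h2 := supConvolution_semiconvex hb hbn (S.snd z) (S.snd z')
    rw [S.inner_eq, S.norm_sq]
    simp only [map_add, map_sub, S.fst_inl, S.snd_inl, S.fst_inr, S.snd_inr, add_zero, zero_add]
    simp only [hw]
    linarith
  set zh : H := S.inl xh + S.inr yh with hzh
  have hwzh : U xh - W yh ≤ w zh := by
    have h1 := ham xh xh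
    have h2 := hbn yh yh
    simp only [sub_self, norm_zero] at h1 h2
    simp only [hw, hzh, map_add, S.fst_inl, S.snd_inl, S.fst_inr, S.snd_inr, add_zero, zero_add]
    linarith
  have hfst : ∀ z : H, ‖S.fst z‖ ≤ ‖z‖ := S.norm_fst_le
  have hsnd : ∀ z : H, ‖S.snd z‖ ≤ ‖z‖ := S.norm_snd_le
  have hwmax : ∀ z, r₁ / 4 ≤ ‖z - zh‖ → ‖z - zh‖ ≤ r₁ →
      w z - ⟪P, z - zh⟫ - 1 / 2 * ⟪T (z - zh), z - zh⟫ + γ < w zh := by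
    intro z hz1 hz2
    obtain ⟨k, hk⟩ : ∃ k, k = z - zh := ⟨_, rfl⟩
    rw [← hk] at hz1 hz2 ⊢
    set z' : H := S.inl (m (S.fst z)) + S.inr (n (S.snd z)) with hz'
    set d := z' - z with hd
    have hdn : ‖d‖ ≤ 2 * σ := by
      have h1 : ‖d‖ ^ 2 ≤ (2 * σ) ^ 2 := by
        rw [S.norm_sq]
        have e1 : ‖S.fst d‖ ≤ σ := by
          rw [← norm_neg]
          have : -S.fst d = S.fst z - m (S.fst z) := by
            simp [hd, hz', S.fst_inl, S.snd_inl, S.fst_inr, S.snd_inr]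
          rw [this]; exact hmσ _
        have e2 : ‖S.snd d‖ ≤ σ := by
          rw [← norm_neg]
          have : -S.snd d = S.snd z - n (S.snd z) := by
            simp [hd, hz', S.fst_inl, S.snd_inl, S.fst_inr, S.snd_inr]
          rw [this]; exact hnσ _
        nlinarith [norm_nonneg (S.fst d), norm_nonneg (S.snd d)]
      exact (abs_le_of_sq_le_sq' h1 (by positivity)).2
    have hkd : z' - zh = k + d := by rw [hk, hd]; abel
    have hdr : ‖k + d‖ ≤ 2 * r := (norm_add_le _ _).trans (by linarith)
    have b1 : ‖m (S.fst z) - xh‖ ≤ r := by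
      have : m (S.fst z) - xh = S.fst k - (S.fst z - m (S.fst z)) := by
        rw [hk, map_sub, hzh, map_add, S.fst_inl, S.fst_inr, add_zero]; abel
      rw [this]
      calc _ ≤ ‖S.fst k‖ + ‖S.fst z - m (S.fst z)‖ := norm_sub_le _ _
        _ ≤ r₁ + σ := add_le_add ((hfst _).trans hz2) (hmσ _)
        _ ≤ r := by linarith
    have b2 : ‖n (S.snd z) - yh‖ ≤ r := by
      have : n (S.snd z) - yh = S.snd k - (S.snd z - n (S.snd z)) := by
        rw [hk, map_sub, hzh, map_add, S.snd_inl, S.snd_inr, zero_add]; abel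
      rw [this]
      calc _ ≤ ‖S.snd k‖ + ‖S.snd z - n (S.snd z)‖ := norm_sub_le _ _
        _ ≤ r₁ + σ := add_le_add ((hsnd _).trans hz2) (hnσ _)
        _ ≤ r := by linarith
    have h1 := hmax _ _ b1 b2
    have h2 : ⟪P, k + d⟫ + 1 / 2 * ⟪T₀ (k + d), k + d⟫ = ⟪p, m (S.fst z) - xh⟫ -
      ⟪q, n (S.snd z) - yh⟫ + 1 / 2 * (⟪T₁ ((m (S.fst z) - xh) - (n (S.snd z) - yh)),
        (m (S.fst z) - xh) - (n (S.snd z) - yh)⟫ + ⟪T₂ (m (S.fst z) - xh), m (S.fst z) - xh⟫) := by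
      rw [← hkd, hPk, hT₀q]
      simp [hzh, hz', S.fst_inl, S.snd_inl, S.fst_inr, S.snd_inr]
    have h3 : w z ≤ U (m (S.fst z)) - W (n (S.snd z)) := by
      simp only [hw]
      rw [ha, hb]
      have : 0 ≤ c / 2 * ‖S.fst z - m (S.fst z)‖ ^ 2 := by positivity
      have : 0 ≤ c / 2 * ‖S.snd z - n (S.snd z)‖ ^ 2 := by positivity
      linarith
    have h4 : ⟪P, k + d⟫ + 1 / 2 * ⟪T₀ (k + d), k + d⟫ =
        ⟪P, k⟫ + 1 / 2 * ⟪T₀ k, k⟫ + (⟪P, d⟫ + 1 / 2 * (⟪T₀ d, k + d⟫ + ⟪T₀ d, k⟫)) := by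
      have : ⟪T₀ k, d⟫ = ⟪T₀ d, k⟫ := by rw [hT₀s, real_inner_comm]
      simp only [map_add, inner_add_left, inner_add_right, this]; ring
    have h5 : ⟪P, d⟫ ≤ ‖P‖ * ‖d‖ := real_inner_le_norm _ _
    have hk2 : ‖k‖ ≤ 2 * r := by linarith
    have h6 : ⟪T₀ d, k + d⟫ ≤ ‖T₀‖ * ‖d‖ * (2 * r) :=
      (real_inner_le_norm _ _).trans (by gcongr; exact T₀.le_opNorm d)
    have h7 : ⟪T₀ d, k⟫ ≤ ‖T₀‖ * ‖d‖ * (2 * r) :=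
      (real_inner_le_norm _ _).trans (by gcongr; exact T₀.le_opNorm d)
    have h8 : ⟪P, d⟫ + 1 / 2 * (⟪T₀ d, k + d⟫ + ⟪T₀ d, k⟫) ≤ γ := by
      calc _ ≤ LQ * ‖d‖ := by rw [hLQ]; nlinarith [norm_nonneg d]
        _ ≤ LQ * (2 * (γ / (2 * LQ))) := by gcongr; exact hdn.trans (by linarith)
        _ = γ := by field_simp
    have h9 : τ₁ * (r₁ / 4) ^ 2 ≤ τ₁ * ‖k‖ ^ 2 := by gcongr
    rw [hTq]
    have : τ₁ * (r₁ / 4) ^ 2 = 8 * γ := by rw [hγ]; ring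
    linarith
  obtain ⟨z, P', M, hz, hTay, hPP, hM⟩ := exists_taylorTwo_near_strict_max hwsemi hTs hr₁0 hγ0 hwmax
    (ρ := τ / 4) (by positivity)
  have hε : 0 < τ / 8 := by positivity
  have hPP' : ‖P' - P‖ < τ := by
    have : P' - P = (P' - P - T (z - zh)) + T (z - zh) := by abel
    rw [this]
    have h1 : ‖T (z - zh)‖ ≤ (‖T‖ + 1) * (τ / (2 * (‖T‖ + 1))) := by
      refine (T.le_opNorm _).trans ?_
      gcongr
      · linarith
      · linarith
    have h2 : (‖T‖ + 1) * (τ / (2 * (‖T‖ + 1))) = τ / 2 := by field_simp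
    linarith [norm_add_le (P' - P - T (z - zh)) (T (z - zh))]
  have tl : Tendsto (S.inl) (𝓝 0) (𝓝 0) := by simpa using (S.inl).continuous.tendsto 0
  have tr : Tendsto (S.inr) (𝓝 0) (𝓝 0) := by simpa using (S.inr).continuous.tendsto 0
  refine ⟨m (S.fst z), n (S.snd z), S.fst P', -(S.snd P'),
    (S.fst.comp (M.comp (S.inl))) + (τ / 4) • ContinuousLinearMap.id ℝ E,
    -(S.snd.comp (M.comp (S.inr))) - (τ / 4) • ContinuousLinearMap.id ℝ E, ?_, ?_, ?_, ?_, ?_, ?_, ?_⟩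
  · have : m (S.fst z) - xh = S.fst (z - zh) - (S.fst z - m (S.fst z)) := by
        rw [map_sub, hzh, map_add, S.fst_inl, S.fst_inr, add_zero]; abel
    rw [this]
    calc _ ≤ ‖S.fst (z - zh)‖ + ‖S.fst z - m (S.fst z)‖ := norm_sub_le _ _
      _ ≤ r₁ / 4 + σ := add_le_add ((hfst _).trans hz) (hmσ _)
      _ < τ := by linarith
  · have : n (S.snd z) - yh = S.snd (z - zh) - (S.snd z - n (S.snd z)) := by
        rw [map_sub, hzh, map_add, S.snd_inl, S.snd_inr, zero_add]; abel
    rw [this]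
    calc _ ≤ ‖S.snd (z - zh)‖ + ‖S.snd z - n (S.snd z)‖ := norm_sub_le _ _
      _ ≤ r₁ / 4 + σ := add_le_add ((hsnd _).trans hz) (hnσ _)
      _ < τ := by linarith
  · have : S.fst P' - p = S.fst (P' - P) := by
      simp [hP, S.fst_inl, S.snd_inl, S.fst_inr, S.snd_inr]
    rw [this]; exact (hfst _).trans_lt hPP'
  · have : -(S.snd P') - q = -S.snd (P' - P) := by
      rw [map_sub, hP, map_sub, S.snd_inl, S.snd_inr]; abel
    rw [this, norm_neg]; exact (hsnd _).trans_lt hPP'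
  · refine jetAbove_of_supConvolution ha ham ?_
    filter_upwards [tl.eventually (hTay _ hε)] with k hk
    have e1 : w (z + S.inl k) = a (S.fst z + k) + b (S.snd z) := by
      simp [hw, S.fst_inl, S.snd_inl]
    have e2 : ⟪P', S.inl k⟫ = ⟪S.fst P', k⟫ := S.inner_inl _ _
    have e3 : ⟪M (S.inl k), S.inl k⟫ = ⟪S.fst (M (S.inl k)), k⟫ := S.inner_inl _ _
    have e4 : ‖S.inl k‖ = ‖k‖ := S.norm_inl k
    rw [e1, e2, e3, e4] at hk
    have e5 : w z = a (S.fst z) + b (S.snd z) := rfl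
    simp only [add_apply, ContinuousLinearMap.comp_apply, smul_apply,
      ContinuousLinearMap.id_apply, inner_add_left, real_inner_smul_left,
      real_inner_self_eq_norm_sq]
    linarith [(abs_le.1 hk).2]
  · have h1 : JetAbove (fun x => -W x) (n (S.snd z)) (S.snd P')
        (fun k => ⟪S.snd (M (S.inr k)), k⟫ + τ / 4 * ‖k‖ ^ 2) := by
      refine jetAbove_of_supConvolution hb hbn ?_
      filter_upwards [tr.eventually (hTay _ hε)] with k hk
      have e1 : w (z + S.inr k) = a (S.fst z) + b (S.snd z + k) := by
        simp [hw, S.fst_inr, S.snd_inr]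
      have e2 : ⟪P', S.inr k⟫ = ⟪S.snd P', k⟫ := S.inner_inr _ _
      have e3 : ⟪M (S.inr k), S.inr k⟫ = ⟪S.snd (M (S.inr k)), k⟫ := S.inner_inr _ _
      have e4 : ‖S.inr k‖ = ‖k‖ := S.norm_inr k
      rw [e1, e2, e3, e4] at hk
      have e5 : w z = a (S.fst z) + b (S.snd z) := rfl
      linarith [(abs_le.1 hk).2]
    filter_upwards [h1] with k hk
    simp only [sub_apply, neg_apply, ContinuousLinearMap.comp_apply, smul_apply,
      ContinuousLinearMap.id_apply, inner_sub_left, inner_neg_left, real_inner_smul_left,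
      real_inner_self_eq_norm_sq]
    linarith
  · intro ξ η
    have h1 := separable_cross_terms S hTay (S.inl ξ + S.inr η)
    have h2 := hM (S.inl ξ + S.inr η)
    simp only [map_add S.fst, map_add S.snd, S.fst_inl, S.snd_inl, S.fst_inr, S.snd_inr, add_zero,
      zero_add] at h1
    rw [hTq, hT₀q, S.norm_sq] at h2
    simp only [map_add S.fst, map_add S.snd, S.fst_inl, S.snd_inl, S.fst_inr, S.snd_inr, add_zero,
      zero_add] at h2
    have e3 : ⟪M (S.inl ξ), S.inl ξ⟫ = ⟪S.fst (M (S.inl ξ)), ξ⟫ := S.inner_inl _ _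
    have e4 : ⟪M (S.inr η), S.inr η⟫ = ⟪S.snd (M (S.inr η)), η⟫ := S.inner_inr _ _
    rw [e3, e4] at h1
    simp only [add_apply, sub_apply, neg_apply, ContinuousLinearMap.comp_apply, smul_apply,
      ContinuousLinearMap.id_apply, inner_sub_left, inner_add_left, inner_neg_left,
      real_inner_smul_left, real_inner_self_eq_norm_sq]
    have : 0 ≤ τ * (‖ξ‖ ^ 2 + ‖η‖ ^ 2) := by positivity
    nlinarith


end Sums

section Lipschitz

variable {E : Type*} [NormedAddCommGroup E] [InnerProductSpace ℝ E]

/-- Uniform ellipticity of a function of the quadratic form of an operator. -/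
structure IsElliptic (a A : ℝ) (G : (E →L[ℝ] E) → ℝ) : Prop where
  zero : G 0 = 0
  le_add : ∀ (X Y : E →L[ℝ] E) (s : ℝ), 0 ≤ s → (∀ k, ⟪X k, k⟫ ≤ ⟪Y k, k⟫ + s * ‖k‖ ^ 2) →
    G X ≤ G Y + A * s
  le_sub : ∀ (X Y : E →L[ℝ] E) (s t : ℝ) (n : E), 0 ≤ s → ‖n‖ = 1 →
    (∀ k, ⟪X k, k⟫ ≤ ⟪Y k, k⟫ + s * ‖k‖ ^ 2) → ⟪X n, n⟫ + t ≤ ⟪Y n, n⟫ →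
    G X ≤ G Y + A * s - a * t

/-- The concave modulus of the Ishii–Lions argument lies below its second order expansion. -/
theorem modulus_le_quadratic {z n : E} {ρ L : ℝ} (hρ : 0 < ρ) (hL : 0 ≤ L) (hn : ‖n‖ = 1)
    {d : E} (hz : z = ρ • n + d) (hd : ‖d‖ ≤ ρ / 2) :
    L * (‖z‖ - ‖z‖ ^ 2 / 4) ≤ L * (ρ - ρ ^ 2 / 4) + L * (1 - ρ / 2) * ⟪n, d⟫ +
      1 / 2 * (2 * L / ρ * (‖d‖ ^ 2 - ⟪n, d⟫ ^ 2) - L / 2 * ‖d‖ ^ 2) := by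
  have hnd := abs_real_inner_le_norm n d
  rw [hn, one_mul] at hnd
  have hs : ρ / 2 ≤ ρ + ⟪n, d⟫ := by linarith [(abs_le.1 hnd).1]
  have hz2 : ‖z‖ ^ 2 = ρ ^ 2 + 2 * ρ * ⟪n, d⟫ + ‖d‖ ^ 2 := by
    rw [hz, norm_add_sq_real, norm_smul, real_inner_smul_left, hn, Real.norm_eq_abs, mul_one,
      sq_abs]; ring
  have hnd2 : 0 ≤ ‖d‖ ^ 2 - ⟪n, d⟫ ^ 2 := by
    have := sq_le_sq' (abs_le.1 hnd).1 (abs_le.1 hnd).2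
    linarith
  have hnz : ‖z‖ ≤ ρ + ⟪n, d⟫ + (‖d‖ ^ 2 - ⟪n, d⟫ ^ 2) / ρ := by
    refine abs_le_of_sq_le_sq' ?_ (add_nonneg (by linarith) (div_nonneg hnd2 hρ.le)) |>.2
    rw [hz2]
    have h1 : (‖d‖ ^ 2 - ⟪n, d⟫ ^ 2) ≤ 2 * (ρ + ⟪n, d⟫) * ((‖d‖ ^ 2 - ⟪n, d⟫ ^ 2) / ρ) := by
      rw [mul_div_assoc', le_div_iff₀ hρ]
      nlinarith
    nlinarith [sq_nonneg ((‖d‖ ^ 2 - ⟪n, d⟫ ^ 2) / ρ)]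
  rw [hz2]
  have := mul_le_mul_of_nonneg_left hnz hL
  have e : 2 * L / ρ * (‖d‖ ^ 2 - ⟪n, d⟫ ^ 2) = 2 * (L * ((‖d‖ ^ 2 - ⟪n, d⟫ ^ 2) / ρ)) := by
    field_simp
  rw [e]
  linarith

theorem exists_lipschitz_scale {α a B : ℝ} (hα : -1 < α) (ha : 0 < a) (hB : 0 ≤ B) :
    ∃ L : ℝ, 4 ≤ L ∧ 1 < a * L ∧ ∀ t : ℝ, L / 4 ≤ t → t ≤ 2 * L →
      2 * B * (t ^ α)⁻¹ ≤ a * L := by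
  have h := (tendsto_rpow_neg_atTop (y := 1 + α) (by linarith)).const_mul (4 * B)
  rw [mul_zero] at h
  have h2 : Tendsto (fun L : ℝ => L / 4) atTop atTop := tendsto_id.atTop_div_const (by norm_num)
  obtain ⟨L, h3, h4, h5⟩ := (((h.comp h2).eventually_lt_const ha).and
    ((eventually_ge_atTop 4).and (eventually_gt_atTop (1 / a)))).exists
  refine ⟨L, h4, by rwa [div_lt_iff₀' ha] at h5, fun t ht1 ht2 => ?_⟩
  have ht : 0 < t := by linarith
  have e : (t ^ α)⁻¹ = t * t ^ (-(1 + α)) := by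
    rw [← Real.rpow_neg ht.le]
    nth_rw 2 [← Real.rpow_one t]
    rw [← Real.rpow_add ht]; congr 1; ring
  have h6 : t ^ (-(1 + α)) ≤ (L / 4) ^ (-(1 + α)) :=
    Real.rpow_le_rpow_of_nonpos (by linarith) ht1 (by linarith)
  have h7 : 0 ≤ (L / 4) ^ (-(1 + α)) := by positivity
  rw [e]
  simp only [Function.comp_apply] at h3
  calc 2 * B * (t * t ^ (-(1 + α))) ≤ 2 * B * (2 * L * (L / 4) ^ (-(1 + α))) := by gcongr
    _ = L * (4 * B * (L / 4) ^ (-(1 + α))) := by ring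
    _ ≤ L * a := by gcongr
    _ = a * L := mul_comm _ _

variable [FiniteDimensional ℝ E]

set_option maxHeartbeats 1600000 in
theorem lipschitz_of_jets {α a A B : ℝ} {G : (E →L[ℝ] E) → ℝ} (hG : IsElliptic a A G)
    (hα : -1 < α) (ha : 0 < a) (hA : 0 ≤ A) (hB : 0 ≤ B) {u : E → ℝ} (hu : Continuous u)
    (hu1 : ∀ x, |u x| ≤ 1)
    (hsub : ∀ x p (X : E →L[ℝ] E), p ≠ 0 → JetAbove u x p (fun k => ⟪X k, k⟫) →
      -B ≤ ‖p‖ ^ α * G X)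
    (hsuper : ∀ x p (X : E →L[ℝ] E), p ≠ 0 → JetBelow u x p (fun k => ⟪X k, k⟫) →
      ‖p‖ ^ α * G X ≤ B) :
    ∃ L : ℝ, 0 ≤ L ∧ ∀ x y, |u x - u y| ≤ L * ‖x - y‖ := by
  obtain ⟨L, hL4, haL, hLt⟩ := exists_lipschitz_scale hα ha hB
  have := FiniteDimensional.proper_real E
  have key : ∀ x y, u x - u y ≤ L * ‖x - y‖ := by
    intro x₁ y₁
    by_contra! hlt
    have hb : ∀ x y, u x - u y ≤ 2 := fun x y => by
      linarith [abs_le.1 (hu1 x), abs_le.1 (hu1 y)]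
    have hr1 : ‖x₁ - y₁‖ < 1 := by
      by_contra! h
      nlinarith [hb x₁ y₁]
    set g := u x₁ - u y₁ - L * ‖x₁ - y₁‖ with hg
    have hg0 : 0 < g := by linarith
    -- penalization parameter
    set κ := min (g / (2 * (‖x₁‖ ^ 2 + 1))) (min (1 / (8 * (A + a))) (1 / 32)) with hκ
    have hκ0 : 0 < κ := by positivity
    have hκ1 : κ * ‖x₁‖ ^ 2 ≤ g / 2 := by
      calc κ * ‖x₁‖ ^ 2 ≤ g / (2 * (‖x₁‖ ^ 2 + 1)) * (‖x₁‖ ^ 2 + 1) :=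
            mul_le_mul (min_le_left _ _) (by linarith) (by positivity) (by positivity)
        _ = g / 2 := by field_simp
    have hκ2 : κ ≤ 1 / (8 * (A + a)) := (min_le_right _ _).trans (min_le_left _ _)
    have hκ3 : κ ≤ 1 / 32 := (min_le_right _ _).trans (min_le_right _ _)
    set Φ : E × E → ℝ := fun z => u z.1 - u z.2 - L * (‖z.1 - z.2‖ - ‖z.1 - z.2‖ ^ 2 / 4) -
      κ * ‖z.1‖ ^ 2 with hΦ
    have hΦc : Continuous Φ := by fun_prop
    set R := ‖x₁‖ + Real.sqrt (2 / κ) with hR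
    set D : Set (E × E) := {z | ‖z.1‖ ≤ R ∧ ‖z.1 - z.2‖ ≤ 1} with hD
    have hDc : IsCompact D := by
      refine Metric.isCompact_of_isClosed_isBounded ?_ ?_
      · have c1 : IsClosed {z : E × E | ‖z.1‖ ≤ R} := isClosed_le (by fun_prop) (by fun_prop)
        have c2 : IsClosed {z : E × E | ‖z.1 - z.2‖ ≤ 1} :=
          isClosed_le (by fun_prop) (by fun_prop)
        exact c1.inter c2
      · refine (isBounded_closedBall (x := (0 : E × E)) (r := R + 1)).subset fun z hz => ?_
        rw [mem_closedBall_zero_iff, Prod.norm_def]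
        refine max_le (by linarith [hz.1]) ?_
        have h1 : ‖z.2‖ ≤ ‖z.1‖ + ‖z.1 - z.2‖ := by
          have := norm_sub_le z.1 (z.1 - z.2)
          rwa [sub_sub_cancel] at this
        linarith [hz.1, hz.2]
    have hmem : (x₁, y₁) ∈ D := ⟨by rw [hR]; linarith [Real.sqrt_nonneg (2 / κ)], hr1.le⟩
    obtain ⟨⟨xh, yh⟩, hzD, hzmax⟩ := hDc.exists_isMaxOn ⟨_, hmem⟩ hΦc.continuousOn
    have hΦ1 : g / 2 ≤ Φ (x₁, y₁) := by
      simp only [hΦ]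
      have : 0 ≤ L * (‖x₁ - y₁‖ ^ 2 / 4) := by positivity
      nlinarith
    have hΦh : g / 2 ≤ Φ (xh, yh) := hΦ1.trans (hzmax hmem)
    simp only [hΦ] at hΦh
    have hmaxall : ∀ x y, ‖x - y‖ ≤ 1 → Φ (x, y) ≤ Φ (xh, yh) := by
      intro x y hxy
      by_cases hx : ‖x‖ ≤ R
      · exact hzmax (show (x, y) ∈ D from ⟨hx, hxy⟩)
      · push Not at hx
        have h1 : Real.sqrt (2 / κ) ≤ ‖x‖ := by linarith [norm_nonneg x₁]
        have h2 : 2 / κ ≤ ‖x‖ ^ 2 := by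
          rw [← Real.sq_sqrt (show (0:ℝ) ≤ 2 / κ by positivity)]
          gcongr
        rw [div_le_iff₀ hκ0] at h2
        have h3 : 0 ≤ L * (‖x - y‖ - ‖x - y‖ ^ 2 / 4) :=
          mul_nonneg (by linarith) (by nlinarith [norm_nonneg (x - y)])
        have : Φ (x, y) ≤ 0 := by
          simp only [hΦ]
          linarith [hb x y]
        exact this.trans (by simp only [hΦ]; linarith)
    obtain ⟨ρ, hρ⟩ : ∃ ρ, ρ = ‖xh - yh‖ := ⟨_, rfl⟩
    rw [← hρ] at hΦh
    have hκx : κ * ‖xh‖ ^ 2 ≤ 2 := by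
      have h3 : 0 ≤ L * (ρ - ρ ^ 2 / 4) :=
        mul_nonneg (by linarith) (by
          have h1 : ρ ≤ 1 := hρ ▸ hzD.2
          have h2 : 0 ≤ ρ := hρ ▸ norm_nonneg _
          nlinarith)
      linarith [hb xh yh]
    have hρ1 : ρ < 1 := by
      have h1 : ρ ≤ 1 := hρ ▸ hzD.2
      refine lt_of_le_of_ne h1 fun h => ?_
      rw [h] at hΦh
      have : 0 ≤ κ * ‖xh‖ ^ 2 := by positivity
      nlinarith [hb xh yh]
    have hρ0 : 0 < ρ := by
      refine lt_of_le_of_ne (hρ ▸ norm_nonneg _) fun h => ?_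
      have h1 : xh = yh := by rw [← sub_eq_zero, ← norm_eq_zero, ← hρ, ← h]
      rw [← h, h1] at hΦh
      have : 0 ≤ κ * ‖yh‖ ^ 2 := by positivity
      linarith
    obtain ⟨n, hn⟩ : ∃ n, n = ρ⁻¹ • (xh - yh) := ⟨_, rfl⟩
    have hn1 : ‖n‖ = 1 := by
      rw [hn, norm_smul, norm_inv, Real.norm_eq_abs, abs_of_pos hρ0, ← hρ, inv_mul_cancel₀ hρ0.ne']
    have hρn : ρ • n = xh - yh := by rw [hn, smul_smul, mul_inv_cancel₀ hρ0.ne', one_smul]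
    set r := min (ρ / 4) ((1 - ρ) / 2) with hr
    have hr0 : 0 < r := lt_min (by linarith) (by linarith)
    have hrρ : r ≤ ρ / 4 := min_le_left _ _
    have hrρ1 : r ≤ (1 - ρ) / 2 := min_le_right _ _
    set T₁ : E →L[ℝ] E := (2 * L / ρ) • (ContinuousLinearMap.id ℝ E -
      (innerSL ℝ n).smulRight n) - (L / 2) • ContinuousLinearMap.id ℝ E with hT₁
    set T₂ : E →L[ℝ] E := (2 * κ) • ContinuousLinearMap.id ℝ E with hT₂
    have hT₁a : ∀ x, T₁ x = (2 * L / ρ) • (x - ⟪n, x⟫ • n) - (L / 2) • x := by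
      intro x; simp [hT₁]
    have hT₂a : ∀ x, T₂ x = (2 * κ) • x := by intro x; simp [hT₂]
    have hT₁q : ∀ x, ⟪T₁ x, x⟫ = 2 * L / ρ * (‖x‖ ^ 2 - ⟪n, x⟫ ^ 2) - L / 2 * ‖x‖ ^ 2 := by
      intro x
      rw [hT₁a, inner_sub_left, real_inner_smul_left, inner_sub_left, real_inner_smul_left,
        real_inner_smul_left, real_inner_self_eq_norm_sq]; ring
    have hT₂q : ∀ x, ⟪T₂ x, x⟫ = 2 * κ * ‖x‖ ^ 2 := by
      intro x
      rw [hT₂a, real_inner_smul_left, real_inner_self_eq_norm_sq]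
    obtain ⟨q, hq⟩ : ∃ q, q = (L * (1 - ρ / 2)) • n := ⟨_, rfl⟩
    set p := q + (2 * κ) • xh with hp
    set τ := min (1 / (8 * (A + a))) (1 / 2) with hτ
    have hτ0 : 0 < τ := by positivity
    have hτ1 : τ ≤ 1 / (8 * (A + a)) := min_le_left _ _
    have hτ2 : τ ≤ 1 / 2 := min_le_right _ _
    obtain ⟨x, y, p', q', X, Y, -, -, hp', hq', hX, hY, hXY⟩ :=
      (hilbertSumProd E).exists_jets_of_doubling hu hu hu1 hu1 (T₁ := T₁) (T₂ := T₂)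
      (p := p) (q := q) (xh := xh) (yh := yh) (r := r)
      (by intro x y
          rw [hT₁a, hT₁a]
          simp only [inner_sub_left, inner_sub_right, real_inner_smul_left, inner_smul_right]
          rw [real_inner_comm n x]; ring)
      (by intro x y; rw [hT₂a, hT₂a, real_inner_smul_left, inner_smul_right]) hr0
      (by
        intro x y hx hy
        obtain ⟨d, hd⟩ : ∃ d, d = x - xh - (y - yh) := ⟨_, rfl⟩
        have hdn : ‖d‖ ≤ 2 * r := by
          rw [hd]; exact (norm_sub_le _ _).trans (by linarith)
        have hz : x - y = ρ • n + d := by rw [hρn, hd]; abel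
        have hxy : ‖x - y‖ ≤ 1 := by
          rw [hz]
          refine (norm_add_le _ _).trans ?_
          rw [norm_smul, hn1, Real.norm_eq_abs, abs_of_pos hρ0]; linarith
        have h1 := hmaxall x y hxy
        simp only [hΦ] at h1
        rw [← hρ] at h1
        have h2 := modulus_le_quadratic hρ0 (by linarith : (0:ℝ) ≤ L) hn1 hz (by linarith)
        have h3 : ‖x‖ ^ 2 = ‖xh‖ ^ 2 + 2 * ⟪xh, x - xh⟫ + ‖x - xh‖ ^ 2 := by
          rw [← norm_add_sq_real, add_sub_cancel]
        rw [← hd, hT₁q, hT₂q, hp, inner_add_left, real_inner_smul_left]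
        have h4 : ⟪q, x - xh⟫ - ⟪q, y - yh⟫ = L * (1 - ρ / 2) * ⟪n, d⟫ := by
          rw [← inner_sub_right, ← hd, hq, real_inner_smul_left]
        rw [h3] at h1
        linarith) hτ0
    have hκxh : ‖(2 * κ) • xh‖ ≤ 1 / 2 := by
      rw [norm_smul, Real.norm_eq_abs, abs_of_pos (by positivity)]
      refine abs_le_of_sq_le_sq' ?_ (by norm_num) |>.2
      nlinarith [mul_le_mul hκ3 hκx (by positivity) (by norm_num)]
    have hqn : ‖q‖ = L * (1 - ρ / 2) := by
      rw [hq, norm_smul, hn1, mul_one, Real.norm_eq_abs, abs_of_nonneg]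
      exact mul_nonneg (by linarith) (by linarith)
    have hql : L / 2 ≤ ‖q‖ := by rw [hqn]; nlinarith
    have hqu : ‖q‖ ≤ L := by rw [hqn]; nlinarith
    have hp'q : ‖p' - q‖ ≤ 1 := by
      have : p' - q = (p' - p) + (2 * κ) • xh := by rw [hp]; abel
      rw [this]
      exact (norm_add_le _ _).trans (by linarith)
    have hp'l : L / 4 ≤ ‖p'‖ := by
      have := norm_sub_norm_le q p'
      rw [norm_sub_rev] at this
      linarith
    have hp'u : ‖p'‖ ≤ 2 * L := by
      have := norm_sub_norm_le p' q
      linarith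
    have hq'l : L / 4 ≤ ‖q'‖ := by
      have := norm_sub_norm_le q q'
      rw [norm_sub_rev] at this
      linarith
    have hq'u : ‖q'‖ ≤ 2 * L := by
      have := norm_sub_norm_le q' q
      linarith
    have hp'0 : 0 < ‖p'‖ := by linarith
    have hq'0 : 0 < ‖q'‖ := by linarith
    have e1 : -(B * (‖p'‖ ^ α)⁻¹) ≤ G X := by
      have h := hsub x p' X (norm_pos_iff.1 hp'0) hX
      have hpos := Real.rpow_pos_of_pos hp'0 α
      rw [← neg_mul, ← div_eq_mul_inv, div_le_iff₀ hpos]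
      linarith
    have e2 : G Y ≤ B * (‖q'‖ ^ α)⁻¹ := by
      have h := hsuper y q' Y (norm_pos_iff.1 hq'0) hY
      have hpos := Real.rpow_pos_of_pos hq'0 α
      rw [← div_eq_mul_inv, le_div_iff₀ hpos]
      linarith
    have e3 := hLt _ hp'l hp'u
    have e4 := hLt _ hq'l hq'u
    have e5 : G X ≤ G Y + A * (2 * κ + 2 * τ) - a * (2 * L - 2 * κ - 2 * τ) := by
      refine hG.le_sub X Y _ _ n (by positivity) hn1 (fun k => ?_) ?_
      · have := hXY k k
        rw [sub_self, map_zero, inner_zero_left, hT₂q] at this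
        linarith
      · have := hXY n (-n)
        rw [hT₁q, hT₂q, sub_neg_eq_add, ← two_smul ℝ n, inner_smul_right,
          real_inner_self_eq_norm_sq, norm_smul, norm_neg, hn1, map_neg, inner_neg_neg,
          Real.norm_eq_abs, abs_two] at this
        linarith
    have e6 : (A + a) * (2 * κ + 2 * τ) ≤ 1 / 2 := by
      calc (A + a) * (2 * κ + 2 * τ) ≤ (A + a) * (2 * (1 / (8 * (A + a))) +
            2 * (1 / (8 * (A + a)))) := by gcongr
        _ = 1 / 2 := by field_simp; norm_num
    nlinarith
  refine ⟨L, by linarith, fun x y => abs_le.2 ⟨?_, key x y⟩⟩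
  have := key y x
  rw [norm_sub_rev] at this
  linarith

end Lipschitz

section Data

variable {E : Type*} [NormedAddCommGroup E] [InnerProductSpace ℝ E]

theorem IsElliptic.neg {a A : ℝ} {G : (E →L[ℝ] E) → ℝ} (hG : IsElliptic a A G) :
    IsElliptic a A (fun X => -G (-X)) where
  zero := by simp [hG.zero]
  le_add X Y s hs h := by
    have := hG.le_add (-Y) (-X) s hs (fun k => by
      simp only [neg_apply, inner_neg_left]; linarith [h k])
    linarith
  le_sub X Y s t n hs hn h ht := by
    have := hG.le_sub (-Y) (-X) s t n hs hn (fun k => by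
      simp only [neg_apply, inner_neg_left]; linarith [h k])
      (by simp only [neg_apply, inner_neg_left]; linarith)
    linarith

/-- The data of the problem: operator `G`, exponent `α`, nonlinearity `f`, distinguished direction
`e`, together with the constants controlling the class of admissible solutions and the opening
`m` of a cone around `e`. -/
structure GibbonsData (E : Type*) [NormedAddCommGroup E] [InnerProductSpace ℝ E] where
  (a A α Lf δ L m : ℝ)
  G : (E →L[ℝ] E) → ℝ
  f : ℝ → ℝ
  e : E
  μ : ℕ → ℝ
  R : ℝ → ℝ
  a_pos : 0 < a
  A_nonneg : 0 ≤ A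
  Lf_nonneg : 0 ≤ Lf
  δ_pos : 0 < δ
  L_nonneg : 0 ≤ L
  m_pos : 0 < m
  m_le_one : m ≤ 1
  norm_e : ‖e‖ = 1
  μ_pos : ∀ n, 0 < μ n
  ell : IsElliptic a A G
  f_lip : ∀ s t, |s| ≤ 1 → |t| ≤ 1 → |f s - f t| ≤ Lf * |s - t|
  f_one : f 1 = 0
  f_neg_one : f (-1) = 0
  f_anti_pos : ∀ s t, 1 - δ ≤ s → s ≤ t → t ≤ 1 → f t ≤ f s
  f_anti_neg : ∀ s t, -1 ≤ s → s ≤ t → t ≤ -1 + δ → f t ≤ f s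

/-- The data of the equation satisfied by `x ↦ -u (-x)`. -/
def GibbonsData.reflect (D : GibbonsData E) : GibbonsData E :=
  { D with
    G := fun X => -D.G (-X)
    f := fun s => -D.f (-s)
    ell := D.ell.neg
    f_lip := fun s t hs ht => by
      have := D.f_lip (-s) (-t) (by rwa [abs_neg]) (by rwa [abs_neg])
      rw [← abs_neg, ← abs_neg (s - t)]
      convert this using 2 <;> ring_nf
    f_one := by rw [D.f_neg_one, neg_zero]
    f_neg_one := by rw [neg_neg, D.f_one, neg_zero]
    f_anti_pos := fun s t h1 h2 h3 => by
      have := D.f_anti_neg (-t) (-s) (by linarith) (by linarith) (by linarith)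
      linarith
    f_anti_neg := fun s t h1 h2 h3 => by
      have := D.f_anti_pos (-t) (-s) (by linarith) (by linarith) (by linarith)
      linarith }

theorem GibbonsData.reflect_reflect (D : GibbonsData E) : D.reflect.reflect = D := by
  cases D
  simp [GibbonsData.reflect]

/-- The function `x ↦ -w (-x)`. -/
def pointRefl (w : E → ℝ) : E → ℝ := fun x => -w (-x)

omit [InnerProductSpace ℝ E] in
theorem pointRefl_pointRefl (w : E → ℝ) : pointRefl (pointRefl w) = w := by
  funext x; simp [pointRefl]

theorem jetAbove_pointRefl_iff {w : E → ℝ} {x p : E} {b : E → ℝ} (hb : ∀ k, b (-k) = b k) :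
    JetAbove (pointRefl w) x p b ↔ JetBelow w (-x) p (fun k => -b k) := by
  have hn : Tendsto (fun k : E => -k) (𝓝 0) (𝓝 0) := by
    have := (continuous_neg (G := E)).tendsto 0
    rwa [neg_zero] at this
  constructor
  · intro h
    filter_upwards [hn.eventually h] with k hk
    simp only [pointRefl, inner_neg_right, hb, neg_add, neg_neg] at hk
    linarith
  · intro h
    filter_upwards [hn.eventually h] with k hk
    simp only [inner_neg_right, hb] at hk
    simp only [pointRefl, neg_add]
    linarith

theorem jetAbove_pointRefl_map_iff {w : E → ℝ} {x p : E} {X : E →L[ℝ] E} :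
    JetAbove (pointRefl w) x p (fun k => ⟪X k, k⟫) ↔ JetBelow w (-x) p (fun k => ⟪(-X) k, k⟫) := by
  rw [jetAbove_pointRefl_iff (by intro k; simp)]
  simp

/-- The half of the definition of a solution concerned with test functions from above. -/
structure IsSub (D : GibbonsData E) (w : E → ℝ) : Prop where
  visc : ∀ x p (X : E →L[ℝ] E), p ≠ 0 → JetAbove w x p (fun k => ⟪X k, k⟫) →
    -D.f (w x) ≤ ‖p‖ ^ D.α * D.G X
  grad : D.α ≠ 0 → ∀ (n : ℕ) x p (X : E →L[ℝ] E), |⟪D.e, x⟫| < n →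
    JetAbove w x p (fun k => ⟪X k, k⟫) → D.μ n ≤ ‖p‖

/-- Solutions of the equation with the prescribed bounds. -/
structure Adm (D : GibbonsData E) (w : E → ℝ) : Prop where
  lip : ∀ x y, |w x - w y| ≤ D.L * ‖x - y‖
  abs_le : ∀ x, |w x| ≤ 1
  lim_pos : ∀ ε > 0, ∀ x, D.R ε ≤ ⟪D.e, x⟫ → 1 - ε ≤ w x
  lim_neg : ∀ ε > 0, ∀ x, ⟪D.e, x⟫ ≤ -D.R ε → w x ≤ -1 + ε
  sub : IsSub D w
  super : IsSub D.reflect (pointRefl w)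

theorem Adm.reflect {D : GibbonsData E} {w : E → ℝ} (h : Adm D w) : Adm D.reflect (pointRefl w) where
  lip x y := by
    have := h.lip (-y) (-x)
    simp only [pointRefl]
    rw [neg_sub_neg] at this
    rwa [neg_sub_neg]
  abs_le x := by simpa [pointRefl] using h.abs_le (-x)
  lim_pos ε hε x hx := by
    have := h.lim_neg ε hε (-x) (by rw [inner_neg_right]; exact neg_le_neg hx)
    simp only [pointRefl]; linarith
  lim_neg ε hε x hx := by
    have hx' : ⟪D.e, x⟫ ≤ -D.R ε := hx
    have := h.lim_pos ε hε (-x) (by rw [inner_neg_right]; linarith)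
    simp only [pointRefl]; linarith
  sub := h.super
  super := by rw [D.reflect_reflect, pointRefl_pointRefl]; exact h.sub

theorem Adm.continuous {D : GibbonsData E} {w : E → ℝ} (h : Adm D w) : Continuous w := by
  refine (LipschitzWith.of_dist_le_mul (K := ⟨D.L, D.L_nonneg⟩) fun x y => ?_).continuous
  rw [Real.dist_eq, dist_eq_norm]; exact h.lip x y

theorem JetAbove.translate {w : E → ℝ} {y x p : E} {b : E → ℝ}
    (h : JetAbove (fun x => w (x + y)) x p b) : JetAbove w (x + y) p b := by
  filter_upwards [h] with k hk
  rwa [add_right_comm] at hk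

theorem IsSub.translate {D : GibbonsData E} {w : E → ℝ} (h : IsSub D w) {y : E}
    (hy : ⟪D.e, y⟫ = 0) : IsSub D (fun x => w (x + y)) where
  visc x p X hp hX := h.visc (x + y) p X hp hX.translate
  grad hα n x p X hx hX := h.grad hα n (x + y) p X (by rwa [inner_add_right, hy, add_zero])
    hX.translate

theorem Adm.translate {D : GibbonsData E} {w : E → ℝ} (h : Adm D w) {y : E}
    (hy : ⟪D.e, y⟫ = 0) : Adm D (fun x => w (x + y)) where
  lip x x' := by simpa using h.lip (x + y) (x' + y)
  abs_le x := h.abs_le _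
  lim_pos ε hε x hx := h.lim_pos ε hε _ (by rwa [inner_add_right, hy, add_zero])
  lim_neg ε hε x hx := h.lim_neg ε hε _ (by rwa [inner_add_right, hy, add_zero])
  sub := h.sub.translate hy
  super := by
    have : pointRefl (fun x => w (x + y)) = fun x => pointRefl w (x + -y) := by
      funext x; simp only [pointRefl, neg_add, neg_neg]
    rw [this]
    exact h.super.translate (by rw [inner_neg_right]; exact neg_eq_zero.2 hy)

variable [FiniteDimensional ℝ E]

/-- Second order expansion of a quadratic polynomial at a different point. -/
theorem quadratic_shift (X : E →L[ℝ] E) (p k h : E) :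
    ⟪p, k + h⟫ + 1 / 2 * ⟪X (k + h), k + h⟫ = ⟪p, k⟫ + 1 / 2 * ⟪X k, k⟫ +
      ⟪p + (1 / 2 : ℝ) • (X k + X.adjoint k), h⟫ + 1 / 2 * ⟪X h, h⟫ := by
  simp only [map_add, inner_add_left, inner_add_right, real_inner_smul_left,
    ContinuousLinearMap.adjoint_inner_left]
  rw [real_inner_comm (X h) k]; ring

theorem JetAbove.exists_strict {w : E → ℝ} {x p : E} {X : E →L[ℝ] E}
    (h : JetAbove w x p (fun k => ⟪X k, k⟫)) {ε : ℝ} :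
    ∃ r > 0, ∀ k, ‖k‖ ≤ r → w (x + k) ≤ w x + (⟪p, k⟫ +
      1 / 2 * ⟪(X + ε • ContinuousLinearMap.id ℝ E) k, k⟫) - ε / 2 * ‖k‖ ^ 2 := by
  obtain ⟨r, hr, hrw⟩ := Metric.eventually_nhds_iff_ball.1 h
  refine ⟨r / 2, by positivity, fun k hk => ?_⟩
  have := hrw k (by rw [mem_ball_zero_iff]; linarith)
  simp only [add_apply, smul_apply, ContinuousLinearMap.id_apply, inner_add_left,
    real_inner_smul_left, real_inner_self_eq_norm_sq]
  linarith

/-- Stability of test functions from above under pointwise limits of equi-Lipschitz functions. -/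
theorem JetAbove.exists_approx {L : ℝ} {𝒰 : Ultrafilter ℕ} {w : ℕ → E → ℝ} {w₀ : E → ℝ}
    (hlip : ∀ n x y, |w n x - w n y| ≤ L * ‖x - y‖)
    (hw : ∀ x, Tendsto (fun n => w n x) 𝒰 (𝓝 (w₀ x))) {x p : E} {X : E →L[ℝ] E}
    (h : JetAbove w₀ x p (fun k => ⟪X k, k⟫)) {ε : ℝ} (hε : 0 < ε) :
    ∃ (y : ℕ → E) (q : ℕ → E), Tendsto y 𝒰 (𝓝 x) ∧ Tendsto q 𝒰 (𝓝 p) ∧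
      Tendsto (fun n => w n (y n)) 𝒰 (𝓝 (w₀ x)) ∧ ∀ᶠ n in (𝒰 : Filter ℕ),
        JetAbove (w n) (y n) (q n) (fun k => ⟪(X + ε • ContinuousLinearMap.id ℝ E) k, k⟫) := by
  have := FiniteDimensional.proper_real E
  obtain ⟨r, hr, hrw⟩ := h.exists_strict (ε := ε)
  set X' := X + ε • ContinuousLinearMap.id ℝ E
  have hc : ∀ n, Continuous (w n) := fun n => by
    refine (LipschitzWith.of_dist_le_mul (K := L.toNNReal) fun x y => ?_).continuous
    rw [Real.dist_eq, dist_eq_norm]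
    exact (hlip n x y).trans (by gcongr; exact Real.le_coe_toNNReal L)
  have hex : ∀ n, ∃ k ∈ closedBall (0 : E) r, ∀ k' ∈ closedBall (0 : E) r,
      w n (x + k') - (⟪p, k'⟫ + 1 / 2 * ⟪X' k', k'⟫) ≤
        w n (x + k) - (⟪p, k⟫ + 1 / 2 * ⟪X' k, k⟫) := by
    intro n
    have hcn := hc n
    obtain ⟨k, hk, hmax⟩ := (isCompact_closedBall (0 : E) r).exists_isMaxOn
      (f := fun k => w n (x + k) - (⟪p, k⟫ + 1 / 2 * ⟪X' k, k⟫)) ⟨0, by simp [hr.le]⟩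
      (by fun_prop)
    exact ⟨k, hk, fun k' hk' => hmax hk'⟩
  choose k hk hmax using hex
  obtain ⟨k₀, hk₀, hlim⟩ := (isCompact_closedBall (0 : E) r).ultrafilter_le_nhds (𝒰.map k)
    (by rw [Ultrafilter.coe_map, Filter.le_principal_iff]; exact Filter.Eventually.of_forall (f := (𝒰 : Filter ℕ)) (p := fun n => k n ∈ closedBall (0:E) r) hk)
  have hlim : Tendsto k 𝒰 (𝓝 k₀) := hlim
  have hval : Tendsto (fun n => w n (x + k n)) 𝒰 (𝓝 (w₀ (x + k₀))) := by
    have h1 : Tendsto (fun n => L * ‖x + k n - (x + k₀)‖) 𝒰 (𝓝 0) := by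
      have : Tendsto (fun n => L * ‖x + k n - (x + k₀)‖) 𝒰 (𝓝 (L * ‖x + k₀ - (x + k₀)‖)) := by
        exact ((tendsto_const_nhds.add hlim).sub tendsto_const_nhds).norm.const_mul L
      simpa using this
    have h2 : Tendsto (fun n => w n (x + k n) - w n (x + k₀)) 𝒰 (𝓝 0) :=
      squeeze_zero_norm (fun n => hlip n _ _) h1
    simpa using h2.add (hw (x + k₀))
  have hq : Continuous fun k : E => ⟪p, k⟫ + 1 / 2 * ⟪X' k, k⟫ := by fun_prop
  have hk0 : k₀ = 0 := by
    have h1 : Tendsto (fun n => w n (x + k n) - (⟪p, k n⟫ + 1 / 2 * ⟪X' (k n), k n⟫)) 𝒰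
        (𝓝 (w₀ (x + k₀) - (⟪p, k₀⟫ + 1 / 2 * ⟪X' k₀, k₀⟫))) :=
      hval.sub ((hq.tendsto k₀).comp hlim)
    have h2 := le_of_tendsto_of_tendsto (hw x) h1 (Filter.Eventually.of_forall fun n => by
      have := hmax n 0 (by simp [hr.le])
      simpa using this)
    have h3 := hrw k₀ (mem_closedBall_zero_iff.1 hk₀)
    have h4 : ε / 2 * ‖k₀‖ ^ 2 ≤ 0 := by linarith
    have h5 : ‖k₀‖ ^ 2 ≤ 0 := by
      by_contra! h
      have : 0 < ε / 2 * ‖k₀‖ ^ 2 := by positivity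
      linarith
    exact norm_eq_zero.1 (pow_eq_zero_iff two_ne_zero |>.1 (le_antisymm h5 (sq_nonneg _)))
  subst hk0
  refine ⟨fun n => x + k n, fun n => p + (1 / 2 : ℝ) • (X' (k n) + X'.adjoint (k n)),
    by simpa using hlim.const_add x, ?_, by simpa using hval, ?_⟩
  · have : Continuous fun k : E => p + (1 / 2 : ℝ) • (X' k + X'.adjoint k) := by fun_prop
    have := (this.tendsto 0).comp hlim
    simpa [Function.comp_def] using this
  · filter_upwards [hlim.eventually (Metric.ball_mem_nhds 0 (half_pos hr))] with n hn
    filter_upwards [Metric.ball_mem_nhds (0 : E) (half_pos hr)] with j hj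
    have hj' : k n + j ∈ closedBall (0 : E) r := by
      rw [mem_closedBall_zero_iff]
      rw [mem_ball_zero_iff] at hj
      rw [dist_zero_right] at hn
      exact (norm_add_le _ _).trans (by linarith)
    have h1 := hmax n _ hj'
    rw [quadratic_shift] at h1
    rw [add_assoc]
    linarith

theorem IsSub.of_tendsto {D : GibbonsData E} {𝒰 : Ultrafilter ℕ} {w : ℕ → E → ℝ} {w₀ : E → ℝ}
    (hlip : ∀ n x y, |w n x - w n y| ≤ D.L * ‖x - y‖) (hb : ∀ n x, |w n x| ≤ 1)
    (hs : ∀ n, IsSub D (w n))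
    (hw : ∀ x, Tendsto (fun n => w n x) 𝒰 (𝓝 (w₀ x))) : IsSub D w₀ where
  visc x p X hp hX := by
    have hb₀ : |w₀ x| ≤ 1 := le_of_tendsto (hw x).abs (Filter.Eventually.of_forall fun n => hb n x)
    have key : ∀ ε > 0, -D.f (w₀ x) ≤ ‖p‖ ^ D.α * D.G X + ‖p‖ ^ D.α * D.A * ε := by
      intro ε hε
      obtain ⟨y, q, hy, hq, hwy, hj⟩ := hX.exists_approx hlip hw hε
      have h1 : Tendsto (fun n => D.f (w n (y n))) 𝒰 (𝓝 (D.f (w₀ x))) := by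
        rw [← tendsto_sub_nhds_zero_iff]
        refine squeeze_zero_norm (a := fun n => D.Lf * |w n (y n) - w₀ x|)
          (fun n => D.f_lip _ _ (hb _ _) hb₀) ?_
        have := ((tendsto_sub_nhds_zero_iff.2 hwy).abs).const_mul D.Lf
        simpa using this
      have h2 : Tendsto (fun n => ‖q n‖ ^ D.α * D.G (X + ε • ContinuousLinearMap.id ℝ E)) 𝒰
          (𝓝 (‖p‖ ^ D.α * D.G (X + ε • ContinuousLinearMap.id ℝ E))) :=
        (hq.norm.rpow_const (Or.inl (norm_ne_zero_iff.2 hp))).mul_const _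
      have h3 := le_of_tendsto_of_tendsto h1.neg h2 (by
        filter_upwards [hj, hq.eventually_ne hp] with n hn hqn
        exact (hs n).visc _ _ _ hqn hn)
      have h4 := D.ell.le_add (X + ε • ContinuousLinearMap.id ℝ E) X ε hε.le (fun k => by
        simp only [add_apply, smul_apply, ContinuousLinearMap.id_apply, inner_add_left,
          real_inner_smul_left, real_inner_self_eq_norm_sq]; exact le_rfl)
      have h5 : 0 ≤ ‖p‖ ^ D.α := by positivity
      nlinarith [mul_le_mul_of_nonneg_left h4 h5]
    have h1 : Tendsto (fun ε : ℝ => ‖p‖ ^ D.α * D.G X + ‖p‖ ^ D.α * D.A * ε) (𝓝[>] 0)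
        (𝓝 (‖p‖ ^ D.α * D.G X)) := by
      have : Continuous fun ε : ℝ => ‖p‖ ^ D.α * D.G X + ‖p‖ ^ D.α * D.A * ε := by fun_prop
      have := this.tendsto 0
      rw [mul_zero, add_zero] at this
      exact this.mono_left nhdsWithin_le_nhds
    exact ge_of_tendsto h1 (by filter_upwards [self_mem_nhdsWithin] with ε hε using key ε hε)
  grad hα n x p X hx hX := by
    obtain ⟨y, q, hy, hq, hwy, hj⟩ := hX.exists_approx hlip hw one_pos
    have h1 : Tendsto (fun n => |⟪D.e, y n⟫|) 𝒰 (𝓝 |⟪D.e, x⟫|) := (tendsto_const_nhds.inner hy).abs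
    refine ge_of_tendsto hq.norm ?_
    filter_upwards [hj, h1.eventually_lt_const hx] with i hi hi'
    exact (hs i).grad hα n _ _ _ hi' hi

theorem Adm.of_tendsto {D : GibbonsData E} {𝒰 : Ultrafilter ℕ} {w : ℕ → E → ℝ} {w₀ : E → ℝ}
    (hs : ∀ n, Adm D (w n)) (hw : ∀ x, Tendsto (fun n => w n x) 𝒰 (𝓝 (w₀ x))) : Adm D w₀ where
  lip x y := le_of_tendsto ((hw x).sub (hw y)).abs (Eventually.of_forall fun n => (hs n).lip x y)
  abs_le x := le_of_tendsto (hw x).abs (Eventually.of_forall fun n => (hs n).abs_le x)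
  lim_pos ε hε x hx := ge_of_tendsto (hw x) (Eventually.of_forall fun n => (hs n).lim_pos ε hε x hx)
  lim_neg ε hε x hx := le_of_tendsto (hw x) (Eventually.of_forall fun n => (hs n).lim_neg ε hε x hx)
  sub := IsSub.of_tendsto (fun n => (hs n).lip) (fun n => (hs n).abs_le) (fun n => (hs n).sub) hw
  super := IsSub.of_tendsto (D := D.reflect) (w := fun n => pointRefl (w n))
    (fun n => (hs n).reflect.lip) (fun n => (hs n).reflect.abs_le)
    (fun n => (hs n).super) (fun x => (hw (-x)).neg)

/-- Compactness of the class of admissible solutions. -/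
theorem exists_adm_limit {D : GibbonsData E} (𝒰 : Ultrafilter ℕ) {w : ℕ → E → ℝ}
    (hs : ∀ n, Adm D (w n)) : ∃ w₀, Adm D w₀ ∧ ∀ (x : ℕ → E) (x₀ : E), Tendsto x 𝒰 (𝓝 x₀) →
      Tendsto (fun n => w n (x n)) 𝒰 (𝓝 (w₀ x₀)) := by
  have hex : ∀ x, ∃ y, Tendsto (fun n => w n x) 𝒰 (𝓝 y) := by
    intro x
    obtain ⟨y, -, hy⟩ := (isCompact_Icc (a := (-1 : ℝ)) (b := 1)).ultrafilter_le_nhds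
      (𝒰.map fun n => w n x) (by
        rw [Ultrafilter.coe_map, Filter.le_principal_iff]
        exact Filter.Eventually.of_forall (f := (𝒰 : Filter ℕ)) fun n => abs_le.1 ((hs n).abs_le x))
    exact ⟨y, hy⟩
  choose w₀ hw₀ using hex
  refine ⟨w₀, Adm.of_tendsto hs hw₀, fun x x₀ hx => ?_⟩
  have h1 : Tendsto (fun n => D.L * ‖x n - x₀‖) 𝒰 (𝓝 0) := by
    have := (tendsto_sub_nhds_zero_iff.2 hx).norm.const_mul D.L
    simpa using this
  have h2 : Tendsto (fun n => w n (x n) - w n x₀) 𝒰 (𝓝 0) :=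
    squeeze_zero_norm (fun n => (hs n).lip _ _) h1
  simpa using h2.add (hw₀ x₀)

/-- A bounded sequence converges along an ultrafilter. -/
theorem exists_tendsto_of_norm_le (𝒰 : Ultrafilter ℕ) {x : ℕ → E} {C : ℝ} (h : ∀ n, ‖x n‖ ≤ C) :
    ∃ x₀, Tendsto x 𝒰 (𝓝 x₀) := by
  have := FiniteDimensional.proper_real E
  obtain ⟨y, -, hy⟩ := (isCompact_closedBall (0 : E) C).ultrafilter_le_nhds (𝒰.map x) (by
    rw [Ultrafilter.coe_map, Filter.le_principal_iff]
    exact Filter.Eventually.of_forall (f := (𝒰 : Filter ℕ)) (p := fun n => x n ∈ closedBall (0 : E) C)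
      fun n => by simpa using h n)
  exact ⟨y, hy⟩

end Data

theorem exists_inv_rpow_bound (α : ℝ) {m M : ℝ} (hm : 0 < m) :
    ∃ C : ℝ, 0 ≤ C ∧ ∀ s t : ℝ, (α ≠ 0 → m ≤ s) → (α ≠ 0 → m ≤ t) → s ≤ M → t ≤ M →
      (s ^ α)⁻¹ ≤ C ∧ |(s ^ α)⁻¹ - (t ^ α)⁻¹| ≤ C * |s - t| := by
  by_cases hα : α = 0
  · refine ⟨1, zero_le_one, fun s t _ _ _ _ => ?_⟩
    simp [hα]
  have hpos : ∀ s ∈ Set.Icc m M, 0 < s := fun s hs => hm.trans_le hs.1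
  have hd : ∀ s ∈ Set.Icc m M,
      HasDerivWithinAt (fun s : ℝ => s ^ (-α)) (-α * s ^ (-α - 1)) (Set.Icc m M) s := fun s hs =>
    (Real.hasDerivAt_rpow_const (Or.inl (hpos s hs).ne')).hasDerivWithinAt
  have hc : ContinuousOn (fun s : ℝ => -α * s ^ (-α - 1)) (Set.Icc m M) := fun s hs =>
    (continuousAt_const.mul
      (Real.continuousAt_rpow_const _ _ (Or.inl (hpos s hs).ne'))).continuousWithinAt
  obtain ⟨C₁, hC₁⟩ := isCompact_Icc.exists_bound_of_continuousOn hc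
  obtain ⟨C₂, hC₂⟩ := isCompact_Icc.exists_bound_of_continuousOn
    (fun s hs => (hd s hs).continuousWithinAt)
  refine ⟨max 0 (max C₁ C₂), le_max_left _ _, fun s t h1 h2 h3 h4 => ?_⟩
  have hs : s ∈ Set.Icc m M := ⟨h1 hα, h3⟩
  have ht : t ∈ Set.Icc m M := ⟨h2 hα, h4⟩
  rw [← Real.rpow_neg (hpos s hs).le, ← Real.rpow_neg (hpos t ht).le]
  refine ⟨(le_abs_self _).trans ((hC₂ s hs).trans
    ((le_max_right _ _).trans (le_max_right _ _))), ?_⟩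
  refine ((convex_Icc m M).norm_image_sub_le_of_norm_hasDerivWithin_le hd hC₁ ht hs).trans ?_
  exact mul_le_mul_of_nonneg_right ((le_max_left _ _).trans (le_max_right _ _)) (norm_nonneg _)

theorem IsCompact.exists_forall_le_neg {X : Type*} [TopologicalSpace X] {s : Set X}
    (hs : IsCompact s) {φ : X → ℝ} (hφ : ContinuousOn φ s) (h : ∀ x ∈ s, φ x < 0) :
    ∃ γ > 0, ∀ x ∈ s, φ x ≤ -γ := by
  rcases s.eq_empty_or_nonempty with rfl | hne
  · exact ⟨1, one_pos, by simp⟩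
  · obtain ⟨x, hx, hmax⟩ := hs.exists_isMaxOn hne hφ
    exact ⟨-φ x, neg_pos.2 (h x hx), fun y hy => by rw [neg_neg]; exact hmax hy⟩

section Hopf

variable {E : Type*} [NormedAddCommGroup E] [InnerProductSpace ℝ E] [FiniteDimensional ℝ E]

/-- A closed set which meets a connected open set without covering it is touched from outside by
a ball. -/
theorem exists_touching_ball {Ω Z : Set E} (hΩ : IsOpen Ω) (hΩc : IsPreconnected Ω)
    (hZ : IsClosed Z) (hne : (Ω ∩ Z).Nonempty) (hnot : ¬ Ω ⊆ Z) :
    ∃ (y z : E) (R : ℝ), 0 < R ∧ z ∈ Ω ∧ z ∈ Z ∧ ‖y - z‖ = R ∧ ∀ x, ‖x - y‖ < R → x ∉ Z := by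
  have := FiniteDimensional.proper_real E
  have hfr : ∃ z ∈ Ω ∩ Z, z ∈ closure Zᶜ := by
    by_contra! h
    obtain ⟨x, hxΩ, hxZ⟩ := Set.not_subset.1 hnot
    have h1 : Ω ⊆ interior Z ∪ Zᶜ := fun w hw => by
      by_cases hwZ : w ∈ Z
      · left
        have := h w ⟨hw, hwZ⟩
        rwa [closure_compl, Set.notMem_compl_iff] at this
      · exact Or.inr hwZ
    obtain ⟨w, hw1, hw2⟩ := hne
    have hw3 : w ∈ interior Z := by
      rcases h1 hw1 with h | h
      · exact h
      · exact absurd hw2 h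
    obtain ⟨v, -, hv1, hv2⟩ := hΩc _ _ isOpen_interior hZ.isOpen_compl h1 ⟨w, hw1, hw3⟩
      ⟨x, hxΩ, hxZ⟩
    exact hv2 (interior_subset hv1)
  obtain ⟨z₁, ⟨hz₁Ω, hz₁Z⟩, hz₁c⟩ := hfr
  obtain ⟨ρ, hρ, hball⟩ := Metric.isOpen_iff.1 hΩ z₁ hz₁Ω
  obtain ⟨y, hyZ, hy⟩ := Metric.mem_closure_iff.1 hz₁c (ρ / 2) (by positivity)
  obtain ⟨z, hz, hzd⟩ := hZ.exists_infDist_eq_dist ⟨z₁, hz₁Z⟩ y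
  have hzy : dist y z ≤ dist y z₁ := hzd ▸ infDist_le_dist_of_mem hz₁Z
  refine ⟨y, z, ‖y - z‖, ?_, ?_, hz, rfl, fun x hx hxZ => ?_⟩
  · rw [norm_pos_iff, sub_ne_zero]
    rintro rfl
    exact hyZ hz
  · refine hball ?_
    rw [mem_ball]
    calc dist z z₁ ≤ dist z y + dist y z₁ := dist_triangle _ _ _
      _ < ρ := by rw [dist_comm z y]; rw [dist_comm] at hy; linarith
  · have h1 := infDist_le_dist_of_mem (x := y) hxZ
    rw [hzd, dist_eq_norm, dist_eq_norm, norm_sub_rev y x] at h1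
    linarith

/-- The quadratic barrier in the Hopf lemma. -/
theorem barrier_pos_imp {ν h : E} {Λ κ R r : ℝ} (hν : ‖ν‖ = 1) (hR : 0 < R)
    (hκ : κ = 2 / R) (hΛ : 0 ≤ Λ) (hr : r * (Λ + κ) ≤ 1) (hh : ‖h‖ ≤ r) (hh0 : h ≠ 0)
    (hb : 0 ≤ ⟪ν, h⟫ + Λ * ⟪ν, h⟫ ^ 2 - κ * (‖h‖ ^ 2 - ⟪ν, h⟫ ^ 2)) :
    ‖h - R • ν‖ < R := by
  have hκ0 : 0 < κ := by rw [hκ]; positivity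
  have hs := abs_real_inner_le_norm ν h
  rw [hν, one_mul] at hs
  set s := ⟪ν, h⟫
  have hh1 : 0 < ‖h‖ := norm_pos_iff.2 hh0
  have hκh : κ * ‖h‖ ^ 2 ≤ s + (Λ + κ) * s ^ 2 := by linarith
  have habs : (Λ + κ) * s ^ 2 ≤ |s| := by
    have : (Λ + κ) * |s| ≤ 1 := by nlinarith [abs_nonneg s]
    rw [← sq_abs]; nlinarith [abs_nonneg s]
  have hκh0 : 0 < κ * ‖h‖ ^ 2 := by positivity
  have hs0 : 0 < s := by
    by_contra! hs0
    rw [abs_of_nonpos hs0] at habs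
    linarith
  rw [abs_of_pos hs0] at habs
  have h2 : ‖h‖ ^ 2 ≤ R * s := by
    have : κ * ‖h‖ ^ 2 ≤ 2 * s := by linarith
    rw [hκ, div_mul_eq_mul_div, div_le_iff₀ hR] at this
    linarith
  have h3 : ‖h - R • ν‖ ^ 2 < R ^ 2 := by
    rw [norm_sub_sq_real, inner_smul_right, norm_smul, hν, Real.norm_eq_abs, mul_one, sq_abs,
      real_inner_comm]
    have : 0 < R * s := by positivity
    change ‖h‖ ^ 2 - 2 * (R * s) + R ^ 2 < R ^ 2
    linarith
  exact lt_of_pow_lt_pow_left₀ 2 hR.le h3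

set_option maxHeartbeats 1600000 in
theorem exists_jets_of_barrier {J V : E → ℝ} {L θ : ℝ} (hL : 0 ≤ L)
    (hJl : ∀ x y, |J x - J y| ≤ L * ‖x - y‖) (hVl : ∀ x y, |V x - V y| ≤ L * ‖x - y‖)
    (hJ1 : ∀ x, |J x| ≤ 1) (hV1 : ∀ x, |V x| ≤ 1) (hle : ∀ x, J x ≤ V x + θ)
    {z ν : E} {B : E →L[ℝ] E} (hB : ∀ x y, ⟪B x, y⟫ = ⟪x, B y⟫) (hz : J z = V z + θ)
    {r η : ℝ} (hr : 0 < r)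
    (hbdry : ∀ h, ‖h‖ = r → J (z + h) - V (z + h) - θ + η * (⟪ν, h⟫ + 1 / 2 * ⟪B h, h⟫) < 0)
    {τ : ℝ} (hτ : 0 < τ) :
    ∃ (h x y p q : E) (X Y : E →L[ℝ] E), ‖h‖ ≤ r ∧ ‖x - z‖ ≤ r + τ ∧ ‖y - z‖ ≤ r + τ ∧
      -(η * (⟪ν, h⟫ + 1 / 2 * ⟪B h, h⟫)) - τ ≤ J x - V y - θ ∧ J x - V y - θ ≤ τ ∧
      ‖p - q + η • (ν + B h)‖ ≤ τ ∧ ‖q‖ ≤ 2 * L + τ ∧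
      JetAbove J x p (fun k => ⟪X k, k⟫) ∧ JetBelow V y q (fun k => ⟪Y k, k⟫) ∧
      ∀ ξ, ⟪X ξ, ξ⟫ ≤ ⟪Y ξ, ξ⟫ - η * ⟪B ξ, ξ⟫ + τ * ‖ξ‖ ^ 2 := by
  have := FiniteDimensional.proper_real E
  have hJc : Continuous J := by
    refine (LipschitzWith.of_dist_le_mul (K := ⟨L, hL⟩) fun x y => ?_).continuous
    rw [Real.dist_eq, dist_eq_norm]; exact hJl x y
  have hVc : Continuous V := by
    refine (LipschitzWith.of_dist_le_mul (K := ⟨L, hL⟩) fun x y => ?_).continuous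
    rw [Real.dist_eq, dist_eq_norm]; exact hVl x y
  obtain ⟨γ, hγ, hbd⟩ := (isCompact_sphere (0 : E) r).exists_forall_le_neg
    (φ := fun h => J (z + h) - V (z + h) - θ + η * (⟪ν, h⟫ + 1 / 2 * ⟪B h, h⟫)) (by fun_prop)
    (fun h hh => hbdry h (mem_sphere_zero_iff_norm.1 hh))
  obtain ⟨j, hj⟩ : ∃ j : ℝ, j = 1 + 2 * L ^ 2 / γ * 2 + 2 * L / r * 2 + 2 * L / τ * 2 +
    4 * L ^ 2 / τ * 2 := ⟨_, rfl⟩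
  have p1 : 0 ≤ 2 * L ^ 2 / γ := by positivity
  have p2 : 0 ≤ 2 * L / r := by positivity
  have p3 : 0 ≤ 2 * L / τ := by positivity
  have p4 : 0 ≤ 4 * L ^ 2 / τ := by positivity
  have hj0 : 0 < j := by rw [hj]; positivity
  have hjγ : 2 * L ^ 2 < γ * j := by
    rw [← div_lt_iff₀' hγ]; linarith
  have hjr : 2 * L < r * j := by rw [← div_lt_iff₀' hr]; linarith
  have hjτ : 2 * L * 2 ≤ τ * j := by rw [← div_le_iff₀' hτ, mul_div_right_comm]; linarith
  have hjτ2 : 4 * L ^ 2 * 2 ≤ τ * j := by rw [← div_le_iff₀' hτ, mul_div_right_comm]; linarith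
  obtain ⟨⟨h, k⟩, hmem, hmax⟩ := ((isCompact_closedBall (0 : E) r).prod
    (isCompact_closedBall (0 : E) (2 * r))).exists_isMaxOn (f := fun w : E × E =>
      J (z + w.1) - V (z + w.2) + η * (⟪ν, w.1⟫ + 1 / 2 * ⟪B w.1, w.1⟫) -
        j / 2 * ‖w.1 - w.2‖ ^ 2) ⟨(0, 0), by simp [hr.le]⟩ (by fun_prop)
  have hmax' : ∀ h' k', ‖h'‖ ≤ r → ‖k'‖ ≤ 2 * r →
      J (z + h') - V (z + k') + η * (⟪ν, h'⟫ + 1 / 2 * ⟪B h', h'⟫) - j / 2 * ‖h' - k'‖ ^ 2 ≤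
      J (z + h) - V (z + k) + η * (⟪ν, h⟫ + 1 / 2 * ⟪B h, h⟫) - j / 2 * ‖h - k‖ ^ 2 := by
    intro h' k' h1 h2
    exact hmax (show (h', k') ∈ _ from ⟨by simpa using h1, by simpa using h2⟩)
  have hhr : ‖h‖ ≤ r := by simpa using hmem.1
  have hjd : j * ‖h - k‖ ≤ 2 * L := by
    have h1 := hmax' h h hhr (by linarith)
    rw [sub_self, norm_zero] at h1
    have h2 := (abs_le.1 (hVl (z + h) (z + k))).2
    rw [add_sub_add_left_eq_sub] at h2
    by_contra! h3
    have h4 : 0 < ‖h - k‖ := by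
      by_contra! h4
      have : ‖h - k‖ = 0 := le_antisymm h4 (norm_nonneg _)
      rw [this] at h3; linarith
    nlinarith
  have hd : ‖h - k‖ * j ≤ 2 * L := by linarith
  have hdr : ‖h - k‖ < r := lt_of_mul_lt_mul_right (by linarith : ‖h - k‖ * j < r * j) hj0.le
  have hdτ : ‖h - k‖ * 2 ≤ τ := le_of_mul_le_mul_right
    (by linarith : ‖h - k‖ * 2 * j ≤ τ * j) hj0
  have hLd : L * ‖h - k‖ * j ≤ 2 * L ^ 2 := by nlinarith
  have hLdγ : L * ‖h - k‖ < γ := lt_of_mul_lt_mul_right (by linarith : _ < γ * j) hj0.le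
  have hLdτ : L * ‖h - k‖ * 4 ≤ τ := le_of_mul_le_mul_right (by linarith : _ ≤ τ * j) hj0
  have hVd := abs_le.1 (hVl (z + h) (z + k))
  rw [add_sub_add_left_eq_sub] at hVd
  have hM0 : 0 ≤ J (z + h) - V (z + k) + η * (⟪ν, h⟫ + 1 / 2 * ⟪B h, h⟫) - θ := by
    have h1 := hmax' 0 0 (by simp [hr.le]) (by simp [hr.le])
    simp only [add_zero, inner_zero_right, sub_self, norm_zero, mul_zero] at h1
    have : 0 ≤ j / 2 * ‖h - k‖ ^ 2 := by positivity
    linarith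
  have hhr' : ‖h‖ < r := by
    refine lt_of_le_of_ne hhr fun he => ?_
    have := hbd h (mem_sphere_zero_iff_norm.2 he)
    linarith [hVd.1]
  have hk : ‖k‖ < 2 * r := by
    have := norm_sub_norm_le k h
    rw [norm_sub_rev] at this
    linarith
  obtain ⟨ρ, hρ⟩ : ∃ ρ, ρ = min (r - ‖h‖) (2 * r - ‖k‖) := ⟨_, rfl⟩
  have hρ0 : 0 < ρ := hρ ▸ lt_min (by linarith) (by linarith)
  have hρ1 : ρ ≤ r - ‖h‖ := hρ ▸ min_le_left _ _
  have hρ2 : ρ ≤ 2 * r - ‖k‖ := hρ ▸ min_le_right _ _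
  obtain ⟨σ, hσ⟩ : ∃ σ, σ = min (τ / 4) (τ / (8 * (L + 1))) := ⟨_, rfl⟩
  have hσ0 : 0 < σ := by rw [hσ]; positivity
  have hσ1 : σ ≤ τ / 4 := hσ ▸ min_le_left _ _
  have hσ2 : L * σ ≤ τ / 8 := by
    calc L * σ ≤ (L + 1) * (τ / (8 * (L + 1))) :=
          mul_le_mul (by linarith) (hσ ▸ min_le_right _ _) hσ0.le (by linarith)
      _ = τ / 8 := by field_simp
  obtain ⟨x, y, p, q, X, Y, hx, hy, hp, hq, hX, hY, hXY⟩ :=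
    (hilbertSumProd E).exists_jets_of_doubling hJc hVc hJ1 hV1
      (T₁ := j • ContinuousLinearMap.id ℝ E) (T₂ := -(η • B))
      (p := j • (h - k) - η • (ν + B h)) (q := j • (h - k)) (xh := z + h) (yh := z + k) (r := ρ)
      (by intro x y; simp [real_inner_smul_left, inner_smul_right])
      (by intro x y; simp [real_inner_smul_left, inner_smul_right, hB]) hρ0
      (by
        intro x y hx hy
        obtain ⟨d, rfl⟩ : ∃ d, x = z + h + d := ⟨x - (z + h), by abel⟩
        obtain ⟨l, rfl⟩ : ∃ l, y = z + k + l := ⟨y - (z + k), by abel⟩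
        rw [add_sub_cancel_left] at hx hy
        have h1 := hmax' (h + d) (k + l) ((norm_add_le _ _).trans (by linarith))
          ((norm_add_le _ _).trans (by linarith))
        rw [add_sub_cancel_left, add_sub_cancel_left]
        have h2 : ‖h + d - (k + l)‖ ^ 2 = ‖h - k‖ ^ 2 + 2 * ⟪h - k, d - l⟫ + ‖d - l‖ ^ 2 := by
          rw [← norm_add_sq_real]; congr 2; abel
        rw [h2, ← add_assoc, ← add_assoc] at h1
        have h3 : ⟪B d, h⟫ = ⟪B h, d⟫ := by rw [hB, real_inner_comm]
        have e1 : ⟪j • (h - k) - η • (ν + B h), d⟫ =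
            j * ⟪h - k, d⟫ - η * (⟪ν, d⟫ + ⟪B h, d⟫) := by
          rw [inner_sub_left, real_inner_smul_left, real_inner_smul_left, inner_add_left]
        have e2 : ⟪j • (h - k), l⟫ = j * ⟪h - k, l⟫ := real_inner_smul_left _ _ _
        have e3 : ⟪(j • ContinuousLinearMap.id ℝ E) (d - l), d - l⟫ = j * ‖d - l‖ ^ 2 := by
          rw [smul_apply, ContinuousLinearMap.id_apply, real_inner_smul_left,
            real_inner_self_eq_norm_sq]
        have e4 : ⟪(-(η • B)) d, d⟫ = -(η * ⟪B d, d⟫) := by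
          rw [neg_apply, smul_apply, inner_neg_left, real_inner_smul_left]
        rw [inner_sub_right, map_add, inner_add_right, inner_add_left, inner_add_right,
          inner_add_right, h3] at h1
        rw [e1, e2, e3, e4]
        linarith) hσ0
  have hxz : ‖x - (z + h)‖ * L ≤ τ / 8 := by nlinarith
  have hyz : ‖y - (z + k)‖ * L ≤ τ / 8 := by nlinarith
  have hJx := abs_le.1 (hJl x (z + h))
  have hVy := abs_le.1 (hVl y (z + k))
  refine ⟨h, x, y, p, q, X, Y, hhr, ?_, ?_, ?_, ?_, ?_, ?_, hX, hY, fun ξ => ?_⟩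
  · have : x - z = (x - (z + h)) + h := by abel
    rw [this]
    exact (norm_add_le _ _).trans (by linarith)
  · have : y - z = (y - (z + k)) + (h - (h - k)) := by abel
    rw [this]
    refine (norm_add_le _ _).trans ?_
    have := norm_sub_le h (h - k)
    linarith
  · linarith [hJx.1, hVy.2]
  · linarith [hJx.2, hVy.1, hle (z + h), hVd.2]
  · have : p - q + η • (ν + B h) = (p - (j • (h - k) - η • (ν + B h))) - (q - j • (h - k)) := by
      abel
    rw [this]
    exact (norm_sub_le _ _).trans (by linarith)
  · have := norm_sub_norm_le q (j • (h - k))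
    rw [norm_smul, Real.norm_eq_abs, abs_of_pos hj0] at this
    linarith
  · have := hXY ξ ξ
    simp only [sub_self, map_zero, inner_zero_left, zero_add, neg_apply, smul_apply,
      inner_neg_left, real_inner_smul_left] at this
    nlinarith [sq_nonneg ‖ξ‖]

end Hopf

section Comparison

variable {E : Type*} [NormedAddCommGroup E] [InnerProductSpace ℝ E]

/-- Near `z` the functions `J` and `V` satisfy the two differential inequalities whenever they are
tested with different gradients. -/
def IsComparable (D : GibbonsData E) (J V : E → ℝ) (z : E) : Prop :=
  ∃ r > 0, ∃ m₀ > 0, ∀ x y, ‖x - z‖ < r → ‖y - z‖ < r → ∀ p q (X Y : E →L[ℝ] E), p ≠ q →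
    JetAbove J x p (fun k => ⟪X k, k⟫) → JetBelow V y q (fun k => ⟪Y k, k⟫) →
    (D.α ≠ 0 → m₀ ≤ ‖p‖ ∧ m₀ ≤ ‖q‖) ∧ -D.f (J x) * (‖p‖ ^ D.α)⁻¹ ≤ D.G X ∧
      D.G Y ≤ -D.f (V y) * (‖q‖ ^ D.α)⁻¹

theorem GibbonsData.abs_f_le (D : GibbonsData E) {s : ℝ} (hs : |s| ≤ 1) : |D.f s| ≤ 2 * D.Lf := by
  have h := D.f_lip s 1 hs (by simp)
  rw [D.f_one, sub_zero] at h
  have : |s - 1| ≤ 2 := by rw [abs_le] at hs ⊢; constructor <;> linarith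
  nlinarith [D.Lf_nonneg]

theorem GibbonsData.f_sub_le (D : GibbonsData E) {s t θ ω : ℝ} (hs : |s| ≤ 1) (ht : |t| ≤ 1)
    (hθ : 0 ≤ θ) (hω : |s - t - θ| ≤ ω) (hcase : θ = 0 ∨ 1 - D.δ ≤ t ∨ s ≤ -1 + D.δ) :
    D.f s - D.f t ≤ D.Lf * ω := by
  have hω0 : 0 ≤ D.Lf * ω := mul_nonneg D.Lf_nonneg ((abs_nonneg _).trans hω)
  have hlip := (le_abs_self _).trans (D.f_lip s t hs ht)
  by_cases hst : |s - t| ≤ ω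
  · exact hlip.trans (mul_le_mul_of_nonneg_left hst D.Lf_nonneg)
  have hts : t ≤ s := by
    by_contra! h
    refine hst ?_
    rw [abs_of_nonpos (by linarith)] at hω ⊢
    linarith
  rw [abs_le] at hs ht
  rcases hcase with rfl | h | h
  · rw [sub_zero] at hω; exact absurd hω hst
  · linarith [D.f_anti_pos t s h hts hs.2]
  · linarith [D.f_anti_neg t s ht.1 hts h]

variable [FiniteDimensional ℝ E]

/-- The inequality which forbids an interior maximum after adding the Hopf barrier. -/
theorem jets_contradiction {D : GibbonsData E} {p q ν : E} {X Y B : E →L[ℝ] E}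
    {s t κ Λ η τ C : ℝ} (hs : |s| ≤ 1) (ht : |t| ≤ 1) (hη : 0 < η) (hκ : 0 ≤ κ) (hτ0 : 0 < τ)
    (hC : 0 ≤ C)
    (hν : ‖ν‖ = 1) (hB : ∀ ξ, ⟪B ξ, ξ⟫ = 2 * (Λ + κ) * ⟪ν, ξ⟫ ^ 2 - 2 * κ * ‖ξ‖ ^ 2)
    (hΛ0 : 0 ≤ Λ)
    (hXY : ∀ ξ, ⟪X ξ, ξ⟫ ≤ ⟪Y ξ, ξ⟫ - η * ⟪B ξ, ξ⟫ + τ * ‖ξ‖ ^ 2)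
    (hpq : ‖p - q‖ ≤ 2 * η) (hst : D.f s - D.f t ≤ D.Lf * (3 * η))
    (hX : -D.f s * (‖p‖ ^ D.α)⁻¹ ≤ D.G X) (hY : D.G Y ≤ -D.f t * (‖q‖ ^ D.α)⁻¹)
    (hbd : (‖p‖ ^ D.α)⁻¹ ≤ C ∧ |(‖p‖ ^ D.α)⁻¹ - (‖q‖ ^ D.α)⁻¹| ≤ C * |‖p‖ - ‖q‖|)
    (hΛ : 2 * D.a * Λ = 7 * D.Lf * C + 2 * D.A * κ + 1) (hτ : (D.A + D.a) * τ < η) : False := by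
  have hell := D.ell.le_sub X Y (2 * κ * η + τ) (2 * η * Λ - τ) ν (by positivity) hν
    (fun k => by
      have := hXY k
      rw [hB] at this
      have h2 : 0 ≤ η * (2 * (Λ + κ) * ⟪ν, k⟫ ^ 2) := by positivity
      linarith)
    (by
      have := hXY ν
      rw [hB, real_inner_self_eq_norm_sq, hν] at this
      linarith)
  have hP0 : 0 ≤ (‖p‖ ^ D.α)⁻¹ := inv_nonneg.2 (Real.rpow_nonneg (norm_nonneg _) _)
  generalize (‖p‖ ^ D.α)⁻¹ = P at *
  generalize (‖q‖ ^ D.α)⁻¹ = Q at *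
  have hPQ : |P - Q| ≤ C * (2 * η) :=
    hbd.2.trans (mul_le_mul_of_nonneg_left ((abs_norm_sub_norm_le _ _).trans hpq) hC)
  have h1 : (D.f s - D.f t) * P ≤ D.Lf * (3 * η) * C :=
    (mul_le_mul_of_nonneg_right hst hP0).trans
      (mul_le_mul_of_nonneg_left hbd.1 (by have := D.Lf_nonneg; positivity))
  have h2 : D.f t * (P - Q) ≤ 2 * D.Lf * (C * (2 * η)) := by
    refine (le_abs_self _).trans ?_
    rw [abs_mul]
    exact mul_le_mul (D.abs_f_le ht) hPQ (abs_nonneg _) (by have := D.Lf_nonneg; positivity)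
  have h3 : η * (2 * D.a * Λ) = η * (7 * D.Lf * C + 2 * D.A * κ + 1) := by rw [hΛ]
  linarith

set_option maxHeartbeats 1600000 in
/-- Strong comparison principle. -/
theorem strong_comparison {D : GibbonsData E} {J V : E → ℝ} {θ : ℝ} (hθ : 0 ≤ θ)
    (hJl : ∀ x y, |J x - J y| ≤ D.L * ‖x - y‖) (hVl : ∀ x y, |V x - V y| ≤ D.L * ‖x - y‖)
    (hJ1 : ∀ x, |J x| ≤ 1) (hV1 : ∀ x, |V x| ≤ 1) (hle : ∀ x, J x ≤ V x + θ)
    {Ω : Set E} (hΩ : IsOpen Ω) (hΩc : IsPreconnected Ω) (hcomp : ∀ z ∈ Ω, IsComparable D J V z)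
    (hcase : θ = 0 ∨ (∀ x ∈ Ω, 1 - D.δ ≤ V x) ∨ ∀ x ∈ Ω, J x ≤ -1 + D.δ)
    {x₀ : E} (hx₀ : x₀ ∈ Ω) (hcontact : J x₀ = V x₀ + θ) {x : E} (hx : x ∈ Ω) :
    J x = V x + θ := by
  have := FiniteDimensional.proper_real E
  have hJc : Continuous J := by
    refine (LipschitzWith.of_dist_le_mul (K := ⟨D.L, D.L_nonneg⟩) fun x y => ?_).continuous
    rw [Real.dist_eq, dist_eq_norm]; exact hJl x y
  have hVc : Continuous V := by
    refine (LipschitzWith.of_dist_le_mul (K := ⟨D.L, D.L_nonneg⟩) fun x y => ?_).continuous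
    rw [Real.dist_eq, dist_eq_norm]; exact hVl x y
  by_contra hnot
  obtain ⟨y, z, R, hR, hzΩ, hzZ, hyz, hball⟩ := exists_touching_ball (Z := {x | J x = V x + θ})
    hΩ hΩc (isClosed_eq hJc (hVc.add continuous_const)) ⟨x₀, hx₀, hcontact⟩ (fun h => hnot (h hx))
  obtain ⟨ν, hνdef⟩ : ∃ ν : E, ν = R⁻¹ • (y - z) := ⟨_, rfl⟩
  have hν : ‖ν‖ = 1 := by
    rw [hνdef, norm_smul, norm_inv, Real.norm_eq_abs, abs_of_pos hR, hyz, inv_mul_cancel₀ hR.ne']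
  have hRν : R • ν = y - z := by rw [hνdef, smul_inv_smul₀ hR.ne']
  obtain ⟨r₀, hr₀, m₀, hm₀, hpair⟩ := hcomp z hzΩ
  obtain ⟨r₁, hr₁, hr₁Ω⟩ := Metric.isOpen_iff.1 hΩ z hzΩ
  obtain ⟨C, hC, hCb⟩ := exists_inv_rpow_bound D.α hm₀ (M := 2 * D.L + 3)
  obtain ⟨κ, hκ⟩ : ∃ κ, κ = 2 / R := ⟨_, rfl⟩
  have hκ0 : 0 < κ := by rw [hκ]; positivity
  have ha := D.a_pos
  have hA := D.A_nonneg
  have hLf := D.Lf_nonneg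
  have hL := D.L_nonneg
  obtain ⟨Λ, hΛ⟩ : ∃ Λ, Λ = (7 * D.Lf * C + 2 * D.A * κ + 1) / (2 * D.a) := ⟨_, rfl⟩
  have hΛ0 : 0 < Λ := by rw [hΛ]; positivity
  have hΛ' : 2 * D.a * Λ = 7 * D.Lf * C + 2 * D.A * κ + 1 := by rw [hΛ]; field_simp
  obtain ⟨r₂, hr₂⟩ : ∃ r₂, r₂ = min r₀ r₁ := ⟨_, rfl⟩
  have hr₂0 : 0 < r₂ := hr₂ ▸ lt_min hr₀ hr₁
  obtain ⟨r, hr⟩ : ∃ r, r = min 1 (min (r₂ / 4) (1 / (8 * (Λ + κ)))) := ⟨_, rfl⟩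
  have hr0 : 0 < r := by rw [hr]; positivity
  have hr1 : r ≤ 1 := hr ▸ min_le_left _ _
  have hrr₂ : r ≤ r₂ / 4 := hr ▸ (min_le_right _ _).trans (min_le_left _ _)
  have hrΛ : r * (Λ + κ) * 8 ≤ 1 := by
    have : r ≤ 1 / (8 * (Λ + κ)) := hr ▸ (min_le_right _ _).trans (min_le_right _ _)
    rw [le_div_iff₀ (by positivity)] at this
    linarith
  have hrκ : r * κ * 8 ≤ 1 := by nlinarith
  obtain ⟨B, hBdef⟩ : ∃ B : E →L[ℝ] E, B = (2 * (Λ + κ)) • (innerSL ℝ ν).smulRight ν -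
    (2 * κ) • ContinuousLinearMap.id ℝ E := ⟨_, rfl⟩
  have hBapp : ∀ ξ, B ξ = (2 * (Λ + κ) * ⟪ν, ξ⟫) • ν - (2 * κ) • ξ := fun ξ => by
    rw [hBdef, sub_apply, smul_apply, smul_apply, ContinuousLinearMap.id_apply,
      ContinuousLinearMap.smulRight_apply, innerSL_apply_apply, smul_smul]
  have hBsymm : ∀ x y, ⟪B x, y⟫ = ⟪x, B y⟫ := fun x y => by
    rw [hBapp, hBapp, inner_sub_left, inner_sub_right, real_inner_smul_left, real_inner_smul_left,
      inner_smul_right, inner_smul_right, real_inner_comm ν x]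
    ring
  have hBq : ∀ ξ, ⟪B ξ, ξ⟫ = 2 * (Λ + κ) * ⟪ν, ξ⟫ ^ 2 - 2 * κ * ‖ξ‖ ^ 2 := fun ξ => by
    rw [hBapp, inner_sub_left, real_inner_smul_left, real_inner_smul_left,
      real_inner_self_eq_norm_sq]
    ring
  have hνle : ∀ h, ‖h‖ ≤ r → |⟪ν, h⟫| ≤ r := fun h hh => by
    have := abs_real_inner_le_norm ν h
    rw [hν, one_mul] at this
    exact this.trans hh
  have hBn : ∀ h, ‖h‖ ≤ r → ‖B h‖ ≤ 1 / 2 := fun h hh => by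
    rw [hBapp]
    refine (norm_sub_le _ _).trans ?_
    rw [norm_smul, norm_smul, hν, Real.norm_eq_abs, Real.norm_eq_abs, abs_mul,
      abs_of_pos (by positivity : 0 < 2 * (Λ + κ)), abs_of_pos (by positivity : 0 < 2 * κ)]
    have h1 : 2 * (Λ + κ) * |⟪ν, h⟫| ≤ 2 * (Λ + κ) * r :=
      mul_le_mul_of_nonneg_left (hνle h hh) (by positivity)
    have h2 : 2 * κ * ‖h‖ ≤ 2 * κ * r := mul_le_mul_of_nonneg_left hh (by positivity)
    linarith
  have hb : ∀ h, ‖h‖ ≤ r → |⟪ν, h⟫ + 1 / 2 * ⟪B h, h⟫| ≤ 2 * r := fun h hh => by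
    have h1 := abs_real_inner_le_norm (B h) h
    have h2 : ‖B h‖ * ‖h‖ ≤ 1 / 2 * r := mul_le_mul (hBn h hh) hh (norm_nonneg _) (by norm_num)
    have h3 := abs_le.1 (hνle h hh)
    have h4 := abs_le.1 (h1.trans h2)
    rw [abs_le]; constructor <;> linarith [h3.1, h3.2, h4.1, h4.2]
  obtain ⟨γ, hγ, hγb⟩ := ((isCompact_sphere (0 : E) r).inter_right
    (t := {h | 0 ≤ ⟪ν, h⟫ + 1 / 2 * ⟪B h, h⟫})
    (isClosed_le continuous_const (by fun_prop))).exists_forall_le_neg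
    (φ := fun h => J (z + h) - V (z + h) - θ) (by fun_prop) (by
      rintro h ⟨hh1, hh2⟩
      rw [mem_sphere_zero_iff_norm] at hh1
      have h3 := barrier_pos_imp (h := h) (r := r) hν hR hκ hΛ0.le (by linarith) hh1.le
        (by rw [← norm_pos_iff, hh1]; exact hr0) (by
          have : 0 ≤ ⟪ν, h⟫ + 1 / 2 * ⟪B h, h⟫ := hh2
          rw [hBq] at this; linarith)
      rw [hRν, show h - (y - z) = z + h - y by abel] at h3
      have h4 : J (z + h) ≠ V (z + h) + θ := hball _ h3
      have h5 := lt_of_le_of_ne (hle (z + h)) h4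
      linarith)
  obtain ⟨η, hη⟩ : ∃ η, η = min 1 (γ / 3) := ⟨_, rfl⟩
  have hη0 : 0 < η := by rw [hη]; positivity
  have hη1 : η ≤ 1 := hη ▸ min_le_left _ _
  have hηγ : η ≤ γ / 3 := hη ▸ min_le_right _ _
  have hbdry : ∀ h, ‖h‖ = r →
      J (z + h) - V (z + h) - θ + η * (⟪ν, h⟫ + 1 / 2 * ⟪B h, h⟫) < 0 := by
    intro h hh
    by_cases hp : 0 ≤ ⟪ν, h⟫ + 1 / 2 * ⟪B h, h⟫
    · have h1 := hγb h ⟨mem_sphere_zero_iff_norm.2 hh, hp⟩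
      have h2 := (abs_le.1 (hb h hh.le)).2
      have h3 : η * (⟪ν, h⟫ + 1 / 2 * ⟪B h, h⟫) ≤ γ / 3 * 2 :=
        mul_le_mul hηγ (by linarith) hp (by positivity)
      linarith
    · push Not at hp
      have := mul_neg_of_pos_of_neg hη0 hp
      linarith [hle (z + h)]
  obtain ⟨τ, hτ⟩ : ∃ τ, τ = min (r₂ / 4) (η / (4 * (D.A + D.a + 1))) := ⟨_, rfl⟩
  have hτ0 : 0 < τ := by rw [hτ]; positivity
  have hτr : τ ≤ r₂ / 4 := hτ ▸ min_le_left _ _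
  have hτη : τ * (4 * (D.A + D.a + 1)) ≤ η := by
    have : τ ≤ η / (4 * (D.A + D.a + 1)) := hτ ▸ min_le_right _ _
    rwa [le_div_iff₀ (by positivity)] at this
  have hAτ : 0 ≤ (D.A + D.a) * τ := by positivity
  have hτη4 : τ * 4 ≤ η := by linarith
  obtain ⟨h, x, y, p, q, X, Y, hh, hx, hy, hd1, hd2, hpq, hq, hX, hY, hXY⟩ :=
    exists_jets_of_barrier hL hJl hVl hJ1 hV1 hle hBsymm hzZ hr0 hbdry hτ0
  have hBh := hBn h hh
  have hνB1 : ‖ν + B h‖ ≤ 3 / 2 := (norm_add_le _ _).trans (by rw [hν]; linarith)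
  have hνB2 : 1 / 2 ≤ ‖ν + B h‖ := by
    have := norm_sub_le (ν + B h) (B h)
    rw [add_sub_cancel_right, hν] at this
    linarith
  have hsm : ‖η • (ν + B h)‖ = η * ‖ν + B h‖ := by
    rw [norm_smul, Real.norm_eq_abs, abs_of_pos hη0]
  have hpq2 : ‖p - q‖ ≤ 2 * η := by
    have h1 := norm_sub_le (p - q + η • (ν + B h)) (η • (ν + B h))
    rw [add_sub_cancel_right, hsm] at h1
    nlinarith
  have hne : p ≠ q := by
    rintro rfl
    rw [sub_self, zero_add, hsm] at hpq
    nlinarith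
  have hr₂0 : r₂ ≤ r₀ := hr₂ ▸ min_le_left _ _
  have hr₂1 : r₂ ≤ r₁ := hr₂ ▸ min_le_right _ _
  obtain ⟨hm, hX', hY'⟩ := hpair x y (by linarith) (by linarith) p q X Y hne hX hY
  have hxΩ : x ∈ Ω := hr₁Ω (by rw [mem_ball, dist_eq_norm]; linarith)
  have hyΩ : y ∈ Ω := hr₁Ω (by rw [mem_ball, dist_eq_norm]; linarith)
  have hpn : ‖p‖ ≤ 2 * D.L + 3 := by
    have := norm_add_le (p - q) q
    rw [sub_add_cancel] at this
    linarith
  have hbh := abs_le.1 (hb h hh)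
  refine jets_contradiction (s := J x) (t := V y) (hJ1 x) (hV1 y) hη0 hκ0.le hτ0 hC hν hBq hΛ0.le
    hXY hpq2 (D.f_sub_le (θ := θ) (hJ1 x) (hV1 y) hθ ?_ ?_) hX' hY'
    (hCb _ _ (fun hα => (hm hα).1) (fun hα => (hm hα).2) hpn (by linarith)) hΛ' (by linarith)
  · have : η * (⟪ν, h⟫ + 1 / 2 * ⟪B h, h⟫) ≤ η * 2 :=
      mul_le_mul_of_nonneg_left (by linarith) hη0.le
    rw [abs_le]; constructor <;> linarith
  · rcases hcase with h | h | h
    · exact Or.inl h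
    · exact Or.inr (Or.inl (h y hyΩ))
    · exact Or.inr (Or.inr (h x hxΩ))

end Comparison

section Singular

variable {E : Type*} [NormedAddCommGroup E] [InnerProductSpace ℝ E]

theorem abs_quadratic_le (X : E →L[ℝ] E) (k : E) : |⟪X k, k⟫| ≤ ‖X‖ * ‖k‖ ^ 2 := by
  refine (abs_real_inner_le_norm _ _).trans ?_
  have := mul_le_mul_of_nonneg_right (X.le_opNorm k) (norm_nonneg k)
  linarith

theorem abs_quadratic_sub_le (X : E →L[ℝ] E) (k ξ : E) :
    |⟪X (k - ξ), k - ξ⟫ - ⟪X k, k⟫| ≤ ‖X‖ * (2 * ‖k‖ + ‖ξ‖) * ‖ξ‖ := by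
  have h : ⟪X (k - ξ), k - ξ⟫ - ⟪X k, k⟫ = -⟪X k, ξ⟫ - ⟪X ξ, k⟫ + ⟪X ξ, ξ⟫ := by
    rw [map_sub, inner_sub_left, inner_sub_right, inner_sub_right]; ring
  have h1 := (abs_real_inner_le_norm (X k) ξ).trans
    (mul_le_mul_of_nonneg_right (X.le_opNorm k) (norm_nonneg ξ))
  have h2 := (abs_real_inner_le_norm (X ξ) k).trans
    (mul_le_mul_of_nonneg_right (X.le_opNorm ξ) (norm_nonneg k))
  have h3 := abs_quadratic_le X ξ
  rw [h]
  rw [abs_le] at *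
  constructor <;> linarith [h1.1, h1.2, h2.1, h2.2, h3.1, h3.2]

theorem eq_of_sub_le_sq {J : E → ℝ} {x₀ : E} {ρ M : ℝ}
    (h : ∀ x ∈ ball x₀ ρ, ∀ y ∈ ball x₀ ρ, J y - J x ≤ M * ‖y - x‖ ^ 2) {x : E}
    (hx : x ∈ ball x₀ ρ) : J x = J x₀ := by
  have hd : ∀ y ∈ ball x₀ ρ, HasFDerivAt J (0 : E →L[ℝ] ℝ) y := by
    intro y hy
    rw [hasFDerivAt_iff_isLittleO]
    have hO : (fun z => J z - J y - (0 : E →L[ℝ] ℝ) (z - y)) =O[𝓝 y] fun z => ‖z - y‖ ^ 2 := by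
      refine Asymptotics.IsBigO.of_bound M ?_
      filter_upwards [isOpen_ball.mem_nhds hy] with z hz
      rw [zero_apply, sub_zero, Real.norm_eq_abs, Real.norm_eq_abs, abs_of_nonneg (sq_nonneg ‖z - y‖),
        abs_le]
      have h1 := h y hy z hz
      have h2 := h z hz y hy
      rw [norm_sub_rev] at h2
      constructor <;> linarith
    refine hO.trans_isLittleO ?_
    have := Asymptotics.isLittleO_pow_sub_sub (m := 2) y (by norm_num : 1 < 2)
    exact this
  have hx₀ : x₀ ∈ ball x₀ ρ := mem_ball_self (pos_of_mem_ball hx)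
  have := (convex_ball x₀ ρ).norm_image_sub_le_of_norm_hasFDerivWithin_le (C := 0)
    (fun y hy => (hd y hy).hasFDerivWithinAt) (by simp) hx₀ hx
  rw [zero_mul, norm_le_zero_iff] at this
  linarith

variable [FiniteDimensional ℝ E]

theorem exists_shift_injective (X : E →L[ℝ] E) {s : ℝ} (hs : 0 < s) :
    ∃ t, 0 < t ∧ t < s ∧ ∀ d, (1 / 2 : ℝ) • ((X + t • ContinuousLinearMap.id ℝ E) d +
      (X + t • ContinuousLinearMap.id ℝ E).adjoint d) = 0 → d = 0 := by
  obtain ⟨S, hS⟩ : ∃ S : E →L[ℝ] E, S = (1 / 2 : ℝ) • (X + X.adjoint) := ⟨_, rfl⟩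
  have hfin : {t : ℝ | Module.End.HasEigenvalue (S : E →ₗ[ℝ] E) t}.Finite :=
    Module.End.finite_hasEigenvalue _
  have hinf : (Set.Ioo 0 s \ (fun t : ℝ => -t) '' {t : ℝ | Module.End.HasEigenvalue
      (S : E →ₗ[ℝ] E) t}).Nonempty :=
    ((Set.Ioo_infinite hs).sdiff (hfin.image _)).nonempty
  obtain ⟨t, ⟨ht0, hts⟩, ht⟩ := hinf
  refine ⟨t, ht0, hts, fun d hd => ?_⟩
  by_contra hne
  refine ht ⟨-t, ?_, neg_neg t⟩
  refine Module.End.hasEigenvalue_of_hasEigenvector (x := d) ⟨?_, hne⟩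
  rw [Module.End.mem_eigenspace_iff, ContinuousLinearMap.coe_coe, hS]
  rw [map_add] at hd
  simp only [add_apply, smul_apply, ContinuousLinearMap.id_apply] at hd ⊢
  have had : (t • ContinuousLinearMap.id ℝ E).adjoint d = t • d := by
    refine ext_inner_right ℝ fun v => ?_
    rw [ContinuousLinearMap.adjoint_inner_left, smul_apply, ContinuousLinearMap.id_apply,
      inner_smul_right, real_inner_smul_left]
  rw [had] at hd
  have : (1 / 2 : ℝ) • (X d + t • d + (X.adjoint d + t • d)) =
    (1 / 2 : ℝ) • (X d + X.adjoint d) + t • d := by module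
  rw [this] at hd
  rw [neg_smul]
  exact eq_neg_of_add_eq_zero_left hd

/-- A test function with vanishing gradient can only violate the differential inequality where the
function is locally constant. -/
theorem IsElliptic.eventually_eq_of_jetAbove_zero {a A : ℝ} {G : (E →L[ℝ] E) → ℝ}
    (hG : IsElliptic a A G) (hA : 0 ≤ A) {J : E → ℝ} (hJ : Continuous J) {x₀ : E} {X : E →L[ℝ] E}
    (h : JetAbove J x₀ 0 (fun k => ⟪X k, k⟫)) {β : ℝ} (hβ : G X < β)
    (htest : ∀ᶠ x in 𝓝 x₀, ∀ p (Y : E →L[ℝ] E), p ≠ 0 → JetAbove J x p (fun k => ⟪Y k, k⟫) →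
      β ≤ G Y) : ∃ ρ > 0, ∀ x ∈ ball x₀ ρ, J x = J x₀ := by
  have := FiniteDimensional.proper_real E
  obtain ⟨t, ht0, hts, hinj⟩ := exists_shift_injective X (s := (β - G X) / (A + 1))
    (div_pos (by linarith) (by linarith))
  rw [lt_div_iff₀ (by linarith)] at hts
  obtain ⟨r, hr, hrJ⟩ := h.exists_strict (ε := t)
  obtain ⟨X', hX'⟩ : ∃ X', X' = X + t • ContinuousLinearMap.id ℝ E := ⟨_, rfl⟩
  rw [← hX'] at hinj hrJ
  have hGX' : G X' < β := by
    have := hG.le_add X' X t ht0.le (fun k => by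
      rw [hX', add_apply, smul_apply, ContinuousLinearMap.id_apply, inner_add_left,
        real_inner_smul_left, real_inner_self_eq_norm_sq])
    linarith
  obtain ⟨r', hr', hr'J⟩ := Metric.eventually_nhds_iff_ball.1 htest
  obtain ⟨ρ, hρ⟩ : ∃ ρ, ρ = min r (r' / 2) := ⟨_, rfl⟩
  have hρ0 : 0 < ρ := by rw [hρ]; positivity
  have hρr : ρ ≤ r := hρ ▸ min_le_left _ _
  have hρr' : ρ ≤ r' / 2 := hρ ▸ min_le_right _ _
  obtain ⟨σ, hσ⟩ : ∃ σ, σ = min ρ (t * ρ / (4 * ‖X'‖ + 4)) := ⟨_, rfl⟩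
  have hσ0 : 0 < σ := by rw [hσ]; positivity
  have hσρ : σ ≤ ρ := hσ ▸ min_le_left _ _
  have hσt : σ * (4 * ‖X'‖ + 4) ≤ t * ρ := by
    have : σ ≤ _ := hσ ▸ min_le_right _ _
    rwa [le_div_iff₀ (by positivity)] at this
  have key : ∀ ξ, ‖ξ‖ < σ → ∀ k, ‖k‖ ≤ ρ →
      J (x₀ + k) - 1 / 2 * ⟪X' (k - ξ), k - ξ⟫ ≤ J (x₀ + ξ) := by
    intro ξ hξ
    obtain ⟨d, hd, hmax⟩ := (isCompact_closedBall (0 : E) ρ).exists_isMaxOn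
      (f := fun k => J (x₀ + k) - 1 / 2 * ⟪X' (k - ξ), k - ξ⟫) ⟨0, by simp [hρ0.le]⟩ (by fun_prop)
    rw [mem_closedBall_zero_iff] at hd
    have hmax' : ∀ k, ‖k‖ ≤ ρ → J (x₀ + k) - 1 / 2 * ⟪X' (k - ξ), k - ξ⟫ ≤
        J (x₀ + d) - 1 / 2 * ⟪X' (d - ξ), d - ξ⟫ := fun k hk => hmax (by simpa using hk)
    have hdρ : ‖d‖ < ρ := by
      refine lt_of_le_of_ne hd fun hd' => ?_
      have h1 := hmax' 0 (by simp [hρ0.le])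
      rw [add_zero] at h1
      have h2 := hrJ d (by linarith)
      rw [inner_zero_left, zero_add, hd'] at h2
      have h3 := (abs_le.1 (abs_quadratic_sub_le X' d ξ)).1
      have h4 := (abs_le.1 (abs_quadratic_sub_le X' 0 ξ)).2
      rw [hd'] at h3
      rw [norm_zero, mul_zero, zero_add, map_zero, inner_zero_left, sub_zero] at h4
      have h5 : ‖X'‖ * ‖ξ‖ * ‖ξ‖ ≤ ‖X'‖ * ρ * ‖ξ‖ := by gcongr; linarith
      have h6 : ρ * (‖ξ‖ * (4 * ‖X'‖)) < ρ * (t * ρ) := by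
        refine mul_lt_mul_of_pos_left ?_ hρ0
        have : ‖ξ‖ * (4 * ‖X'‖) ≤ σ * (4 * ‖X'‖) := by gcongr
        linarith
      linarith
    by_cases hne : d = ξ
    · intro k hk
      have := hmax' k hk
      rwa [hne, sub_self, map_zero, inner_zero_left, mul_zero, sub_zero] at this
    · exfalso
      refine absurd (hr'J (x₀ + d) (by rw [mem_ball, dist_eq_norm, add_sub_cancel_left]; linarith)
        ((1 / 2 : ℝ) • (X' (d - ξ) + X'.adjoint (d - ξ))) X'
        (fun h0 => hne (sub_eq_zero.1 (hinj _ h0))) ?_) (not_le.2 hGX')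
      filter_upwards [ball_mem_nhds (0 : E) (sub_pos.2 hdρ)] with k hk
      rw [mem_ball_zero_iff] at hk
      have h1 := hmax' (d + k) ((norm_add_le _ _).trans (by linarith))
      have h2 := quadratic_shift X' 0 (d - ξ) k
      rw [show d + k - ξ = d - ξ + k by abel, ← add_assoc] at h1
      simp only [inner_zero_left, zero_add] at h2
      linarith
  refine ⟨σ, hσ0, fun x hx => eq_of_sub_le_sq (ρ := σ) (M := ‖X'‖) ?_ hx⟩
  intro x hx y hy
  have h1 := key (x - x₀) (by simpa [dist_eq_norm] using hx) (y - x₀)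
    (by rw [mem_ball, dist_eq_norm] at hy; linarith)
  rw [add_sub_cancel, add_sub_cancel, sub_sub_sub_cancel_right] at h1
  have h2 := (abs_le.1 (abs_quadratic_le X' (y - x))).2
  have h3 : 0 ≤ ‖X'‖ * ‖y - x‖ ^ 2 := by positivity
  linarith

end Singular

section Shifts

variable {E : Type*} [NormedAddCommGroup E] [InnerProductSpace ℝ E]

theorem forall_quadratic_nonneg {p : E} {X : E →L[ℝ] E}
    (h : ∀ᶠ k in 𝓝 (0 : E), 0 ≤ ⟪p, k⟫ + 1 / 2 * ⟪X k, k⟫) : p = 0 ∧ ∀ k, 0 ≤ ⟪X k, k⟫ := by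
  have h1 : ∀ k, ∀ᶠ t : ℝ in 𝓝[>] 0, 0 ≤ ⟪p, k⟫ + t * (1 / 2 * ⟪X k, k⟫) := fun k => by
    have ht : Tendsto (fun t : ℝ => t • k) (𝓝[>] 0) (𝓝 0) := by
      have : Tendsto (fun t : ℝ => t • k) (𝓝 0) (𝓝 ((0 : ℝ) • k)) :=
        (continuous_id.smul continuous_const).tendsto 0
      rw [zero_smul] at this
      exact this.mono_left nhdsWithin_le_nhds
    filter_upwards [ht.eventually h, self_mem_nhdsWithin] with t ht ht0
    have ht0 : 0 < t := ht0
    rw [map_smul, inner_smul_right, inner_smul_right, real_inner_smul_left] at ht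
    refine nonneg_of_mul_nonneg_right (a := t) ?_ ht0
    linarith
  have h2 : ∀ k, 0 ≤ ⟪p, k⟫ := fun k => by
    have hc : Tendsto (fun t : ℝ => ⟪p, k⟫ + t * (1 / 2 * ⟪X k, k⟫)) (𝓝[>] 0)
        (𝓝 (⟪p, k⟫ + 0 * (1 / 2 * ⟪X k, k⟫))) :=
      Tendsto.mono_left (Continuous.tendsto (by fun_prop) 0) nhdsWithin_le_nhds
    rw [zero_mul, add_zero] at hc
    exact ge_of_tendsto hc (h1 k)
  have hp : p = 0 := by
    have := h2 (-p)
    rw [inner_neg_right, real_inner_self_eq_norm_sq] at this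
    rw [← norm_eq_zero]
    nlinarith [norm_nonneg p]
  refine ⟨hp, fun k => ?_⟩
  obtain ⟨t, ht, ht0⟩ := ((h1 k).and self_mem_nhdsWithin).exists
  have ht0 : 0 < t := ht0
  rw [hp, inner_zero_left, zero_add] at ht
  nlinarith

theorem JetAbove.of_isLocalMin {J : E → ℝ} {x p : E} {X : E →L[ℝ] E}
    (h : JetAbove J x p (fun k => ⟪X k, k⟫)) (hx : ∀ᶠ y in 𝓝 x, J x ≤ J y) :
    p = 0 ∧ ∀ k, 0 ≤ ⟪X k, k⟫ := by
  refine forall_quadratic_nonneg ?_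
  have ht : Tendsto (fun k => x + k) (𝓝 (0 : E)) (𝓝 x) := by
    have : Tendsto (fun k => x + k) (𝓝 (0 : E)) (𝓝 (x + 0)) := Continuous.tendsto (by fun_prop) 0
    rwa [add_zero] at this
  filter_upwards [h, ht.eventually hx] with k h1 h2
  linarith

theorem IsElliptic.nonneg {a A : ℝ} {G : (E →L[ℝ] E) → ℝ} (hG : IsElliptic a A G)
    {X : E →L[ℝ] E} (hX : ∀ k, 0 ≤ ⟪X k, k⟫) : 0 ≤ G X := by
  have := hG.le_add 0 X 0 le_rfl (fun k => by simpa using hX k)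
  rw [hG.zero] at this
  linarith

theorem JetAbove.congr {J w : E → ℝ} {x p : E} {b : E → ℝ} (h : JetAbove J x p b)
    (hx : J =ᶠ[𝓝 x] w) : JetAbove w x p b := by
  have ht : Tendsto (fun k => x + k) (𝓝 (0 : E)) (𝓝 x) := by
    have : Tendsto (fun k => x + k) (𝓝 (0 : E)) (𝓝 (x + 0)) := Continuous.tendsto (by fun_prop) 0
    rwa [add_zero] at this
  filter_upwards [h, ht.eventually hx] with k h1 h2
  rwa [← hx.self_of_nhds, ← h2]

/-- The closed convex cone of opening `D.m` around the direction `D.e`. -/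
def GibbonsData.cone (D : GibbonsData E) : Set E := {k | D.m * ‖k‖ ≤ ⟪D.e, k⟫}

theorem GibbonsData.zero_mem_cone (D : GibbonsData E) : (0 : E) ∈ D.cone := by
  simp [GibbonsData.cone]

theorem GibbonsData.add_mem_cone {D : GibbonsData E} {k l : E} (hk : k ∈ D.cone)
    (hl : l ∈ D.cone) : k + l ∈ D.cone := by
  have hk' : D.m * ‖k‖ ≤ ⟪D.e, k⟫ := hk
  have hl' : D.m * ‖l‖ ≤ ⟪D.e, l⟫ := hl
  change D.m * ‖k + l‖ ≤ ⟪D.e, k + l⟫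
  have := mul_le_mul_of_nonneg_left (norm_add_le k l) D.m_pos.le
  rw [inner_add_right]; linarith

theorem GibbonsData.smul_mem_cone {D : GibbonsData E} {k : E} (hk : k ∈ D.cone) {t : ℝ}
    (ht : 0 ≤ t) : t • k ∈ D.cone := by
  have hk' : D.m * ‖k‖ ≤ ⟪D.e, k⟫ := hk
  change D.m * ‖t • k‖ ≤ ⟪D.e, t • k⟫
  rw [norm_smul, Real.norm_eq_abs, abs_of_nonneg ht, inner_smul_right]
  nlinarith

theorem GibbonsData.inner_nonneg {D : GibbonsData E} {k : E} (hk : k ∈ D.cone) : 0 ≤ ⟪D.e, k⟫ :=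
  (mul_nonneg D.m_pos.le (norm_nonneg k)).trans hk

theorem GibbonsData.inner_self (D : GibbonsData E) : ⟪D.e, D.e⟫ = 1 := by
  rw [real_inner_self_eq_norm_sq, D.norm_e, one_pow]

theorem GibbonsData.e_mem_cone (D : GibbonsData E) : D.e ∈ D.cone := by
  change D.m * ‖D.e‖ ≤ ⟪D.e, D.e⟫
  rw [D.inner_self, D.norm_e, mul_one]; exact D.m_le_one

theorem GibbonsData.norm_le_of_mem_cone {D : GibbonsData E} {k : E} (hk : k ∈ D.cone) {C : ℝ}
    (h : ⟪D.e, k⟫ ≤ C) : ‖k‖ ≤ C / D.m := by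
  have hk' : D.m * ‖k‖ ≤ ⟪D.e, k⟫ := hk
  rw [le_div_iff₀ D.m_pos]; linarith

theorem GibbonsData.isClosed_cone (D : GibbonsData E) : IsClosed D.cone :=
  isClosed_le (by fun_prop) (by fun_prop)

theorem GibbonsData.convex_cone (D : GibbonsData E) : Convex ℝ D.cone := fun _ hx _ hy _ _ ha hb _ =>
  GibbonsData.add_mem_cone (GibbonsData.smul_mem_cone hx ha) (GibbonsData.smul_mem_cone hy hb)

/-- The largest value of `w` on the backward cone. -/
def supShift (D : GibbonsData E) (w : E → ℝ) (x : E) : ℝ := sSup ((fun k => w (x - k)) '' D.cone)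

/-- The smallest value of `w` on the forward cone. -/
def infShift (D : GibbonsData E) (w : E → ℝ) : E → ℝ := pointRefl (supShift D.reflect (pointRefl w))

section Basic

variable {D : GibbonsData E} {w : E → ℝ}

theorem Adm.le_supShift (h : Adm D w) (x : E) {k : E} (hk : k ∈ D.cone) :
    w (x - k) ≤ supShift D w x := by
  refine le_csSup ⟨1, ?_⟩ ⟨k, hk, rfl⟩
  rintro _ ⟨l, -, rfl⟩
  exact (_root_.abs_le.1 (h.abs_le _)).2

theorem Adm.infShift_le (h : Adm D w) (x : E) {k : E} (hk : k ∈ D.cone) :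
    infShift D w x ≤ w (x + k) := by
  have := h.reflect.le_supShift (-x) hk
  simp only [pointRefl, infShift] at this ⊢
  rw [neg_sub, sub_neg_eq_add, add_comm k] at this
  linarith

theorem Adm.le_supShift_self (h : Adm D w) (x : E) : w x ≤ supShift D w x := by
  simpa using h.le_supShift x D.zero_mem_cone

variable [FiniteDimensional ℝ E]

theorem Adm.exists_eq_supShift (h : Adm D w) (x : E) : ∃ k ∈ D.cone, supShift D w x = w (x - k) := by
  have := FiniteDimensional.proper_real E
  suffices hs : ∃ k ∈ D.cone, ∀ l ∈ D.cone, w (x - l) ≤ w (x - k) by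
    obtain ⟨k, hk, hmax⟩ := hs
    refine ⟨k, hk, le_antisymm (csSup_le ⟨_, k, hk, rfl⟩ ?_) (h.le_supShift x hk)⟩
    rintro _ ⟨l, hl, rfl⟩
    exact hmax l hl
  by_cases hex : ∃ k₀ ∈ D.cone, -1 < w (x - k₀)
  · obtain ⟨k₀, hk₀, hw₀⟩ := hex
    obtain ⟨ε, hε⟩ : ∃ ε, ε = (w (x - k₀) + 1) / 2 := ⟨_, rfl⟩
    have hfar : ∀ l, ⟪D.e, x⟫ + D.R ε < ⟪D.e, l⟫ → w (x - l) < w (x - k₀) := fun l hl => by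
      have := h.lim_neg ε (by linarith) (x - l) (by rw [inner_sub_right]; linarith)
      linarith
    have hcpt : IsCompact (D.cone ∩ {k | ⟪D.e, k⟫ ≤ ⟪D.e, x⟫ + D.R ε}) := by
      refine (isCompact_closedBall (0 : E) ((⟪D.e, x⟫ + D.R ε) / D.m)).of_isClosed_subset
        (D.isClosed_cone.inter (isClosed_le (by fun_prop) continuous_const)) ?_
      rintro k ⟨hk1, hk2⟩
      rw [mem_closedBall_zero_iff]
      exact GibbonsData.norm_le_of_mem_cone hk1 hk2
    have hc := h.continuous
    obtain ⟨k, ⟨hk, -⟩, hmax⟩ := hcpt.exists_isMaxOn (f := fun k => w (x - k))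
      ⟨k₀, hk₀, not_lt.1 fun hlt => lt_irrefl _ (hfar k₀ hlt)⟩ (by fun_prop)
    have hk₀max : w (x - k₀) ≤ w (x - k) :=
      hmax ⟨hk₀, not_lt.1 fun hlt => lt_irrefl _ (hfar k₀ hlt)⟩
    refine ⟨k, hk, fun l hl => ?_⟩
    by_cases hl' : ⟪D.e, l⟫ ≤ ⟪D.e, x⟫ + D.R ε
    · exact hmax ⟨hl, hl'⟩
    · exact (hfar l (not_le.1 hl')).le.trans hk₀max
  · push Not at hex
    exact ⟨0, D.zero_mem_cone, fun l hl => (hex l hl).trans (_root_.abs_le.1 (h.abs_le _)).1⟩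

theorem Adm.exists_eq_infShift (h : Adm D w) (x : E) : ∃ k ∈ D.cone, infShift D w x = w (x + k) := by
  obtain ⟨k, hk, he⟩ := h.reflect.exists_eq_supShift (-x)
  refine ⟨k, hk, ?_⟩
  simp only [pointRefl, infShift] at he ⊢
  rw [he, neg_neg, neg_sub, sub_neg_eq_add, add_comm k]

theorem Adm.supShift_lip (h : Adm D w) (x y : E) :
    |supShift D w x - supShift D w y| ≤ D.L * ‖x - y‖ := by
  have key : ∀ x y, supShift D w x - supShift D w y ≤ D.L * ‖x - y‖ := fun x y => by
    obtain ⟨k, hk, he⟩ := h.exists_eq_supShift x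
    have h1 := h.le_supShift y hk
    have h2 := (_root_.abs_le.1 (h.lip (x - k) (y - k))).2
    rw [sub_sub_sub_cancel_right] at h2
    linarith
  rw [_root_.abs_le]
  have := key y x
  rw [norm_sub_rev] at this
  exact ⟨by linarith, key x y⟩

theorem Adm.abs_supShift_le (h : Adm D w) (x : E) : |supShift D w x| ≤ 1 := by
  obtain ⟨k, -, he⟩ := h.exists_eq_supShift x
  rw [he]; exact h.abs_le _

theorem Adm.infShift_lip (h : Adm D w) (x y : E) :
    |infShift D w x - infShift D w y| ≤ D.L * ‖x - y‖ := by
  have := h.reflect.supShift_lip (-y) (-x)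
  simp only [infShift, pointRefl]
  rw [neg_sub_neg] at this ⊢
  exact this

theorem Adm.abs_infShift_le (h : Adm D w) (x : E) : |infShift D w x| ≤ 1 := by
  have := h.reflect.abs_supShift_le (-x)
  rwa [infShift, pointRefl, abs_neg]

end Basic

/-- The differential inequality from above, including test functions with vanishing gradient when
`α = 0` and excluding them otherwise. -/
def IsGenSub (D : GibbonsData E) (J : E → ℝ) : Prop :=
  ∀ z, ∃ r > 0, ∃ m₀ > 0, ∀ x, ‖x - z‖ < r → ∀ p (X : E →L[ℝ] E),
    JetAbove J x p (fun k => ⟪X k, k⟫) →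
    (D.α ≠ 0 → m₀ ≤ ‖p‖) ∧ -D.f (J x) * (‖p‖ ^ D.α)⁻¹ ≤ D.G X

theorem IsGenSub.isComparable {D : GibbonsData E} {J V : E → ℝ} (hJ : IsGenSub D J)
    (hV : IsGenSub D.reflect (pointRefl V)) (z : E) : IsComparable D J V z := by
  obtain ⟨r₁, hr₁, m₁, hm₁, h1⟩ := hJ z
  obtain ⟨r₂, hr₂, m₂, hm₂, h2⟩ := hV (-z)
  refine ⟨min r₁ r₂, lt_min hr₁ hr₂, min m₁ m₂, lt_min hm₁ hm₂, ?_⟩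
  intro x y hx hy p q X Y _ hX hY
  obtain ⟨ha, hb⟩ := h1 x (hx.trans_le (min_le_left _ _)) p X hX
  obtain ⟨hc, hd⟩ := h2 (-y) (by
    rw [neg_sub_neg, norm_sub_rev]; exact hy.trans_le (min_le_right _ _)) q (-Y)
    (jetAbove_pointRefl_map_iff.2 (by rwa [neg_neg, neg_neg]))
  refine ⟨fun hα => ⟨(min_le_left _ _).trans (ha hα), (min_le_right _ _).trans (hc hα)⟩, hb, ?_⟩
  have hd' : -(-D.f (-(-V (- -y)))) * (‖q‖ ^ D.α)⁻¹ ≤ -D.G (- -Y) := hd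
  rw [neg_neg, neg_neg, neg_neg, neg_neg] at hd'
  linarith

theorem IsGenSub.translate {D : GibbonsData E} {J : E → ℝ} (hJ : IsGenSub D J) (y : E) :
    IsGenSub D (fun x => J (x + y)) := by
  intro z
  obtain ⟨r, hr, m₀, hm₀, h⟩ := hJ (z + y)
  exact ⟨r, hr, m₀, hm₀, fun x hx p X hX =>
    h (x + y) (by rwa [add_sub_add_right_eq_sub]) p X hX.translate⟩

theorem isGenSub_neg_one {D : GibbonsData E} (hα : D.α = 0) : IsGenSub D (fun _ => -1) := by
  intro z
  refine ⟨1, one_pos, 1, one_pos, fun x _ p X hX => ⟨fun h => absurd hα h, ?_⟩⟩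
  rw [D.f_neg_one, neg_zero, zero_mul]
  exact D.ell.nonneg (hX.of_isLocalMin (Eventually.of_forall fun _ => le_rfl)).2

section Genuine

variable {D : GibbonsData E} {w : E → ℝ}

theorem Adm.lt_one_of_ne_zero (h : Adm D w) (hα : D.α ≠ 0) (x : E) : w x < 1 := by
  refine lt_of_le_of_ne (_root_.abs_le.1 (h.abs_le x)).2 fun hx => ?_
  obtain ⟨n, hn⟩ := exists_nat_gt |⟪D.e, x⟫|
  have hj : JetAbove w x 0 (fun k => ⟪(0 : E →L[ℝ] E) k, k⟫) := Eventually.of_forall fun k => by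
    simpa [hx] using (_root_.abs_le.1 (h.abs_le (x + k))).2
  have := h.sub.grad hα n x 0 0 hn hj
  rw [norm_zero] at this
  exact absurd (D.μ_pos n) (not_lt.2 this)

theorem Adm.neg_one_lt_of_ne_zero (h : Adm D w) (hα : D.α ≠ 0) (x : E) : -1 < w x := by
  have := h.reflect.lt_one_of_ne_zero hα (-x)
  simp only [pointRefl, neg_neg] at this
  linarith

theorem Adm.jetAbove_of_supShift (h : Adm D w) {x k p : E} {b : E → ℝ} (hk : k ∈ D.cone)
    (he : supShift D w x = w (x - k)) (hj : JetAbove (supShift D w) x p b) :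
    JetAbove w (x - k) p b := by
  filter_upwards [hj] with l hl
  have := h.le_supShift (x + l) hk
  rw [← he, show x - k + l = x + l - k by abel]
  linarith

variable [FiniteDimensional ℝ E]

theorem Adm.not_eventually_eq_supShift (h : Adm D w) (hα : D.α = 0) {x₀ : E} {ρ : ℝ} (hρ : 0 < ρ)
    (hconst : ∀ x ∈ ball x₀ ρ, supShift D w x = supShift D w x₀)
    (hf : D.f (supShift D w x₀) < 0) : False := by
  obtain ⟨k₀, hk₀, he⟩ := h.exists_eq_supShift x₀
  obtain ⟨c, hc⟩ : ∃ c, c = supShift D w x₀ := ⟨_, rfl⟩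
  rw [← hc] at hconst hf he
  have hc1 : |c| ≤ 1 := hc ▸ h.abs_supShift_le x₀
  obtain ⟨Ω, hΩdef⟩ : ∃ Ω, Ω = ball x₀ ρ - D.cone := ⟨_, rfl⟩
  have hΩ : IsOpen Ω := hΩdef ▸ isOpen_ball.sub_right
  have hΩc : IsPreconnected Ω := hΩdef ▸ ((convex_ball x₀ ρ).sub D.convex_cone).isPreconnected
  have hmem : ∀ k ∈ D.cone, x₀ - k ∈ Ω := fun k hk =>
    hΩdef ▸ Set.sub_mem_sub (mem_ball_self hρ) hk
  have hle : ∀ x ∈ Ω, w x ≤ c := by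
    intro x hx
    rw [hΩdef] at hx
    obtain ⟨y, hy, k, hk, rfl⟩ := Set.mem_sub.1 hx
    exact (h.le_supShift y hk).trans (hconst y hy).le
  have hwc : ∀ x ∈ Ω, min (w x) c = w x := fun x hx => min_eq_left (hle x hx)
  have hSC : ∀ x ∈ Ω, w x = c := by
    intro x hx
    have := strong_comparison (D := D) (J := fun x => min (w x) c) (V := fun _ => c) (θ := 0) le_rfl
      (fun x y => (abs_min_sub_min_le_max _ _ _ _).trans (max_le (h.lip x y) (by
        simpa using mul_nonneg D.L_nonneg (norm_nonneg _))))
      (fun x y => by simpa using mul_nonneg D.L_nonneg (norm_nonneg _))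
      (fun x => by
        have h1 := _root_.abs_le.1 (h.abs_le x)
        have h2 := _root_.abs_le.1 hc1
        exact _root_.abs_le.2 ⟨le_min h1.1 h2.1, (min_le_left _ _).trans h1.2⟩)
      (fun _ => hc1) (fun x => by rw [add_zero]; exact min_le_right _ _) hΩ hΩc ?_ (Or.inl rfl)
      (x₀ := x₀ - k₀) (hmem k₀ hk₀) (by rw [hwc _ (hmem k₀ hk₀), ← he, add_zero]) hx
    · rwa [hwc x hx, add_zero] at this
    · intro z hz
      obtain ⟨r, hr, hrΩ⟩ := Metric.isOpen_iff.1 hΩ z hz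
      refine ⟨r, hr, 1, one_pos, fun x y hx _ p q X Y hpq hX hY => ?_⟩
      have hxΩ : x ∈ Ω := hrΩ (by rwa [mem_ball, dist_eq_norm])
      have hY' : JetAbove (pointRefl fun _ : E => c) (-y) q (fun k => ⟪(-Y) k, k⟫) :=
        jetAbove_pointRefl_map_iff.2 (by rwa [neg_neg, neg_neg])
      obtain ⟨hq, hYn⟩ := hY'.of_isLocalMin (Eventually.of_forall fun _ => le_rfl)
      have hGY := D.reflect.ell.nonneg hYn
      have hGY' : 0 ≤ -D.G (- -Y) := hGY
      rw [neg_neg] at hGY'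
      refine ⟨fun h => absurd hα h, ?_, ?_⟩
      · have := h.sub.visc x p X (hq ▸ hpq) (hX.congr (by
          filter_upwards [hΩ.mem_nhds hxΩ] with y hy using hwc y hy))
        change -D.f (min (w x) c) * _ ≤ _
        rw [hwc x hxΩ, hα, Real.rpow_zero, inv_one, mul_one]
        rwa [hα, Real.rpow_zero, one_mul] at this
      · rw [hα, Real.rpow_zero, inv_one, mul_one]
        linarith
  have hc2 : c = -1 := by
    refine le_antisymm (le_of_forall_pos_le_add fun ε hε => ?_) (_root_.abs_le.1 hc1).1
    obtain ⟨t, ht⟩ : ∃ t, t = |⟪D.e, x₀⟫ + D.R ε| := ⟨_, rfl⟩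
    have htm : t • D.e ∈ D.cone := GibbonsData.smul_mem_cone D.e_mem_cone (ht ▸ abs_nonneg _)
    rw [← hSC _ (hmem _ htm)]
    refine h.lim_neg ε hε _ ?_
    rw [inner_sub_right, inner_smul_right, D.inner_self]
    have := le_abs_self (⟪D.e, x₀⟫ + D.R ε)
    linarith
  rw [hc2, D.f_neg_one] at hf
  exact lt_irrefl _ hf

theorem Adm.isGenSub_supShift (h : Adm D w) : IsGenSub D (supShift D w) := by
  intro z
  by_cases hα : D.α = 0
  · refine ⟨1, one_pos, 1, one_pos, fun x _ p X hX => ⟨fun h => absurd hα h, ?_⟩⟩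
    rw [hα, Real.rpow_zero, inv_one, mul_one]
    have hne : ∀ x p (X : E →L[ℝ] E), p ≠ 0 → JetAbove (supShift D w) x p (fun k => ⟪X k, k⟫) →
        -D.f (supShift D w x) ≤ D.G X := by
      intro x p X hp hX
      obtain ⟨k, hk, he⟩ := h.exists_eq_supShift x
      have := h.sub.visc _ p X hp (h.jetAbove_of_supShift hk he hX)
      rwa [hα, Real.rpow_zero, one_mul, ← he] at this
    by_cases hp : p = 0
    · subst hp
      by_contra! hlt
      obtain ⟨β, hβ1, hβ2⟩ := exists_between hlt
      have hJc : Continuous (supShift D w) := by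
        refine (LipschitzWith.of_dist_le_mul (K := ⟨D.L, D.L_nonneg⟩) fun x y => ?_).continuous
        rw [Real.dist_eq, dist_eq_norm]; exact h.supShift_lip x y
      have hfc : Tendsto (fun y => -D.f (supShift D w y)) (𝓝 x) (𝓝 (-D.f (supShift D w x))) := by
        refine Tendsto.neg ?_
        rw [← tendsto_sub_nhds_zero_iff]
        refine squeeze_zero_norm (a := fun y => D.Lf * |supShift D w y - supShift D w x|)
          (fun y => D.f_lip _ _ (h.abs_supShift_le y) (h.abs_supShift_le x)) ?_
        have : Tendsto (fun y => D.Lf * |supShift D w y - supShift D w x|) (𝓝 x)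
            (𝓝 (D.Lf * |supShift D w x - supShift D w x|)) :=
          Continuous.tendsto (by fun_prop) x
        simpa using this
      obtain ⟨ρ, hρ, hconst⟩ := D.ell.eventually_eq_of_jetAbove_zero D.A_nonneg hJc hX hβ1 (by
        filter_upwards [hfc.eventually (lt_mem_nhds hβ2)] with y hy p Y hp hY
        exact hy.le.trans (hne y p Y hp hY))
      have hXn := (hX.of_isLocalMin (by
        filter_upwards [ball_mem_nhds x hρ] with y hy using (hconst y hy).ge)).2
      have := D.ell.nonneg hXn
      exact h.not_eventually_eq_supShift hα hρ hconst (by linarith)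
    · exact hne x p X hp hX
  · obtain ⟨ε, hε⟩ : ∃ ε, ε = (w z + 1) / 4 := ⟨_, rfl⟩
    have hε0 : 0 < ε := by have := h.neg_one_lt_of_ne_zero hα z; linarith
    obtain ⟨n, hn⟩ := exists_nat_gt (|⟪D.e, z⟫| + 1 + |D.R ε|)
    obtain ⟨r, hr⟩ : ∃ r, r = min 1 (ε / (D.L + 1)) := ⟨_, rfl⟩
    have hL := D.L_nonneg
    have hr0 : 0 < r := by rw [hr]; positivity
    have hr1 : r ≤ 1 := hr ▸ min_le_left _ _
    have hrL : r * (D.L + 1) ≤ ε := by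
      rw [← le_div_iff₀ (by positivity)]; exact hr ▸ min_le_right _ _
    refine ⟨r, hr0, D.μ n, D.μ_pos n, fun x hx p X hX => ?_⟩
    obtain ⟨k, hk, he⟩ := h.exists_eq_supShift x
    have hX' := h.jetAbove_of_supShift hk he hX
    have hxz := abs_real_inner_le_norm D.e (x - z)
    rw [D.norm_e, one_mul, inner_sub_right] at hxz
    have hxz' := _root_.abs_le.1 hxz
    have hstrip : |⟪D.e, x - k⟫| < n := by
      have h1 : -D.R ε < ⟪D.e, x - k⟫ := by
        by_contra! hle
        have h2 := h.lim_neg ε hε0 _ hle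
        have h3 := h.le_supShift_self x
        have h4 := (_root_.abs_le.1 (h.lip x z)).1
        have h5 : D.L * ‖x - z‖ ≤ D.L * r := mul_le_mul_of_nonneg_left hx.le hL
        linarith
      have h2 := GibbonsData.inner_nonneg hk
      rw [inner_sub_right] at h1 ⊢
      have h3 := le_abs_self (D.R ε)
      have h4 := _root_.abs_le.1 (le_refl |⟪D.e, z⟫|)
      rw [abs_lt]
      constructor <;> linarith [h4.1, h4.2, hxz'.1, hxz'.2, abs_nonneg (D.R ε),
        abs_nonneg ⟪D.e, z⟫]
    have hg := h.sub.grad hα n _ p X hstrip hX'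
    refine ⟨fun _ => hg, ?_⟩
    have hp : 0 < ‖p‖ := (D.μ_pos n).trans_le hg
    have hv := h.sub.visc _ p X (norm_pos_iff.1 hp) hX'
    rw [← div_eq_mul_inv, div_le_iff₀ (Real.rpow_pos_of_pos hp _), he, mul_comm]
    exact hv

theorem Adm.isGenSub_reflect_infShift (h : Adm D w) :
    IsGenSub D.reflect (pointRefl (infShift D w)) := by
  rw [infShift, pointRefl_pointRefl]
  exact h.reflect.isGenSub_supShift

end Genuine

end Shifts

section Sliding

variable {E : Type*} [NormedAddCommGroup E] [InnerProductSpace ℝ E] [FiniteDimensional ℝ E]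
  {D : GibbonsData E} {w : E → ℝ}

theorem Adm.isGenSub_reflect_infShift_translate (h : Adm D w) (v : E) :
    IsGenSub D.reflect (pointRefl fun y => infShift D w (y + v)) := by
  have := h.isGenSub_reflect_infShift.translate (-v)
  convert this using 2 with y
  simp [pointRefl, add_comm]

theorem Adm.supShift_le (h : Adm D w) {ε : ℝ} (hε : 0 < ε) {x : E} (hx : ⟪D.e, x⟫ ≤ -D.R ε) :
    supShift D w x ≤ -1 + ε := by
  obtain ⟨k, hk, he⟩ := h.exists_eq_supShift x
  rw [he]
  refine h.lim_neg ε hε _ ?_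
  have := GibbonsData.inner_nonneg hk
  rw [inner_sub_right]; linarith

theorem Adm.le_infShift (h : Adm D w) {ε : ℝ} (hε : 0 < ε) {x : E} (hx : D.R ε ≤ ⟪D.e, x⟫) :
    1 - ε ≤ infShift D w x := by
  obtain ⟨k, hk, he⟩ := h.exists_eq_infShift x
  rw [he]
  refine h.lim_pos ε hε _ ?_
  have := GibbonsData.inner_nonneg hk
  rw [inner_add_right]; linarith

theorem GibbonsData.inner_smul_e (D : GibbonsData E) (t : ℝ) : ⟪D.e, t • D.e⟫ = t := by
  rw [inner_smul_right, D.inner_self, mul_one]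

theorem Adm.lt_one (h : Adm D w) (x : E) : w x < 1 := by
  by_cases hα : D.α = 0
  · refine lt_of_le_of_ne (_root_.abs_le.1 (h.abs_le x)).2 fun hx => ?_
    have hV : IsGenSub D.reflect (pointRefl fun _ : E => (1 : ℝ)) := isGenSub_neg_one hα
    have hxJ : supShift D w x = 1 := le_antisymm (_root_.abs_le.1 (h.abs_supShift_le x)).2
      (hx ▸ h.le_supShift_self x)
    have := strong_comparison (D := D) (J := supShift D w) (V := fun _ => 1) (θ := 0) le_rfl
      h.supShift_lip (fun x y => by simpa using mul_nonneg D.L_nonneg (norm_nonneg _))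
      h.abs_supShift_le (by simp)
      (fun x => by rw [add_zero]; exact (_root_.abs_le.1 (h.abs_supShift_le x)).2) isOpen_univ
      isPreconnected_univ (fun z _ => h.isGenSub_supShift.isComparable hV z) (Or.inl rfl)
      (x₀ := x) (Set.mem_univ _) (by rw [hxJ, add_zero])
      (x := (-D.R 1) • D.e) (Set.mem_univ _)
    have h2 := h.supShift_le one_pos (x := (-D.R 1) • D.e) (by rw [D.inner_smul_e])
    linarith
  · exact h.lt_one_of_ne_zero hα x

theorem exists_limit_triple (𝒰 : Ultrafilter ℕ) {w : ℕ → E → ℝ} {x h : ℕ → E} {C C' : ℝ}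
    (hs : ∀ n, Adm D (w n)) (hx : ∀ n, |⟪D.e, x n⟫| ≤ C) (hh : ∀ n, ‖h n‖ ≤ C') :
    ∃ w₀ x₀ h₀, Adm D w₀ ∧ |⟪D.e, x₀⟫| ≤ C ∧ Tendsto h 𝒰 (𝓝 h₀) ∧
      Tendsto (fun n => w n (x n)) 𝒰 (𝓝 (w₀ x₀)) ∧
      Tendsto (fun n => w n (x n + h n)) 𝒰 (𝓝 (w₀ (x₀ + h₀))) := by
  obtain ⟨y, hy⟩ : ∃ y : ℕ → E, ∀ n, y n = ⟪D.e, x n⟫ • D.e := ⟨_, fun _ => rfl⟩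
  have hxy : ∀ n, ⟪D.e, x n - y n⟫ = 0 := fun n => by
    rw [inner_sub_right, hy, D.inner_smul_e, sub_self]
  obtain ⟨w₀, hw₀, hlim⟩ := exists_adm_limit 𝒰 (fun n => (hs n).translate (hxy n))
  have hyn : ∀ n, ‖y n‖ ≤ C := fun n => by
    rw [hy, norm_smul, D.norm_e, mul_one]; exact hx n
  obtain ⟨x₀, hx₀⟩ := exists_tendsto_of_norm_le 𝒰 hyn
  obtain ⟨h₀, hh₀⟩ := exists_tendsto_of_norm_le 𝒰 hh
  refine ⟨w₀, x₀, h₀, hw₀, ?_, hh₀, ?_, ?_⟩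
  · refine (abs_real_inner_le_norm _ _).trans ?_
    rw [D.norm_e, one_mul]
    exact le_of_tendsto hx₀.norm (Filter.Eventually.of_forall (f := (𝒰 : Filter ℕ)) hyn)
  · refine (hlim y x₀ hx₀).congr fun n => ?_
    rw [add_sub_cancel]
  · refine (hlim _ _ (hx₀.add hh₀)).congr fun n => ?_
    congr 1; abel

theorem exists_uniform_lt_one (D : GibbonsData E) (C : ℝ) :
    ∃ ε > 0, ∀ w, Adm D w → ∀ x, |⟪D.e, x⟫| ≤ C → w x ≤ 1 - ε := by
  by_contra! hcon
  choose w hw x hx hlt using fun n : ℕ => hcon (1 / ((n : ℝ) + 1)) (by positivity)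
  obtain ⟨w₀, x₀, h₀, hw₀, -, -, h1, -⟩ :=
    exists_limit_triple (hyperfilter ℕ) hw hx (h := fun _ => 0) (C' := 0) (by simp)
  have hle : (hyperfilter ℕ : Filter ℕ) ≤ atTop := Nat.hyperfilter_le_atTop
  have h2 : Tendsto (fun n : ℕ => 1 - 1 / ((n : ℝ) + 1)) (hyperfilter ℕ) (𝓝 (1 - 0)) :=
    (tendsto_const_nhds.sub tendsto_one_div_add_atTop_nhds_zero_nat).mono_left hle
  have h3 : 1 - 0 ≤ w₀ x₀ := le_of_tendsto_of_tendsto h2 h1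
    (Filter.Eventually.of_forall (f := (hyperfilter ℕ : Filter ℕ)) fun n => (hlt n).le)
  have := hw₀.lt_one x₀
  linarith

/-- Admissible solutions do not decrease under shifts in the cone translated by `s • e`. -/
def IsOrdered (D : GibbonsData E) (s : ℝ) : Prop :=
  ∀ w, Adm D w → ∀ x h, h - s • D.e ∈ D.cone → w x ≤ w (x + h)

theorem GibbonsData.mem_cone_of_sub {D : GibbonsData E} {h : E} {s s' : ℝ} (hs : s' ≤ s)
    (hh : h - s • D.e ∈ D.cone) : h - s' • D.e ∈ D.cone := by
  have := GibbonsData.add_mem_cone hh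
    (GibbonsData.smul_mem_cone D.e_mem_cone (sub_nonneg.2 hs))
  convert this using 1
  module

theorem GibbonsData.mem_cone_of_sub_smul {D : GibbonsData E} {h : E} {s : ℝ} (hs : 0 ≤ s)
    (hh : h - s • D.e ∈ D.cone) : h ∈ D.cone := by
  simpa using GibbonsData.mem_cone_of_sub hs hh

theorem GibbonsData.le_inner_of_sub_mem {D : GibbonsData E} {h : E} {s : ℝ}
    (hh : h - s • D.e ∈ D.cone) : s ≤ ⟪D.e, h⟫ := by
  have := GibbonsData.inner_nonneg hh
  rw [inner_sub_right, D.inner_smul_e] at this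
  linarith

theorem IsOrdered.mono {s s' : ℝ} (h : IsOrdered D s) (hs : s ≤ s') : IsOrdered D s' :=
  fun w hw x k hk => h w hw x k (GibbonsData.mem_cone_of_sub hs hk)

/-- The largest violation of the ordering is attained in the central strip. -/
theorem exists_violation_in_strip {s : ℝ} (hs : 0 ≤ s) (hord : ¬ IsOrdered D s) :
    ∃ w x h, Adm D w ∧ h - s • D.e ∈ D.cone ∧ |⟪D.e, x⟫| ≤ D.R D.δ ∧ w (x + h) < w x := by
  simp only [IsOrdered] at hord
  push Not at hord
  obtain ⟨w₁, hw₁, x₁, h₁, hh₁, hlt₁⟩ := hord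
  obtain ⟨T, hT⟩ : ∃ T : Set ℝ, T = {t | ∃ w x h, Adm D w ∧ h - s • D.e ∈ D.cone ∧
    t = w x - w (x + h)} := ⟨_, rfl⟩
  have hTb : BddAbove T := ⟨2, by
    rw [hT]
    rintro _ ⟨w, x, h, hw, -, rfl⟩
    linarith [(_root_.abs_le.1 (hw.abs_le x)).2, (_root_.abs_le.1 (hw.abs_le (x + h))).1]⟩
  have hT₁ : w₁ x₁ - w₁ (x₁ + h₁) ∈ T := hT ▸ ⟨w₁, x₁, h₁, hw₁, hh₁, rfl⟩
  obtain ⟨θ, hθ⟩ : ∃ θ, θ = sSup T := ⟨_, rfl⟩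
  have hθ0 : 0 < θ := by
    have := le_csSup hTb hT₁
    rw [hθ]; linarith
  have hθle : ∀ w, Adm D w → ∀ x h, h - s • D.e ∈ D.cone → w x - w (x + h) ≤ θ :=
    fun w hw x h hh => hθ ▸ le_csSup hTb (hT ▸ ⟨w, x, h, hw, hh, rfl⟩)
  have hseq : ∀ n : ℕ, ∃ w x h, Adm D w ∧ h - s • D.e ∈ D.cone ∧
      max (θ / 2) (θ - 1 / ((n : ℝ) + 1)) < w x - w (x + h) := by
    intro n
    have hpos : 0 < 1 / ((n : ℝ) + 1) := by positivity
    obtain ⟨t, ht, hlt⟩ := exists_lt_of_lt_csSup ⟨_, hT₁⟩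
      (show max (θ / 2) (θ - 1 / ((n : ℝ) + 1)) < sSup T from
        hθ ▸ max_lt (by linarith) (by linarith))
    rw [hT] at ht
    obtain ⟨w, x, h, hw, hh, rfl⟩ := ht
    exact ⟨w, x, h, hw, hh, hlt⟩
  choose w x h hw hh hlt using hseq
  have hhc : ∀ n, h n ∈ D.cone := fun n => GibbonsData.mem_cone_of_sub_smul hs (hh n)
  have hgap : ∀ n, θ / 2 < w n (x n) - w n (x n + h n) := fun n =>
    (le_max_left _ _).trans_lt (hlt n)
  have hb1 : ∀ n, -D.R (θ / 4) < ⟪D.e, x n⟫ := fun n => by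
    by_contra! hle
    have h1 := (hw n).lim_neg (θ / 4) (by linarith) _ hle
    have h2 := (_root_.abs_le.1 ((hw n).abs_le (x n + h n))).1
    linarith [hgap n]
  have hb2 : ∀ n, ⟪D.e, x n⟫ + ⟪D.e, h n⟫ < D.R (θ / 4) := fun n => by
    by_contra! hle
    rw [← inner_add_right] at hle
    have h1 := (hw n).lim_pos (θ / 4) (by linarith) _ hle
    have h2 := (_root_.abs_le.1 ((hw n).abs_le (x n))).2
    linarith [hgap n]
  obtain ⟨w₀, x₀, h₀, hw₀, -, hhlim, hl1, hl2⟩ := exists_limit_triple (hyperfilter ℕ) hw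
    (C := D.R (θ / 4)) (C' := 2 * D.R (θ / 4) / D.m)
    (fun n => _root_.abs_le.2 ⟨(hb1 n).le, by
      linarith [hb2 n, GibbonsData.inner_nonneg (hhc n)]⟩)
    (fun n => GibbonsData.norm_le_of_mem_cone (hhc n) (by linarith [hb1 n, hb2 n]))
  have hh₀ : h₀ - s • D.e ∈ D.cone := D.isClosed_cone.mem_of_tendsto
    (hhlim.sub_const _) (Filter.Eventually.of_forall (f := (hyperfilter ℕ : Filter ℕ)) hh)
  have hle : (hyperfilter ℕ : Filter ℕ) ≤ atTop := Nat.hyperfilter_le_atTop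
  have hθlim : Tendsto (fun n : ℕ => θ - 1 / ((n : ℝ) + 1)) (hyperfilter ℕ) (𝓝 (θ - 0)) :=
    (tendsto_const_nhds.sub tendsto_one_div_add_atTop_nhds_zero_nat).mono_left hle
  have hattain : θ - 0 ≤ w₀ x₀ - w₀ (x₀ + h₀) := le_of_tendsto_of_tendsto hθlim (hl1.sub hl2)
    (Filter.Eventually.of_forall (f := (hyperfilter ℕ : Filter ℕ)) fun n =>
      ((le_max_right _ _).trans_lt (hlt n)).le)
  have hJV : ∀ y, supShift D w₀ y ≤ infShift D w₀ (y + s • D.e) + θ := fun y => by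
    obtain ⟨k, hk, he⟩ := hw₀.exists_eq_supShift y
    obtain ⟨l, hl, he'⟩ := hw₀.exists_eq_infShift (y + s • D.e)
    have := hθle w₀ hw₀ (y - k) (k + l + s • D.e)
      (by rw [add_sub_cancel_right]; exact GibbonsData.add_mem_cone hk hl)
    rw [show y - k + (k + l + s • D.e) = y + s • D.e + l by abel] at this
    rw [he, he']; linarith
  have hcontact : supShift D w₀ x₀ = infShift D w₀ (x₀ + s • D.e) + θ := by
    refine le_antisymm (hJV x₀) ?_
    have h1 := hw₀.le_supShift_self x₀
    have h2 := hw₀.infShift_le (x₀ + s • D.e) hh₀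
    rw [add_add_sub_cancel] at h2
    linarith
  have hSC : ∀ Ω : Set E, IsOpen Ω → Convex ℝ Ω → ((∀ y ∈ Ω, 1 - D.δ ≤
      infShift D w₀ (y + s • D.e)) ∨ ∀ y ∈ Ω, supShift D w₀ y ≤ -1 + D.δ) → x₀ ∈ Ω →
      ∀ y ∈ Ω, supShift D w₀ y = infShift D w₀ (y + s • D.e) + θ := by
    intro Ω hΩ hΩc hcase hx₀ y hy
    exact strong_comparison (V := fun y => infShift D w₀ (y + s • D.e)) hθ0.le hw₀.supShift_lip
      (fun y z => by simpa using hw₀.infShift_lip (y + s • D.e) (z + s • D.e))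
      hw₀.abs_supShift_le (fun y => hw₀.abs_infShift_le _) hJV hΩ hΩc.isPreconnected
      (fun z _ => hw₀.isGenSub_supShift.isComparable
        (hw₀.isGenSub_reflect_infShift_translate _) z) (Or.inr hcase) hx₀ hcontact hy
  have hconv : IsLinearMap ℝ fun y : E => ⟪D.e, y⟫ := (innerSL ℝ D.e).toLinearMap.isLinear
  refine ⟨w₀, x₀, h₀, hw₀, hh₀, _root_.abs_le.2 ⟨?_, ?_⟩, by linarith⟩
  · by_contra! hlt
    obtain ⟨y, hy⟩ : ∃ y, y = (min (-D.R D.δ - 1) (-D.R (θ / 2))) • D.e := ⟨_, rfl⟩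
    have hye : ⟪D.e, y⟫ = min (-D.R D.δ - 1) (-D.R (θ / 2)) := by rw [hy, D.inner_smul_e]
    have h1 := hSC {y | ⟪D.e, y⟫ < -D.R D.δ} (isOpen_lt (by fun_prop) continuous_const)
      (convex_halfSpace_lt hconv _) (Or.inr fun y hy => hw₀.supShift_le D.δ_pos (le_of_lt hy)) hlt
      y (by rw [Set.mem_setOf_eq, hye]; exact (min_le_left _ _).trans_lt (by linarith))
    have h2 := hw₀.supShift_le (x := y) (half_pos hθ0) (hye ▸ min_le_right _ _)
    have h3 := (_root_.abs_le.1 (hw₀.abs_infShift_le (y + s • D.e))).1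
    linarith
  · by_contra! hlt
    obtain ⟨y, hy⟩ : ∃ y, y = (max (D.R D.δ + 1) (D.R (θ / 2))) • D.e := ⟨_, rfl⟩
    have hye : ⟪D.e, y⟫ = max (D.R D.δ + 1) (D.R (θ / 2)) := by rw [hy, D.inner_smul_e]
    have h1 := hSC {y | D.R D.δ < ⟪D.e, y⟫} (isOpen_lt continuous_const (by fun_prop))
      (convex_halfSpace_gt hconv _) (Or.inl fun y hy => hw₀.le_infShift D.δ_pos (by
        rw [inner_add_right, D.inner_smul_e]
        have : D.R D.δ < ⟪D.e, y⟫ := hy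
        linarith)) hlt
      y (by rw [Set.mem_setOf_eq, hye]; exact lt_of_lt_of_le (by linarith) (le_max_left _ _))
    have h2 := hw₀.le_infShift (x := y + s • D.e) (half_pos hθ0) (by
      rw [inner_add_right, D.inner_smul_e, hye]
      have := le_max_right (D.R D.δ + 1) (D.R (θ / 2))
      linarith)
    have h3 := (_root_.abs_le.1 (hw₀.abs_supShift_le y)).2
    linarith

end Sliding

section Contact

variable {E : Type*} [NormedAddCommGroup E] [InnerProductSpace ℝ E] [FiniteDimensional ℝ E]
  {D : GibbonsData E} {w : E → ℝ}

theorem exists_isOrdered (D : GibbonsData E) : ∃ s, 0 ≤ s ∧ IsOrdered D s := by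
  obtain ⟨ε, hε, hlt⟩ := exists_uniform_lt_one D (D.R D.δ)
  refine ⟨|D.R D.δ| + |D.R ε|, by positivity, ?_⟩
  by_contra hcon
  obtain ⟨w, x, h, hw, hh, hx, hv⟩ := exists_violation_in_strip (by positivity) hcon
  have h1 := hlt w hw x hx
  have h2 := GibbonsData.le_inner_of_sub_mem hh
  have h3 := hw.lim_pos ε hε (x + h) (by
    rw [inner_add_right]
    linarith [le_abs_self (D.R ε), (_root_.abs_le.1 hx).1, le_abs_self (D.R D.δ)])
  linarith

theorem isOrdered_of_forall_lt {s : ℝ} (hs : ∀ s', s < s' → IsOrdered D s') : IsOrdered D s := by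
  intro w hw x h hh
  refine le_of_forall_pos_le_add fun ε hε => ?_
  have hL := D.L_nonneg
  have ht : 0 < ε / (D.L + 1) := by positivity
  have h1 := hs (s + ε / (D.L + 1)) (by linarith) w hw x (h + (ε / (D.L + 1)) • D.e)
    (by convert hh using 1; module)
  have h2 := (_root_.abs_le.1 (hw.lip (x + (h + (ε / (D.L + 1)) • D.e)) (x + h))).2
  rw [show x + (h + (ε / (D.L + 1)) • D.e) - (x + h) = (ε / (D.L + 1)) • D.e by abel, norm_smul,
    D.norm_e, mul_one, Real.norm_of_nonneg ht.le] at h2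
  have h3 : D.L * (ε / (D.L + 1)) ≤ ε := by
    rw [← mul_div_assoc, div_le_iff₀ (by positivity)]; nlinarith
  linarith

theorem exists_contact {s : ℝ} (hs : 0 < s) (hord : IsOrdered D s)
    (hn : ∀ s', 0 ≤ s' → s' < s → ¬ IsOrdered D s') :
    ∃ w x h, Adm D w ∧ h - s • D.e ∈ D.cone ∧ w (x + h) = w x := by
  obtain ⟨ε, hε, hlt⟩ := exists_uniform_lt_one D (D.R D.δ)
  obtain ⟨t, ht⟩ : ∃ t : ℕ → ℝ, ∀ n, t n = s - s * (1 / ((n : ℝ) + 1)) := ⟨_, fun _ => rfl⟩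
  have ht0 : ∀ n, 0 ≤ t n := fun n => by
    have : 1 / ((n : ℝ) + 1) ≤ 1 := (div_le_one (by positivity)).2 (by linarith [n.cast_nonneg (α := ℝ)])
    rw [ht]; nlinarith
  have hts : ∀ n, t n < s := fun n => by
    have : 0 < s * (1 / ((n : ℝ) + 1)) := by positivity
    rw [ht]; linarith
  choose w x h hw hh hx hv using fun n => exists_violation_in_strip (ht0 n) (hn _ (ht0 n) (hts n))
  have hhc : ∀ n, h n ∈ D.cone := fun n => GibbonsData.mem_cone_of_sub_smul (ht0 n) (hh n)
  have hhe : ∀ n, ⟪D.e, h n⟫ ≤ D.R ε + D.R D.δ := fun n => by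
    by_contra! hcon
    have h1 := hlt _ (hw n) _ (hx n)
    have h2 := (hw n).lim_pos ε hε (x n + h n) (by
      rw [inner_add_right]; linarith [(_root_.abs_le.1 (hx n)).1])
    linarith [hv n]
  obtain ⟨w₀, x₀, h₀, hw₀, -, hhlim, hl1, hl2⟩ := exists_limit_triple (hyperfilter ℕ) hw hx
    (fun n => GibbonsData.norm_le_of_mem_cone (hhc n) (hhe n))
  have hle : (hyperfilter ℕ : Filter ℕ) ≤ atTop := Nat.hyperfilter_le_atTop
  have htlim : Tendsto t (hyperfilter ℕ) (𝓝 s) := by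
    have : Tendsto (fun n : ℕ => s - s * (1 / ((n : ℝ) + 1))) atTop (𝓝 (s - s * 0)) :=
      tendsto_const_nhds.sub (tendsto_one_div_add_atTop_nhds_zero_nat.const_mul s)
    rw [mul_zero, sub_zero] at this
    exact (this.mono_left hle).congr fun n => (ht n).symm
  have hh₀ : h₀ - s • D.e ∈ D.cone := D.isClosed_cone.mem_of_tendsto
    (hhlim.sub (htlim.smul_const _)) (Filter.Eventually.of_forall (f := (hyperfilter ℕ : Filter ℕ)) hh)
  exact ⟨w₀, x₀, h₀, hw₀, hh₀, le_antisymm (le_of_tendsto_of_tendsto hl2 hl1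
    (Filter.Eventually.of_forall (f := (hyperfilter ℕ : Filter ℕ)) fun n => (hv n).le))
    (hord _ hw₀ _ _ hh₀)⟩

/-- A contact propagates to the whole space. -/
theorem Adm.supShift_eq_infShift (hw : Adm D w) {s : ℝ} (hord : IsOrdered D s) {x h : E}
    (hh : h - s • D.e ∈ D.cone) (hc : w (x + h) = w x) (y : E) :
    supShift D w y = infShift D w (y + h) := by
  have hJV : ∀ y, supShift D w y ≤ infShift D w (y + h) + 0 := fun y => by
    obtain ⟨k, hk, he⟩ := hw.exists_eq_supShift y
    obtain ⟨l, hl, he'⟩ := hw.exists_eq_infShift (y + h)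
    have := hord w hw (y - k) (h + (k + l)) (by
      have := GibbonsData.add_mem_cone hh (GibbonsData.add_mem_cone hk hl)
      rwa [sub_add_eq_add_sub] at this)
    rw [show y - k + (h + (k + l)) = y + h + l by abel] at this
    rw [he, he']; linarith
  have := strong_comparison (V := fun y => infShift D w (y + h)) le_rfl hw.supShift_lip
    (fun y z => by simpa using hw.infShift_lip (y + h) (z + h))
    hw.abs_supShift_le (fun y => hw.abs_infShift_le _) hJV isOpen_univ isPreconnected_univ
    (fun z _ => hw.isGenSub_supShift.isComparable
      (hw.isGenSub_reflect_infShift_translate _) z) (Or.inl rfl) (x₀ := x) (Set.mem_univ _)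
    (le_antisymm (hJV x) (by
      have h1 := hw.le_supShift_self x
      have h2 := hw.infShift_le (x + h) D.zero_mem_cone
      rw [add_zero] at h2
      linarith)) (x := y) (Set.mem_univ _)
  rwa [add_zero] at this

theorem Adm.abs_inner_lt (hw : Adm D w) {z : E} (hz : w z = 0) : |⟪D.e, z⟫| < D.R (1 / 2) := by
  by_contra! hcon
  rcases le_abs.1 hcon with h | h
  · linarith [hw.lim_pos (1 / 2) (by norm_num) z h]
  · linarith [hw.lim_neg (1 / 2) (by norm_num) z (by linarith)]

/-- A contact can be moved to the zero level set without decreasing the shift. -/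
theorem Adm.exists_normalized_contact (hw : Adm D w) {s : ℝ} (hord : IsOrdered D s) {x h : E}
    (hh : h - s • D.e ∈ D.cone) (hc : w (x + h) = w x) :
    ∃ z h', h' - s • D.e ∈ D.cone ∧ w z = 0 ∧ w (z + h') = 0 ∧ ⟪D.e, h⟫ ≤ ⟪D.e, h'⟫ := by
  have hcont : Continuous (supShift D w) := by
    refine (LipschitzWith.of_dist_le_mul (K := ⟨D.L, D.L_nonneg⟩) fun x y => ?_).continuous
    rw [Real.dist_eq, dist_eq_norm]; exact hw.supShift_lip x y
  obtain ⟨t, ht⟩ := mem_range_of_exists_le_of_exists_ge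
    (f := fun t : ℝ => supShift D w (t • D.e)) (c := 0)
    (hcont.comp (by fun_prop))
    ⟨-D.R (1 / 2), by
      linarith [hw.supShift_le (ε := 1 / 2) (by norm_num) (x := (-D.R (1 / 2)) • D.e)
        (by rw [D.inner_smul_e])]⟩
    ⟨D.R (1 / 2), by
      linarith [hw.lim_pos (1 / 2) (by norm_num) (D.R (1 / 2) • D.e) (by rw [D.inner_smul_e]),
        hw.le_supShift_self (D.R (1 / 2) • D.e)]⟩
  have ht' : supShift D w (t • D.e) = 0 := ht
  obtain ⟨k, hk, he⟩ := hw.exists_eq_supShift (t • D.e)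
  obtain ⟨l, hl, he'⟩ := hw.exists_eq_infShift (t • D.e + h)
  have hJI := hw.supShift_eq_infShift hord hh hc (t • D.e)
  refine ⟨t • D.e - k, h + (k + l), ?_, by rw [← he, ht'], ?_, ?_⟩
  · have := GibbonsData.add_mem_cone hh (GibbonsData.add_mem_cone hk hl)
    rwa [sub_add_eq_add_sub] at this
  · rw [show t • D.e - k + (h + (k + l)) = t • D.e + h + l by abel, ← he', ← hJI, ht']
  · have := GibbonsData.inner_nonneg hk
    have := GibbonsData.inner_nonneg hl
    rw [inner_add_right, inner_add_right]; linarith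

theorem Adm.not_periodic (hw : Adm D w) {h : E} (hh : 0 < ⟪D.e, h⟫) (hper : ∀ y, w (y + h) = w y) :
    False := by
  have hiter : ∀ n : ℕ, w ((n : ℝ) • h) = w 0 := fun n => by
    induction n with
    | zero => simp
    | succ n ih => rw [Nat.cast_succ, add_smul, one_smul, hper, ih]
  have hlt := hw.lt_one 0
  obtain ⟨n, hn⟩ := exists_nat_ge (D.R ((1 - w 0) / 2) / ⟪D.e, h⟫)
  have := hw.lim_pos ((1 - w 0) / 2) (by linarith) ((n : ℝ) • h) (by
    rw [inner_smul_right]; rwa [div_le_iff₀ hh] at hn)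
  rw [hiter] at this
  linarith

theorem Adm.no_contact (hw : Adm D w) {s : ℝ} (hs : 0 < s) (hord : IsOrdered D s) {x h : E}
    (hh : h - s • D.e ∈ D.cone) (hc : w (x + h) = w x) : False := by
  obtain ⟨T, hT⟩ : ∃ T : Set ℝ, T = {t | ∃ w z h, Adm D w ∧ h - s • D.e ∈ D.cone ∧ w z = 0 ∧
    w (z + h) = 0 ∧ t = ⟪D.e, h⟫} := ⟨_, rfl⟩
  have hTb' : ∀ (w : E → ℝ) z h, Adm D w → w z = 0 → w (z + h) = 0 →
      ⟪D.e, h⟫ ≤ 2 * D.R (1 / 2) := fun w z h hw hz hzh => by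
    have h1 := abs_lt.1 (hw.abs_inner_lt hz)
    have h2 := abs_lt.1 (hw.abs_inner_lt hzh)
    rw [inner_add_right] at h2
    linarith
  have hTb : BddAbove T := ⟨2 * D.R (1 / 2), by
    rw [hT]
    rintro _ ⟨w, z, h, hw, -, hz, hzh, rfl⟩
    exact hTb' w z h hw hz hzh⟩
  have hTm : ∀ (w : E → ℝ), Adm D w → ∀ x h, h - s • D.e ∈ D.cone → w (x + h) = w x →
      ∃ t ∈ T, ⟪D.e, h⟫ ≤ t := fun w hw x h hh hc => by
    obtain ⟨z, h', hh', hz, hzh, hle⟩ := hw.exists_normalized_contact hord hh hc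
    exact ⟨_, hT ▸ ⟨w, z, h', hw, hh', hz, hzh, rfl⟩, hle⟩
  have hTn : T.Nonempty := by
    obtain ⟨t, ht, -⟩ := hTm w hw x h hh hc
    exact ⟨t, ht⟩
  have hseq : ∀ n : ℕ, ∃ w z h, Adm D w ∧ h - s • D.e ∈ D.cone ∧ w z = 0 ∧ w (z + h) = 0 ∧
      sSup T - 1 / ((n : ℝ) + 1) < ⟪D.e, h⟫ := by
    intro n
    have hpos : 0 < 1 / ((n : ℝ) + 1) := by positivity
    obtain ⟨t, ht, hlt⟩ := exists_lt_of_lt_csSup hTn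
      (show sSup T - 1 / ((n : ℝ) + 1) < sSup T by linarith)
    rw [hT] at ht
    obtain ⟨w, z, h, hw, hh, hz, hzh, rfl⟩ := ht
    exact ⟨w, z, h, hw, hh, hz, hzh, hlt⟩
  choose v z k hv hk hz hzk hlt using hseq
  obtain ⟨w₀, x₀, h₀, hw₀, -, hhlim, hl1, hl2⟩ := exists_limit_triple (hyperfilter ℕ) hv
    (fun n => ((hv n).abs_inner_lt (hz n)).le)
    (fun n => GibbonsData.norm_le_of_mem_cone (GibbonsData.mem_cone_of_sub_smul hs.le (hk n))
      (hTb' _ _ _ (hv n) (hz n) (hzk n)))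
  have hle : (hyperfilter ℕ : Filter ℕ) ≤ atTop := Nat.hyperfilter_le_atTop
  have hh₀ : h₀ - s • D.e ∈ D.cone := D.isClosed_cone.mem_of_tendsto
    (hhlim.sub_const _) (Filter.Eventually.of_forall (f := (hyperfilter ℕ : Filter ℕ)) hk)
  simp only [hz, hzk] at hl1 hl2
  have hc₀ : w₀ (x₀ + h₀) = w₀ x₀ := tendsto_nhds_unique hl2 hl1
  have hmax : sSup T - 0 ≤ ⟪D.e, h₀⟫ := le_of_tendsto_of_tendsto
    ((tendsto_const_nhds.sub tendsto_one_div_add_atTop_nhds_zero_nat).mono_left hle)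
    (((innerSL ℝ D.e).continuous.tendsto h₀).comp hhlim)
    (Filter.Eventually.of_forall (f := (hyperfilter ℕ : Filter ℕ)) fun n => (hlt n).le)
  have hper : ∀ y, w₀ (y + h₀) = w₀ y := fun y => by
    have hJI := hw₀.supShift_eq_infShift hord hh₀ hc₀ y
    obtain ⟨k, hk, he⟩ := hw₀.exists_eq_supShift y
    obtain ⟨l, hl, he'⟩ := hw₀.exists_eq_infShift (y + h₀)
    obtain ⟨t, ht, hle⟩ := hTm w₀ hw₀ (y - k) (h₀ + (k + l))
      (by
        have := GibbonsData.add_mem_cone hh₀ (GibbonsData.add_mem_cone hk hl)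
        rwa [sub_add_eq_add_sub] at this)
      (by rw [show y - k + (h₀ + (k + l)) = y + h₀ + l by abel, ← he', ← hJI, he])
    have h1 := le_csSup hTb ht
    have h2 := GibbonsData.inner_nonneg hk
    have h3 := GibbonsData.inner_nonneg hl
    rw [inner_add_right, inner_add_right] at hle
    have hk0 : k = 0 := norm_le_zero_iff.1 (by
      simpa using GibbonsData.norm_le_of_mem_cone hk (C := 0) (by linarith))
    have hl0 : l = 0 := norm_le_zero_iff.1 (by
      simpa using GibbonsData.norm_le_of_mem_cone hl (C := 0) (by linarith))
    rw [hk0, sub_zero] at he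
    rw [hl0, add_zero] at he'
    rw [← he, ← he', hJI]
  exact hw₀.not_periodic (hs.trans_le (GibbonsData.le_inner_of_sub_mem hh₀)) hper

theorem isOrdered_zero (D : GibbonsData E) : IsOrdered D 0 := by
  obtain ⟨s₁, hs₁, hord₁⟩ := exists_isOrdered D
  obtain ⟨S, hS⟩ : ∃ S : Set ℝ, S = {s | 0 ≤ s ∧ IsOrdered D s} := ⟨_, rfl⟩
  have hSn : S.Nonempty := ⟨s₁, hS ▸ ⟨hs₁, hord₁⟩⟩
  have hSb : BddBelow S := ⟨0, by rw [hS]; exact fun s hs => hs.1⟩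
  have hord : IsOrdered D (sInf S) := isOrdered_of_forall_lt fun s' hs' => by
    obtain ⟨s, hs, hlt⟩ := exists_lt_of_csInf_lt hSn hs'
    rw [hS] at hs
    exact hs.2.mono hlt.le
  have h0 : 0 ≤ sInf S := le_csInf hSn (by rw [hS]; exact fun s hs => hs.1)
  rcases h0.eq_or_lt with h | h
  · rwa [← h] at hord
  · obtain ⟨w, x, k, hw, hk, hc⟩ := exists_contact h hord fun s' h1 h2 h3 =>
      absurd (csInf_le hSb (by rw [hS]; exact ⟨h1, h3⟩)) (not_le.2 h2)
    exact (hw.no_contact h hord hk hc).elim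

/-- Admissible solutions are strictly increasing in the directions of the cone. -/
theorem Adm.lt_of_mem_cone (hw : Adm D w) {h : E} (hh : h ∈ D.cone) (he : 0 < ⟪D.e, h⟫) (x : E) :
    w x < w (x + h) := by
  have hord := isOrdered_zero D
  have hh' : h - (0 : ℝ) • D.e ∈ D.cone := by simpa using hh
  refine lt_of_le_of_ne (hord w hw x h hh') fun heq => hw.not_periodic he fun y => ?_
  have hle : ∀ z k, k ∈ D.cone → w z ≤ w (z + k) := fun z k hk =>
    hord w hw z k (by simpa using hk)
  have hJI := hw.supShift_eq_infShift hord hh' heq.symm y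
  obtain ⟨k, hk, hJ⟩ := hw.exists_eq_supShift y
  obtain ⟨l, hl, hI⟩ := hw.exists_eq_infShift (y + h)
  have h1 := hle (y - k) k hk
  rw [sub_add_cancel] at h1
  linarith [hle y h hh, hle (y + h) l hl]

end Contact

section Bridge

variable {N : ℕ}

/-- The matrix of the symmetric part of an operator. -/
def symMat (X : ESp N →L[ℝ] ESp N) : Matrix (Fin N) (Fin N) ℝ :=
  Matrix.of fun i j =>
    1 / 2 * (⟪X (EuclideanSpace.single j 1), EuclideanSpace.single i 1⟫ +
      ⟪X (EuclideanSpace.single i 1), EuclideanSpace.single j 1⟫)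

theorem symMat_isSymm (X : ESp N →L[ℝ] ESp N) : (symMat X).IsSymm := by
  refine Matrix.IsSymm.ext fun i j => ?_
  simp only [symMat, Matrix.of_apply]
  ring

open Matrix in
theorem dotProduct_symMat (X : ESp N →L[ℝ] ESp N) (k : ESp N) :
    (k : Fin N → ℝ) ⬝ᵥ (symMat X *ᵥ (k : Fin N → ℝ)) = ⟪X k, k⟫ := by
  have hk : k = ∑ i, k i • EuclideanSpace.single i (1 : ℝ) := by
    ext j
    simp [Pi.single_apply]
  have hX : ⟪X k, k⟫ = ∑ i, ∑ j, k i * k j *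
      ⟪X (EuclideanSpace.single i 1), EuclideanSpace.single j 1⟫ := by
    conv_lhs => rw [hk]
    simp only [map_sum, map_smul, sum_inner, inner_sum, inner_smul_left, inner_smul_right,
      Finset.mul_sum]
    rw [Finset.sum_comm]
    refine Finset.sum_congr rfl fun i _ => Finset.sum_congr rfl fun j _ => ?_
    simp only [conj_trivial]
    ring
  have hX' : ⟪X k, k⟫ = ∑ i, ∑ j, k i * k j *
      ⟪X (EuclideanSpace.single j 1), EuclideanSpace.single i 1⟫ := by
    rw [hX, Finset.sum_comm]
    exact Finset.sum_congr rfl fun i _ => Finset.sum_congr rfl fun j _ => by ring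
  have : ⟪X k, k⟫ = 1 / 2 * (⟪X k, k⟫ + ⟪X k, k⟫) := by ring
  rw [this]
  conv_rhs => rw [hX']; arg 2; arg 2; rw [← hX', hX]
  simp only [dotProduct, mulVec, symMat, Matrix.of_apply, ← Finset.sum_add_distrib,
    Finset.mul_sum]
  exact Finset.sum_congr rfl fun i _ => Finset.sum_congr rfl fun j _ => by ring

open Matrix MatrixOrder Matrix.Norms.L2Operator in
theorem Matrix.PosSemidef.dotProduct_le_trace {n : Type*} [Fintype n] [DecidableEq n]
    {P : Matrix n n ℝ} (hP : P.PosSemidef) (k : n → ℝ) :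
    k ⬝ᵥ (P *ᵥ k) ≤ P.trace * ∑ i, k i ^ 2 := by
  obtain ⟨B, rfl⟩ := CStarAlgebra.nonneg_iff_eq_star_mul_self.1 hP.nonneg
  rw [star_eq_conjTranspose]
  have h1 : k ⬝ᵥ ((Bᴴ * B) *ᵥ k) = ∑ i, (∑ j, B i j * k j) ^ 2 := by
    rw [← mulVec_mulVec, dotProduct_mulVec, Matrix.conjTranspose_eq_transpose_of_trivial,
      vecMul_transpose]
    simp [dotProduct, mulVec, sq]
  have h2 : (Bᴴ * B).trace = ∑ i, ∑ j, B i j ^ 2 := by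
    rw [Finset.sum_comm]
    simp [Matrix.trace, Matrix.mul_apply, sq]
  rw [h1, h2, Finset.sum_mul]
  exact Finset.sum_le_sum fun i _ => Finset.sum_mul_sq_le_sq_mul_sq _ _ _

open Matrix in
theorem UniformlyElliptic.isElliptic {a A : ℝ} (ha : 0 < a)
    {Ftil : Matrix (Fin N) (Fin N) ℝ → ℝ} (hF : UniformlyElliptic N a A Ftil) :
    IsElliptic a (A * N) (fun X => Ftil (symMat X)) := by
  have key : ∀ (X Y : ESp N →L[ℝ] ESp N) (s t : ℝ), 0 ≤ s →
      (∀ k, ⟪X k, k⟫ ≤ ⟪Y k, k⟫ + s * ‖k‖ ^ 2) →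
      (t ≤ 0 ∨ ∃ n : ESp N, ‖n‖ = 1 ∧ ⟪X n, n⟫ + t ≤ ⟪Y n, n⟫) →
      Ftil (symMat X) ≤ Ftil (symMat Y) + A * N * s - a * t := by
    intro X Y s t hs h ht
    obtain ⟨P, hPdef⟩ : ∃ P, P = symMat Y + s • (1 : Matrix (Fin N) (Fin N) ℝ) - symMat X :=
      ⟨_, rfl⟩
    have hS : (s • (1 : Matrix (Fin N) (Fin N) ℝ)).PosSemidef := Matrix.PosSemidef.one.smul hs
    have hSs : (s • (1 : Matrix (Fin N) (Fin N) ℝ)).IsSymm := Matrix.isSymm_one.smul s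
    have hPs : P.IsSymm := hPdef ▸ ((symMat_isSymm Y).add hSs).sub (symMat_isSymm X)
    have hPq : ∀ k : ESp N, (k : Fin N → ℝ) ⬝ᵥ (P *ᵥ (k : Fin N → ℝ)) =
        ⟪Y k, k⟫ + s * ‖k‖ ^ 2 - ⟪X k, k⟫ := fun k => by
      rw [hPdef, Matrix.sub_mulVec, Matrix.add_mulVec, dotProduct_sub, dotProduct_add,
        dotProduct_symMat, dotProduct_symMat, Matrix.smul_mulVec, Matrix.one_mulVec,
        dotProduct_smul, EuclideanSpace.norm_sq_eq]
      simp [dotProduct, sq]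
    have hP : P.PosSemidef := by
      refine Matrix.PosSemidef.of_dotProduct_mulVec_nonneg ?_ fun x => ?_
      · rw [Matrix.IsHermitian, Matrix.conjTranspose_eq_transpose_of_trivial]; exact hPs
      · have := hPq (WithLp.toLp 2 x)
        have h2 := h (WithLp.toLp 2 x)
        simp only [star_trivial] at this ⊢
        rw [this]; linarith
    have h1 := (hF.2 _ P (symMat_isSymm X) hPs hP).1
    have h2 := (hF.2 _ _ (symMat_isSymm Y) hSs hS).2
    have h3 : symMat X + P = symMat Y + s • 1 := by rw [hPdef]; abel
    have h4 : (s • (1 : Matrix (Fin N) (Fin N) ℝ)).trace = N * s := by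
      simp [Matrix.trace_smul, mul_comm]
    have h5 : t ≤ P.trace := by
      rcases ht with ht | ⟨n, hn, hnt⟩
      · exact ht.trans hP.trace_nonneg
      · have h6 := hP.dotProduct_le_trace (n : Fin N → ℝ)
        have h7 := EuclideanSpace.norm_sq_eq n
        simp only [Real.norm_eq_abs, sq_abs] at h7
        rw [hPq, ← h7, hn] at h6
        linarith
    rw [h3] at h1
    rw [h4] at h2
    have := mul_le_mul_of_nonneg_left h5 ha.le
    linarith
  refine ⟨?_, fun X Y s hs h => ?_, fun X Y s t n hs hn h ht => ?_⟩
  · have h0 : symMat (0 : ESp N →L[ℝ] ESp N) = 0 := by ext i j; simp [symMat]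
    have := hF.1 0 le_rfl 0 Matrix.isSymm_zero
    simpa [h0] using this
  · simpa using key X Y s 0 hs h (Or.inl le_rfl)
  · exact key X Y s t hs h (Or.inr ⟨n, hn, ht⟩)

/-- The quadratic polynomial with gradient `p` and second derivative `X` at `x`. -/
def quadTest (x p : ESp N) (X : ESp N →L[ℝ] ESp N) (y : ESp N) : ℝ :=
  ⟪p, y - x⟫ + 1 / 2 * ⟪X (y - x), y - x⟫

theorem contDiff_quadTest (x p : ESp N) (X : ESp N →L[ℝ] ESp N) :
    ContDiff ℝ 2 (quadTest x p X) := by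
  have h1 : ContDiff ℝ 2 fun y : ESp N => y - x := contDiff_id.sub contDiff_const
  exact (contDiff_const.inner ℝ h1).add (contDiff_const.mul ((X.contDiff.comp h1).inner ℝ h1))

theorem hasFDerivAt_quadTest (x p : ESp N) (X : ESp N →L[ℝ] ESp N) (y : ESp N) :
    ∃ L : ESp N →L[ℝ] ℝ, HasFDerivAt (quadTest x p X) L y ∧
      ∀ v, L v = ⟪p, v⟫ + 1 / 2 * (⟪X v, y - x⟫ + ⟪X (y - x), v⟫) := by
  have h1 : HasFDerivAt (fun y : ESp N => y - x) (ContinuousLinearMap.id ℝ (ESp N)) y :=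
    (hasFDerivAt_id y).sub_const x
  have h2 : HasFDerivAt (fun y : ESp N => X (y - x)) (X.comp (ContinuousLinearMap.id ℝ (ESp N))) y :=
    X.hasFDerivAt.comp y h1
  refine ⟨_, ((hasFDerivAt_const p y).inner ℝ h1).add ((h2.inner ℝ h1).const_mul (1 / 2)), ?_⟩
  intro v
  simp [real_inner_comm]
  try ring

theorem gradient_quadTest (x p : ESp N) (X : ESp N →L[ℝ] ESp N) :
    gradient (quadTest x p X) x = p := by
  obtain ⟨L, hL, hv⟩ := hasFDerivAt_quadTest x p X x
  refine HasGradientAt.gradient ?_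
  rw [hasGradientAt_iff_hasFDerivAt]
  refine hL.congr_fderiv (ContinuousLinearMap.ext fun v => ?_)
  simp [hv]

theorem hessianMatrix_quadTest (x p : ESp N) (X : ESp N →L[ℝ] ESp N) :
    hessianMatrix (quadTest x p X) x = symMat X := by
  have h0 : ∀ v, (fun y => fderiv ℝ (quadTest x p X) y v) =
      fun y => ⟪p, v⟫ + 1 / 2 * (⟪X v, y - x⟫ + ⟪X (y - x), v⟫) := fun v => by
    funext y
    obtain ⟨L, hL, hv⟩ := hasFDerivAt_quadTest x p X y
    rw [hL.fderiv, hv]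
  ext i j
  simp only [hessianMatrix, symMat, Matrix.of_apply]
  rw [h0]
  generalize EuclideanSpace.single j (1 : ℝ) = v
  have h1 : HasFDerivAt (fun y : ESp N => y - x) (ContinuousLinearMap.id ℝ (ESp N)) x :=
    (hasFDerivAt_id x).sub_const x
  have h2 : HasFDerivAt (fun y : ESp N => X (y - x)) (X.comp (ContinuousLinearMap.id ℝ (ESp N))) x :=
    X.hasFDerivAt.comp x h1
  have h3 := (((((hasFDerivAt_const (X v) x).inner ℝ h1).add
    (h2.inner ℝ (hasFDerivAt_const v x))).const_mul (1 / 2)).const_add ⟪p, v⟫)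
  have h4 : fderiv ℝ (fun y => ⟪p, v⟫ + 1 / 2 * (⟪X v, y - x⟫ + ⟪X (y - x), v⟫)) x = _ := h3.fderiv
  rw [h4]
  simp [mul_add]

theorem JetAbove.isLocalMax {u : ESp N → ℝ} {x p : ESp N} {X : ESp N →L[ℝ] ESp N}
    (h : JetAbove u x p (fun k => ⟪X k, k⟫)) : IsLocalMax (fun y => u y - quadTest x p X y) x := by
  have ht : Tendsto (fun y => y - x) (𝓝 x) (𝓝 0) := by
    have : Tendsto (fun y => y - x) (𝓝 x) (𝓝 (x - x)) := Continuous.tendsto (by fun_prop) x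
    rwa [sub_self] at this
  filter_upwards [ht.eventually h] with y hy
  simp only [quadTest, sub_self, map_zero, inner_zero_right]
  rw [add_sub_cancel] at hy
  linarith

theorem JetBelow.isLocalMin {u : ESp N → ℝ} {x p : ESp N} {X : ESp N →L[ℝ] ESp N}
    (h : JetBelow u x p (fun k => ⟪X k, k⟫)) : IsLocalMin (fun y => u y - quadTest x p X y) x := by
  have ht : Tendsto (fun y => y - x) (𝓝 x) (𝓝 0) := by
    have : Tendsto (fun y => y - x) (𝓝 x) (𝓝 (x - x)) := Continuous.tendsto (by fun_prop) x
    rwa [sub_self] at this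
  filter_upwards [ht.eventually h] with y hy
  simp only [quadTest, sub_self, map_zero, inner_zero_right]
  rw [add_sub_cancel] at hy
  linarith

theorem fderiv_eq_zero_of_const_ball {u φ : ESp N → ℝ} {x : ESp N} {r c : ℝ} (hr : 0 < r)
    (hc : ∀ y ∈ ball x r, u y = c) (h : IsLocalExtr (fun y => u y - φ y) x) :
    gradient φ x = 0 := by
  have h1 : IsLocalExtr (fun y => c - φ y) x := by
    refine h.congr ?_
    filter_upwards [ball_mem_nhds x hr] with y hy
    rw [hc y hy]
  have h2 := h1.fderiv_eq_zero
  rw [fderiv_const_sub, neg_eq_zero] at h2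
  rw [gradient, h2, map_zero]

theorem ViscSub.apply {α : ℝ} {Ftil : Matrix (Fin N) (Fin N) ℝ → ℝ} {g : ESp N → ℝ → ℝ}
    {u φ : ESp N → ℝ} (h : ViscSub α Ftil g Set.univ u) {x : ESp N} (hφ : ContDiff ℝ 2 φ)
    (hm : IsLocalMax (fun y => u y - φ y) x) (hg : gradient φ x ≠ 0) :
    g x (u x) ≤ ‖gradient φ x‖ ^ α * Ftil (hessianMatrix φ x) := by
  rcases h x (Set.mem_univ _) with ⟨r, hr, c, -, hc, -⟩ | h
  · exact absurd (fderiv_eq_zero_of_const_ball hr hc (Or.inr hm)) hg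
  · exact h φ hφ hm hg

theorem ViscSuper.apply {α : ℝ} {Ftil : Matrix (Fin N) (Fin N) ℝ → ℝ} {g : ESp N → ℝ → ℝ}
    {u φ : ESp N → ℝ} (h : ViscSuper α Ftil g Set.univ u) {x : ESp N} (hφ : ContDiff ℝ 2 φ)
    (hm : IsLocalMin (fun y => u y - φ y) x) (hg : gradient φ x ≠ 0) :
    ‖gradient φ x‖ ^ α * Ftil (hessianMatrix φ x) ≤ g x (u x) := by
  rcases h x (Set.mem_univ _) with ⟨r, hr, c, -, hc, -⟩ | h
  · exact absurd (fderiv_eq_zero_of_const_ball hr hc (Or.inl hm)) hg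
  · exact h φ hφ hm hg

section OneD

variable [NeZero N]

theorem hasFDerivAt_comp_coord {φ : ℝ → ℝ} (hφ : Differentiable ℝ φ) (x : ESp N) :
    ∃ L : ESp N →L[ℝ] ℝ, HasFDerivAt (fun y : ESp N => φ (y 0)) L x ∧
      ∀ v, L v = deriv φ (x 0) * v 0 := by
  have h1 : HasFDerivAt (fun y : ESp N => y 0) (EuclideanSpace.proj (𝕜 := ℝ) 0) x :=
    (EuclideanSpace.proj (𝕜 := ℝ) (0 : Fin N)).hasFDerivAt
  exact ⟨_, (hφ (x 0)).hasDerivAt.comp_hasFDerivAt x h1, fun v => by simp⟩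

theorem gradient_comp_coord {φ : ℝ → ℝ} (hφ : Differentiable ℝ φ) (x : ESp N) :
    gradient (fun y : ESp N => φ (y 0)) x = EuclideanSpace.single 0 (deriv φ (x 0)) := by
  obtain ⟨L, hL, hv⟩ := hasFDerivAt_comp_coord hφ x
  refine HasGradientAt.gradient ?_
  rw [hasGradientAt_iff_hasFDerivAt]
  refine hL.congr_fderiv (ContinuousLinearMap.ext fun v => ?_)
  simp [hv, EuclideanSpace.inner_single_left]

theorem hessianMatrix_comp_coord {φ : ℝ → ℝ} (hφ : ContDiff ℝ 2 φ) (x : ESp N) :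
    hessianMatrix (fun y : ESp N => φ (y 0)) x = deriv (deriv φ) (x 0) • e11 N := by
  have hφ1 : Differentiable ℝ φ := hφ.differentiable (by norm_num)
  have hφ2 : Differentiable ℝ (deriv φ) := by
    have : ContDiff ℝ (1 + 1) φ := by norm_num; exact hφ
    exact (contDiff_succ_iff_deriv.1 this).2.2.differentiable (by norm_num)
  have h0 : ∀ v : ESp N, (fun y : ESp N => fderiv ℝ (fun y : ESp N => φ (y 0)) y v) =
      fun y => deriv φ (y 0) * v 0 := fun v => by
    funext y
    obtain ⟨L, hL, hv⟩ := hasFDerivAt_comp_coord hφ1 y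
    rw [hL.fderiv, hv]
  ext i j
  simp only [hessianMatrix, Matrix.of_apply]
  rw [h0]
  obtain ⟨L, hL, hv⟩ := hasFDerivAt_comp_coord hφ2 x
  rw [(hL.mul_const _).fderiv]
  simp only [e11, Matrix.smul_apply, Matrix.of_apply, smul_apply, hv, smul_eq_mul]
  by_cases hi : i = 0 <;> by_cases hj : j = 0 <;> simp [hi, hj, eq_comm]

theorem ViscSol.viscSol1D {α : ℝ} {Ftil : Matrix (Fin N) (Fin N) ℝ → ℝ} {f : ℝ → ℝ}
    {u : ESp N → ℝ} (h : ViscSol α Ftil (fun _ s => -f s) Set.univ u) {v : ℝ → ℝ}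
    (hv : ∀ x, u x = v (x 0)) : ViscSol1D (N := N) α Ftil f v := by
  have hcoord : ∀ t : ℝ, (EuclideanSpace.single 0 t : ESp N) 0 = t := fun t => by simp
  have ht : ∀ t : ℝ, Tendsto (fun y : ESp N => y 0) (𝓝 (EuclideanSpace.single 0 t)) (𝓝 t) :=
    fun t => by
      have : Tendsto (fun y : ESp N => y 0) (𝓝 (EuclideanSpace.single 0 t))
        (𝓝 ((EuclideanSpace.single 0 t : ESp N) 0)) := Continuous.tendsto (by fun_prop) _
      rwa [hcoord] at this
  intro t
  refine ⟨Or.inr fun φ hφ hm hd => ?_, Or.inr fun φ hφ hm hd => ?_⟩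
  · have hg := gradient_comp_coord (hφ.differentiable (by norm_num))
      (EuclideanSpace.single 0 t : ESp N)
    rw [hcoord] at hg
    have := h.1.apply (x := EuclideanSpace.single 0 t) (φ := fun y => φ (y 0))
      (hφ.comp (EuclideanSpace.proj (𝕜 := ℝ) (0 : Fin N)).contDiff)
      (by
        filter_upwards [(ht t).eventually hm] with y hy
        rw [hv, hv, hcoord]; exact hy)
      (by rw [hg]; simpa using hd)
    rw [hessianMatrix_comp_coord hφ, hg, hv, hcoord] at this
    simpa using this
  · have hg := gradient_comp_coord (hφ.differentiable (by norm_num))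
      (EuclideanSpace.single 0 t : ESp N)
    rw [hcoord] at hg
    have := h.2.apply (x := EuclideanSpace.single 0 t) (φ := fun y => φ (y 0))
      (hφ.comp (EuclideanSpace.proj (𝕜 := ℝ) (0 : Fin N)).contDiff)
      (by
        filter_upwards [(ht t).eventually hm] with y hy
        rw [hv, hv, hcoord]; exact hy)
      (by rw [hg]; simpa using hd)
    rw [hessianMatrix_comp_coord hφ, hg, hv, hcoord] at this
    simpa using this

end OneD

end Bridge

section Main

variable {N : ℕ} [NeZero N]

theorem inner_single_zero (x : ESp N) : ⟪EuclideanSpace.single 0 1, x⟫ = x 0 := by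
  simp [EuclideanSpace.inner_single_left]

theorem lt_add_of_pos_coord {a A α : ℝ} (ha : 0 < a) (haA : a ≤ A) (hα : -1 < α)
    {Ftil : Matrix (Fin N) (Fin N) ℝ → ℝ} (hF : UniformlyElliptic N a A Ftil)
    {f : ℝ → ℝ} (hf : ContDiffOn ℝ 1 f (Set.Icc (-1) 1)) (hfm1 : f (-1) = 0) (hf1 : f 1 = 0)
    {δ₀ : ℝ} (hδ₀ : δ₀ ∈ Set.Ioo (0 : ℝ) 1) (hmonoNeg : AntitoneOn f (Set.Icc (-1) (-1 + δ₀)))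
    (hmonoPos : AntitoneOn f (Set.Icc (1 - δ₀) 1)) {u : ESp N → ℝ} (hu : Continuous u)
    (hrange : ∀ x, u x ∈ Set.Icc (-1 : ℝ) 1)
    (hsol : ViscSol α Ftil (fun _ s => -f s) Set.univ u)
    (hlimPos : ∀ ε > (0 : ℝ), ∃ R : ℝ, ∀ x : ESp N, R ≤ x 0 → |u x - 1| < ε)
    (hlimNeg : ∀ ε > (0 : ℝ), ∃ R : ℝ, ∀ x : ESp N, x 0 ≤ R → |u x + 1| < ε)
    (hgrad : α ≠ 0 → ∀ b c : ℝ, b < c →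
      ∃ m > (0 : ℝ), GradGE m {x : ESp N | x 0 ∈ Set.Icc b c} u)
    {h : ESp N} (hh : 0 < h 0) (x : ESp N) : u x < u (x + h) := by
  obtain ⟨K, hK⟩ := hf.exists_lipschitzOnWith one_ne_zero (convex_Icc _ _) isCompact_Icc
  have habs : ∀ x, |u x| ≤ 1 := fun x => _root_.abs_le.2 (hrange x)
  have hflip : ∀ s t, |s| ≤ 1 → |t| ≤ 1 → |f s - f t| ≤ K * |s - t| := fun s t hs ht => by
    have := hK.dist_le_mul s (_root_.abs_le.1 hs) t (_root_.abs_le.1 ht)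
    rwa [Real.dist_eq, Real.dist_eq] at this
  have hfB : ∀ x, |f (u x)| ≤ K * 2 := fun x => by
    have h1 := hflip (u x) 1 (habs x) (by simp)
    rw [hf1, sub_zero] at h1
    refine h1.trans (mul_le_mul_of_nonneg_left ?_ K.2)
    exact _root_.abs_le.2 ⟨by linarith [(hrange x).1], by linarith [(hrange x).2]⟩
  have hell := hF.isElliptic ha
  have hsub : ∀ x p (X : ESp N →L[ℝ] ESp N), p ≠ 0 → JetAbove u x p (fun k => ⟪X k, k⟫) →
      -f (u x) ≤ ‖p‖ ^ α * Ftil (symMat X) := fun x p X hp hX => by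
    have := hsol.1.apply (contDiff_quadTest x p X) hX.isLocalMax (by rwa [gradient_quadTest])
    rwa [gradient_quadTest, hessianMatrix_quadTest] at this
  have hsup : ∀ x p (X : ESp N →L[ℝ] ESp N), p ≠ 0 → JetBelow u x p (fun k => ⟪X k, k⟫) →
      ‖p‖ ^ α * Ftil (symMat X) ≤ -f (u x) := fun x p X hp hX => by
    have := hsol.2.apply (contDiff_quadTest x p X) hX.isLocalMin (by rwa [gradient_quadTest])
    rwa [gradient_quadTest, hessianMatrix_quadTest] at this
  obtain ⟨L, hL, hLip⟩ := lipschitz_of_jets hell hα ha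
    (mul_nonneg (ha.le.trans haA) (Nat.cast_nonneg N)) (mul_nonneg K.2 zero_le_two) hu habs
    (fun x p X hp hX => (hsub x p X hp hX).trans' (neg_le_neg (_root_.abs_le.1 (hfB x)).2))
    (fun x p X hp hX => (hsup x p X hp hX).trans (neg_le.1 (_root_.abs_le.1 (hfB x)).1))
  obtain ⟨μ, hμ, hμg⟩ : ∃ μ : ℕ → ℝ, (∀ n, 0 < μ n) ∧ (α ≠ 0 → ∀ n : ℕ,
      GradGE (μ n) {x : ESp N | x 0 ∈ Set.Icc (-(n : ℝ) - 1) (n + 1)} u) := by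
    by_cases hα0 : α = 0
    · exact ⟨fun _ => 1, fun _ => one_pos, fun h => absurd hα0 h⟩
    · choose μ hμ hg using fun n : ℕ => hgrad hα0 (-(n : ℝ) - 1) (n + 1)
        (by linarith [n.cast_nonneg (α := ℝ)])
      exact ⟨μ, hμ, fun _ => hg⟩
  have hmem : ∀ (n : ℕ) (x : ESp N), |x 0| < n →
      x ∈ {x : ESp N | x 0 ∈ Set.Icc (-(n : ℝ) - 1) (n + 1)} := fun n x hx =>
    ⟨by linarith [(abs_lt.1 hx).1], by linarith [(abs_lt.1 hx).2]⟩
  have hRex : ∀ ε : ℝ, ∃ R : ℝ, 0 < ε → (∀ x : ESp N, R ≤ x 0 → 1 - ε ≤ u x) ∧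
      ∀ x : ESp N, x 0 ≤ -R → u x ≤ -1 + ε := fun ε => by
    by_cases hε : 0 < ε
    · obtain ⟨R₁, h1⟩ := hlimPos ε hε
      obtain ⟨R₂, h2⟩ := hlimNeg ε hε
      refine ⟨max R₁ (-R₂), fun _ => ⟨fun x hx => ?_, fun x hx => ?_⟩⟩
      · linarith [(abs_lt.1 (h1 x ((le_max_left _ _).trans hx))).1]
      · linarith [(abs_lt.1 (h2 x (by linarith [le_max_right R₁ (-R₂)]))).2]
    · exact ⟨0, fun h => absurd h hε⟩
  choose R hR using hRex
  have hh0 : 0 < ‖h‖ := norm_pos_iff.2 fun h0 => by simp [h0] at hh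
  have hcoord : h 0 ≤ ‖h‖ := (le_abs_self _).trans (PiLp.norm_apply_le h 0)
  obtain ⟨D, hD⟩ : ∃ D : GibbonsData (ESp N), D =
    { a := a, A := A * N, α := α, Lf := K, δ := δ₀, L := L, m := h 0 / ‖h‖
      G := fun X => Ftil (symMat X)
      f := f, e := EuclideanSpace.single 0 1, μ := μ, R := R
      a_pos := ha
      A_nonneg := mul_nonneg (ha.le.trans haA) (Nat.cast_nonneg N)
      Lf_nonneg := K.2
      δ_pos := hδ₀.1
      L_nonneg := hL
      m_pos := div_pos hh hh0
      m_le_one := (div_le_one hh0).2 hcoord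
      norm_e := by simp
      μ_pos := hμ
      ell := hell
      f_lip := hflip
      f_one := hf1
      f_neg_one := hfm1
      f_anti_pos := fun s t h1 h2 h3 => hmonoPos ⟨h1, h2.trans h3⟩ ⟨h1.trans h2, h3⟩ h2
      f_anti_neg := fun s t h1 h2 h3 => hmonoNeg ⟨h1, h2.trans h3⟩ ⟨h1.trans h2, h3⟩ h2 } :=
    ⟨_, rfl⟩
  have hDe : ∀ x, ⟪D.e, x⟫ = x 0 := fun x => by rw [hD]; exact inner_single_zero x
  have hadm : Adm D u :=
    { lip := by rw [hD]; exact hLip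
      abs_le := habs
      lim_pos := fun ε hε x hx => (hR ε hε).1 x (by rw [hDe, hD] at hx; exact hx)
      lim_neg := fun ε hε x hx => (hR ε hε).2 x (by rw [hDe, hD] at hx; exact hx)
      sub :=
        { visc := by rw [hD]; exact hsub
          grad := fun hα0 n x p X hx hX => by
            rw [hDe] at hx
            rw [hD] at hα0 ⊢
            have := hμg hα0 n _ (contDiff_quadTest x p X) x (hmem n x hx) (Or.inr hX.isLocalMax)
            rwa [gradient_quadTest] at this }
      super :=
        { visc := fun x p X hp hX => by
            have := hsup (-x) p (-X) hp (jetAbove_pointRefl_map_iff.1 hX)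
            rw [hD]
            simp only [GibbonsData.reflect, pointRefl, neg_neg]
            linarith
          grad := fun hα0 n x p X hx hX => by
            have hx' : |⟪D.e, x⟫| < n := hx
            rw [hDe] at hx'
            have hα1 : D.α ≠ 0 := hα0
            change D.μ n ≤ ‖p‖
            rw [hD] at hα1 ⊢
            have := hμg hα1 n _ (contDiff_quadTest (-x) p (-X)) (-x)
              (hmem n (-x) (by simpa using hx'))
              (Or.inl (jetAbove_pointRefl_map_iff.1 hX).isLocalMin)
            rwa [gradient_quadTest] at this } }
  refine hadm.lt_of_mem_cone ?_ (by rwa [hDe]) x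
  change D.m * ‖h‖ ≤ ⟪D.e, h⟫
  rw [hDe, hD, div_mul_cancel₀ _ hh0.ne']

theorem eq_of_coord_eq {u : ESp N → ℝ} (hu : Continuous u)
    (hmono : ∀ h : ESp N, 0 < h 0 → ∀ x, u x < u (x + h)) {x y : ESp N} (hxy : x 0 = y 0) :
    u x = u y := by
  have key : ∀ x y : ESp N, x 0 = y 0 → u x ≤ u y := fun x y hxy => by
    have ht : Tendsto (fun t : ℝ => u (y + t • EuclideanSpace.single 0 1)) (𝓝[>] 0) (𝓝 (u y)) := by
      have h1 : Tendsto (fun t : ℝ => u (y + t • EuclideanSpace.single 0 1)) (𝓝 0)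
          (𝓝 (u (y + (0 : ℝ) • EuclideanSpace.single 0 1))) := Continuous.tendsto (by fun_prop) 0
      rw [zero_smul, add_zero] at h1
      exact h1.mono_left nhdsWithin_le_nhds
    refine ge_of_tendsto ht ?_
    filter_upwards [self_mem_nhdsWithin] with t ht
    have ht' : 0 < t := ht
    have := hmono (y + t • EuclideanSpace.single 0 1 - x) (by simpa [hxy] using ht') x
    rw [add_sub_cancel] at this
    exact this.le
  exact le_antisymm (key x y hxy) (key y x hxy.symm)

end Main

/-- **Gibbons' conjecture for fully nonlinear operators** (Theorem 4.1).
A solution of `F(∇u, D²u) + f(u) = 0` in `ℝ^N` with values in `[-1,1]`, tending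
uniformly to `±1` as `x₁ → ±∞` (and with nonvanishing gradient on strips when
`α ≠ 0`), depends only on `x₁`: `u(x₁,x') = v(x₁)` with `v` increasing, a
one-dimensional viscosity solution of the equation, with limits `±1` at `±∞`. -/
theorem one_dimensionality
    (N : ℕ) [NeZero N] (a A α : ℝ) (ha : 0 < a) (haA : a ≤ A) (hα : -1 < α)
    (Ftil : Matrix (Fin N) (Fin N) ℝ → ℝ) (hF : UniformlyElliptic N a A Ftil)
    (f : ℝ → ℝ) (hf : ContDiffOn ℝ 1 f (Set.Icc (-1) 1))
    (hfm1 : f (-1) = 0) (hf1 : f 1 = 0)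
    (δ₀ : ℝ) (hδ₀ : δ₀ ∈ Set.Ioo (0:ℝ) 1)
    (hmonoNeg : AntitoneOn f (Set.Icc (-1) (-1 + δ₀)))
    (hmonoPos : AntitoneOn f (Set.Icc (1 - δ₀) 1))
    (u : ESp N → ℝ) (hu : Continuous u)
    (hrange : ∀ x, u x ∈ Set.Icc (-1 : ℝ) 1)
    (hsol : ViscSol α Ftil (fun _ s => -f s) Set.univ u)
    (hlimPos : ∀ ε > (0:ℝ), ∃ R : ℝ, ∀ x : ESp N, R ≤ x 0 → |u x - 1| < ε)
    (hlimNeg : ∀ ε > (0:ℝ), ∃ R : ℝ, ∀ x : ESp N, x 0 ≤ R → |u x + 1| < ε)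
    (hgrad : α ≠ 0 → ∀ b c : ℝ, b < c →
      ∃ m > (0:ℝ), GradGE m {x : ESp N | x 0 ∈ Set.Icc b c} u) :
    ∃ v : ℝ → ℝ,
      (∀ x : ESp N, u x = v (x 0)) ∧
      StrictMono v ∧
      (∀ t : ℝ, v t ∈ Set.Icc (-1 : ℝ) 1) ∧
      Tendsto v atTop (𝓝 1) ∧ Tendsto v atBot (𝓝 (-1)) ∧
      ViscSol1D α Ftil f v := by
  have hmono : ∀ h : ESp N, 0 < h 0 → ∀ x, u x < u (x + h) := fun h hh x =>
    lt_add_of_pos_coord ha haA hα hF hf hfm1 hf1 hδ₀ hmonoNeg hmonoPos hu hrange hsol hlimPos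
      hlimNeg hgrad hh x
  have huv : ∀ x, u x = u (EuclideanSpace.single 0 (x 0)) := fun x =>
    eq_of_coord_eq hu hmono (by simp)
  refine ⟨fun t => u (EuclideanSpace.single 0 t), huv, fun s t hst => ?_, fun t => hrange _, ?_, ?_,
    hsol.viscSol1D huv⟩
  · have := hmono (EuclideanSpace.single 0 t - EuclideanSpace.single 0 s) (by simpa using hst)
      (EuclideanSpace.single 0 s)
    rwa [add_sub_cancel] at this
  · refine Metric.tendsto_atTop.2 fun ε hε => ?_
    obtain ⟨R, hR⟩ := hlimPos ε hε
    exact ⟨R, fun t ht => by rw [Real.dist_eq]; exact hR _ (by simpa using ht)⟩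
  · refine Metric.tendsto_nhds.2 fun ε hε => ?_
    obtain ⟨R, hR⟩ := hlimNeg ε hε
    filter_upwards [eventually_le_atBot R] with t ht
    rw [Real.dist_eq, sub_neg_eq_add]
    exact hR _ (by simpa using ht)
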